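/- arXiv:2406.07326 — 3 statements merged into one kernel-verified Lean document; each statement's English description precedes it below -/
import Mathlib

section
/- Let q be a prime power, F a finite field with q^2 elements, and G ∈ F[x_0,...,x_4] a nonzero homogeneous polynomial of degree 2. Then |V(G)(F) ∩ V_3| ≤ 2(q^5 + q^2) + q^3 + 1. -/
open MvPolynomial

noncomputable section

/-- The projective space ℙ⁴(F): 1-dimensional F-linear subspaces of F⁵. -/
abbrev P4 (F : Type) [Field F] := Projectivization F (Fin 5 → F)

/-- The non-degenerate Hermitian threefold
    V₃ = {[x] ∈ ℙ⁴(F) : x₀^{q+1} + ⋯ + x₄^{q+1} = 0}. -/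
def hermV3 (q : ℕ) (F : Type) [Field F] : Set (P4 F) :=
  {x | ∑ i, x.rep i ^ (q + 1) = 0}

/-- V(G)(F) = {[x] ∈ ℙ⁴(F) : G(x) = 0}, for G homogeneous this is well defined. -/
def VG {F : Type} [Field F] (G : MvPolynomial (Fin 5) F) : Set (P4 F) :=
  {x | eval x.rep G = 0}

/-- The set of points of ℙ⁴(F) contained in an F-linear subspace of F⁵ of dimension k. -/
def IsLinSub (F : Type) [Field F] (k : ℕ) (S : Set (P4 F)) : Prop :=
  ∃ W : Submodule F (Fin 5 → F), Module.finrank F W = k ∧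
    S = {x : P4 F | x.submodule ≤ W}

/-- A line of ℙ⁴(F). -/
def IsLine (F : Type) [Field F] (S : Set (P4 F)) : Prop := IsLinSub F 2 S

/-- A plane of ℙ⁴(F). -/
def IsPlane (F : Type) [Field F] (S : Set (P4 F)) : Prop := IsLinSub F 3 S

/-- A hyperplane of ℙ⁴(F). -/
def IsHyperplane (F : Type) [Field F] (S : Set (P4 F)) : Prop := IsLinSub F 4 S

/-- The tangent hyperplane T_P(V₃) = {[x] : a₀^q x₀ + ⋯ + a₄^q x₄ = 0} where P = [a]. -/
def tangentHyp (q : ℕ) {F : Type} [Field F] (P : P4 F) : Set (P4 F) :=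
  {x | ∑ i, P.rep i ^ q * x.rep i = 0}

/-- A subset of ℙ⁴(F) is a tangent hyperplane to V₃ if it equals T_P(V₃) for some P ∈ V₃. -/
def IsTangentHyp (q : ℕ) {F : Type} [Field F] (S : Set (P4 F)) : Prop :=
  ∃ P ∈ hermV3 q F, S = tangentHyp q P

open Finset

/-- `σ` is the involutory automorphism `t ↦ t ^ q` of a field with `q ^ 2` elements. -/
structure IsHermConj {F : Type*} [Field F] [Fintype F] (σ : F →+* F) (q : ℕ) : Prop where
  two_le : 2 ≤ q
  card_eq : Fintype.card F = q ^ 2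
  apply_eq : ∀ t, σ t = t ^ q

theorem card_fiber_eq_of_le {α β : Type*} [DecidableEq β] {S : Finset α} {T : Finset β}
    {f : α → β} {m k : ℕ} (hf : ∀ a ∈ S, f a ∈ T)
    (hm : ∀ b ∈ T, #{a ∈ S | f a = b} ≤ m) (hT : #T ≤ k) (hS : #S = m * k) {b : β} (hb : b ∈ T) :
    #{a ∈ S | f a = b} = m := by
  by_contra hne
  have h1 : #S < ∑ _b ∈ T, m := by
    rw [card_eq_sum_card_fiberwise hf]
    exact sum_lt_sum hm ⟨b, hb, lt_of_le_of_ne (hm b hb) hne⟩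
  rw [sum_const, smul_eq_mul, hS, mul_comm] at h1
  exact absurd (Nat.mul_le_mul_right m hT) (by omega)

theorem card_le_of_forall_eval_eq_zero {F : Type*} [Field F] {S : Finset F} {p : Polynomial F}
    {m : ℕ} (hp : p ≠ 0) (hm : p.natDegree ≤ m) (hS : ∀ t ∈ S, p.eval t = 0) : #S ≤ m := by
  refine le_trans (Polynomial.card_le_degree_of_subset_roots fun t ht => ?_) hm
  rw [Polynomial.mem_roots hp]
  exact hS t ht

section Conj

variable {F : Type*} [Field F] [Fintype F] {σ : F →+* F} {q : ℕ}

theorem IsHermConj.conj_conj (hs : IsHermConj σ q) (t : F) : σ (σ t) = t := by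
  rw [hs.apply_eq, hs.apply_eq, ← pow_mul, ← sq, ← hs.card_eq, FiniteField.pow_card]

variable [DecidableEq F]

theorem IsHermConj.card_trace_fiber_le (hs : IsHermConj σ q) (d : F) :
    #{t : F | t + σ t = d} ≤ q := by
  have hq := hs.two_le
  have hdeg :
      (Polynomial.X ^ q + (Polynomial.X - Polynomial.C d) : Polynomial F).natDegree = q := by
    rw [Polynomial.natDegree_add_eq_left_of_natDegree_lt] <;>
      simp only [Polynomial.natDegree_X_pow, Polynomial.natDegree_X_sub_C]
    omega
  refine card_le_of_forall_eval_eq_zero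
    (p := Polynomial.X ^ q + (Polynomial.X - Polynomial.C d)) ?_ hdeg.le ?_
  · intro h
    rw [h, Polynomial.natDegree_zero] at hdeg
    omega
  · intro t ht
    simp only [mem_filter, mem_univ, true_and, hs.apply_eq] at ht
    simp only [Polynomial.eval_add, Polynomial.eval_sub, Polynomial.eval_pow, Polynomial.eval_X,
      Polynomial.eval_C, ← ht]
    ring

theorem IsHermConj.card_norm_fiber_le (hs : IsHermConj σ q) (d : F) :
    #{t : F | σ t * t = d} ≤ q + 1 := by
  refine card_le_of_forall_eval_eq_zero
    (p := Polynomial.X ^ (q + 1) - Polynomial.C d) ?_ ?_ ?_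
  · exact Polynomial.X_pow_sub_C_ne_zero (Nat.succ_pos q) d
  · exact (Polynomial.natDegree_X_pow_sub_C).le
  · intro t ht
    simp only [mem_filter, mem_univ, true_and, hs.apply_eq] at ht
    simp [← ht, pow_succ]

theorem IsHermConj.card_fixed_le (hs : IsHermConj σ q) : #{t : F | σ t = t} ≤ q := by
  have hq := hs.two_le
  refine card_le_of_forall_eval_eq_zero
    (p := Polynomial.X ^ q - Polynomial.X) ?_ ?_ ?_
  · exact FiniteField.X_pow_card_sub_X_ne_zero F (by omega)
  · exact (FiniteField.X_pow_card_sub_X_natDegree_eq F (by omega)).le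
  · intro t ht
    simp only [mem_filter, mem_univ, true_and, hs.apply_eq] at ht
    simp [ht]

theorem IsHermConj.card_trace_fiber (hs : IsHermConj σ q) {d : F} (hd : σ d = d) :
    #{t : F | t + σ t = d} = q := by
  refine card_fiber_eq_of_le (S := univ) (T := {t : F | σ t = t}) (f := fun t => t + σ t)
    (fun t _ => ?_) (fun b _ => hs.card_trace_fiber_le b) hs.card_fixed_le ?_ ?_
  · simp [hs.conj_conj, add_comm]
  · rw [card_univ, hs.card_eq, sq]
  · simpa using hd

theorem IsHermConj.card_norm_fiber (hs : IsHermConj σ q) {d : F} (hd : σ d = d) (hd0 : d ≠ 0) :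
    #{t : F | σ t * t = d} = q + 1 := by
  have hq := hs.two_le
  have key := card_fiber_eq_of_le (S := univ.erase (0 : F))
    (T := ({t : F | σ t = t} : Finset F).erase 0)
    (f := fun t => σ t * t) (m := q + 1) (k := q - 1) (b := d)
    (fun t ht => ?_) (fun b _ => ?_) ?_ ?_ ?_
  · rw [← key]
    congr 1
    ext t
    simp only [mem_filter, mem_univ, mem_erase, true_and, and_true]
    refine ⟨fun h => ⟨?_, h⟩, fun h => h.2⟩
    rintro rfl
    exact hd0 (by simp [← h])
  · simp only [mem_erase, mem_univ, and_true] at ht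
    simp [hs.conj_conj, mul_comm, ht]
  · exact le_trans (card_le_card (filter_subset_filter _ (subset_univ _)))
      (hs.card_norm_fiber_le b)
  · rw [card_erase_of_mem (by simp)]
    exact Nat.sub_le_sub_right hs.card_fixed_le 1
  · rw [card_erase_of_mem (mem_univ _), card_univ, hs.card_eq]
    obtain ⟨k, rfl⟩ : ∃ k, q = k + 1 := ⟨q - 1, by omega⟩
    simp only [Nat.add_sub_cancel]
    rw [show (k + 1) ^ 2 = (k + 1 + 1) * k + 1 by ring, Nat.add_sub_cancel]
  · simpa using ⟨hd0, hd⟩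

theorem IsHermConj.card_trace_mul_fiber (hs : IsHermConj σ q) {c d : F} (hc : c ≠ 0)
    (hd : σ d = d) : #{t : F | d + (t * c + σ (t * c)) = 0} = q := by
  rw [← hs.card_trace_fiber (d := -d) (by rw [map_neg, hd])]
  refine card_nbij' (· * c) (· * c⁻¹) ?_ ?_ ?_ ?_
  · intro t ht
    simp only [coe_filter, mem_univ, true_and, Set.mem_ofPred_eq] at ht ⊢
    linear_combination ht
  · intro t ht
    simp only [coe_filter, mem_univ, true_and, Set.mem_ofPred_eq] at ht ⊢
    rw [inv_mul_cancel_right₀ hc]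
    linear_combination ht
  · intro t _
    simp [hc]
  · intro t _
    simp [hc]

end Conj

theorem sum_sum_translate {V K M : Type*} [AddCommGroup V] [Fintype K] [AddCommMonoid M]
    {S : Finset V} {φ : K → V} (hS : ∀ y k, y + φ k ∈ S ↔ y ∈ S) (f : V → M) :
    ∑ y ∈ S, ∑ k, f (y + φ k) = Fintype.card K • ∑ y ∈ S, f y := by
  rw [sum_comm, ← card_univ, ← sum_const]
  refine sum_congr rfl fun k _ => ?_
  refine sum_nbij' (· + φ k) (· - φ k) ?_ ?_ ?_ ?_ ?_
  · intro y hy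
    exact (hS y k).2 hy
  · intro y hy
    exact (hS _ k).1 (by simpa using hy)
  · intro y _
    simp
  · intro y _
    simp
  · intro y _
    rfl

theorem card_mul_card_filter_of_translate {V K : Type*} [AddCommGroup V] [Fintype K]
    {S : Finset V} {φ : K → V} (hS : ∀ y k, y + φ k ∈ S ↔ y ∈ S) (P : V → Prop) [DecidablePred P] :
    Fintype.card K * #{y ∈ S | P y} = ∑ y ∈ S, #{k | P (y + φ k)} := by
  have h := sum_sum_translate hS (fun y => if P y then 1 else 0)
  simp only [card_filter]
  rw [h, smul_eq_mul]

theorem card_filter_le_of_translate {V K : Type*} [AddCommGroup V] [Fintype K]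
    {S : Finset V} {φ : K → V} (hS : ∀ y k, y + φ k ∈ S ↔ y ∈ S) (P : V → Prop) [DecidablePred P]
    {m : ℕ} (hm : ∀ y ∈ S, #{k | P (y + φ k)} ≤ m) :
    Fintype.card K * #{y ∈ S | P y} ≤ #S * m := by
  rw [card_mul_card_filter_of_translate hS, ← smul_eq_mul, ← sum_const]
  exact sum_le_sum hm

theorem card_filter_eq_of_translate {V K : Type*} [AddCommGroup V] [Fintype K]
    {S : Finset V} {φ : K → V} (hS : ∀ y k, y + φ k ∈ S ↔ y ∈ S) (P : V → Prop) [DecidablePred P]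
    {m : ℕ} (hm : ∀ y ∈ S, #{k | P (y + φ k)} = m) :
    Fintype.card K * #{y ∈ S | P y} = #S * m := by
  rw [card_mul_card_filter_of_translate hS, ← smul_eq_mul, ← sum_const]
  exact sum_congr rfl hm

section Herm

open scoped Classical

variable {F : Type*} [Field F] {σ : F →+* F} {q : ℕ} {ι : Type*}

theorem add_smul_mem_iff {W : Submodule F (ι → F)} {b : ι → F} (hb : b ∈ W) (y : ι → F) (t : F) :
    y + t • b ∈ W ↔ y ∈ W :=
  W.add_mem_iff_left (W.smul_mem t hb)

variable [Fintype ι]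

/-- The Hermitian form `∑ i, σ (x i) * y i`, as a linear functional of `y`. -/
def herm (σ : F →+* F) (x : ι → F) : (ι → F) →ₗ[F] F :=
  ∑ i, σ (x i) • LinearMap.proj i

theorem herm_apply (x y : ι → F) : herm σ x y = ∑ i, σ (x i) * y i := by
  simp [herm, LinearMap.sum_apply]

theorem herm_add_left (x x' y : ι → F) : herm σ (x + x') y = herm σ x y + herm σ x' y := by
  simp [herm_apply, add_mul, sum_add_distrib]

theorem herm_smul_left (t : F) (x y : ι → F) : herm σ (t • x) y = σ t * herm σ x y := by
  simp [herm_apply, mul_sum, mul_assoc]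

theorem eq_zero_of_herm_eq_zero {a : ι → F} (h : herm σ a = 0) : a = 0 := by
  funext i
  have := LinearMap.congr_fun h (Pi.single i 1)
  simpa [herm_apply, Pi.single_apply] using this

variable [Fintype F]

theorem conj_herm (hs : IsHermConj σ q) (x y : ι → F) : σ (herm σ x y) = herm σ y x := by
  simp [herm_apply, map_sum, hs.conj_conj, mul_comm]

theorem herm_eq_zero_comm (hs : IsHermConj σ q) {x y : ι → F} :
    herm σ x y = 0 ↔ herm σ y x = 0 := by
  rw [← conj_herm hs, map_eq_zero]

theorem exists_herm_eq (hs : IsHermConj σ q) (f : (ι → F) →ₗ[F] F) : ∃ a, herm σ a = f := by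
  refine ⟨fun i => σ (f (Pi.single i 1)), LinearMap.pi_ext' fun i => LinearMap.ext_ring ?_⟩
  simp [herm_apply, hs.conj_conj, Pi.single_apply]

theorem herm_add_smul_self (hs : IsHermConj σ q) (t : F) (x y : ι → F) :
    herm σ (y + t • x) (y + t • x) =
      herm σ y y + (t * herm σ y x + σ (t * herm σ y x)) + σ t * t * herm σ x x := by
  rw [map_mul, conj_herm hs]
  simp only [herm_add_left, herm_smul_left, map_add, map_smul, smul_eq_mul]
  ring

/-- On every line in a direction `a` that is isotropic but not orthogonal to the line, exactly
`q` vectors are isotropic. -/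
theorem card_isotropic_on_line (hs : IsHermConj σ q) {a y : ι → F} (ha : herm σ a a = 0)
    (hy : herm σ a y ≠ 0) : #{t : F | herm σ (y + t • a) (y + t • a) = 0} = q := by
  have hy' : herm σ y a ≠ 0 := fun h => hy ((herm_eq_zero_comm hs).1 h)
  rw [← hs.card_trace_mul_fiber hy' (conj_herm hs y y)]
  simp [herm_add_smul_self hs, ha]

/-- On every line in an anisotropic direction at most `q + 1` vectors are isotropic. -/
theorem card_isotropic_on_line_le (hs : IsHermConj σ q) {a : ι → F} (haa : herm σ a a ≠ 0)
    (y : ι → F) : #{t : F | herm σ (y + t • a) (y + t • a) = 0} ≤ q + 1 := by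
  set c := herm σ a y / herm σ a a with hc
  have h0 : herm σ (y - c • a) a = 0 := by
    rw [herm_eq_zero_comm hs]
    simp [hc, haa]
  refine le_trans (card_le_card_of_injOn (· + c) ?_ (add_left_injective c).injOn)
    (hs.card_norm_fiber_le (-herm σ (y - c • a) (y - c • a) / herm σ a a))
  intro t ht
  simp only [coe_filter, mem_univ, true_and, Set.mem_ofPred_eq] at ht ⊢
  have h2 : y + t • a = (y - c • a) + (t + c) • a := by
    rw [add_smul]
    abel
  rw [h2, herm_add_smul_self hs, h0] at ht
  rw [eq_div_iff haa]
  simp only [mul_zero, map_zero, add_zero] at ht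
  linear_combination ht

/-- The vectors of a totally isotropic subspace are pairwise orthogonal. -/
theorem herm_eq_zero_of_forall_isotropic (hs : IsHermConj σ q) {W : Submodule F (ι → F)}
    (hW : ∀ w ∈ W, herm σ w w = 0) {x y : ι → F} (hx : x ∈ W) (hy : y ∈ W) : herm σ x y = 0 := by
  have hq := hs.two_le
  by_contra h
  have h1 := card_isotropic_on_line hs (hW x hx) h
  rw [filter_true_of_mem fun t _ => hW _ ((add_smul_mem_iff hx y t).2 hy), card_univ,
    hs.card_eq] at h1
  nlinarith

variable [DecidableEq ι]

/-- The number of vectors of a subspace. -/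
def subCount (W : Submodule F (ι → F)) : ℕ := #{y : ι → F | y ∈ W}

/-- The number of isotropic vectors of a subspace, the zero vector included. -/
def isoCount (σ : F →+* F) (W : Submodule F (ι → F)) : ℕ :=
  #{y : ι → F | y ∈ W ∧ herm σ y y = 0}

theorem subCount_eq_pow (W : Submodule F (ι → F)) :
    subCount W = Fintype.card F ^ Module.finrank F W := by
  rw [← Module.card_eq_pow_finrank (K := F) (V := W), subCount, ← Fintype.card_subtype]

theorem one_le_isoCount (W : Submodule F (ι → F)) : 1 ≤ isoCount σ W :=
  card_pos.2 ⟨0, by simp⟩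

theorem isoCount_le_subCount (W : Submodule F (ι → F)) : isoCount σ W ≤ subCount W :=
  card_le_card (monotone_filter_right _ fun _ _ h => h.1)

theorem isoCount_mono {W W' : Submodule F (ι → F)} (h : W ≤ W') :
    isoCount σ W ≤ isoCount σ W' :=
  card_le_card (monotone_filter_right _ fun _ _ hy => ⟨h hy.1, hy.2⟩)

theorem card_mul_subCount_inf_ker {W : Submodule F (ι → F)} {f : (ι → F) →ₗ[F] F} {b : ι → F}
    (hb : b ∈ W) (hfb : f b ≠ 0) :
    Fintype.card F * subCount (W ⊓ LinearMap.ker f) = subCount W := by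
  have h := card_filter_eq_of_translate (S := {y : ι → F | y ∈ W}) (φ := fun t : F => t • b)
    (fun y t => by simpa using add_smul_mem_iff hb y t) (fun y => f y = 0) (m := 1) ?_
  · rw [mul_one] at h
    rw [subCount, subCount, ← h, filter_filter]
    simp
  · intro y _
    rw [card_eq_one]
    refine ⟨-f y / f b, ?_⟩
    ext t
    simp only [map_add, map_smul, smul_eq_mul, mem_filter, mem_univ, true_and, mem_singleton]
    rw [eq_div_iff hfb]
    constructor <;> intro h <;> linear_combination h

theorem isoCount_inf_of_isotropic (hs : IsHermConj σ q) {W : Submodule F (ι → F)} {a : ι → F}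
    (ha : a ∈ W) (haa : herm σ a a = 0) :
    q * isoCount σ W + subCount (W ⊓ LinearMap.ker (herm σ a)) =
      q * isoCount σ (W ⊓ LinearMap.ker (herm σ a)) + subCount W := by
  have hq := hs.two_le
  set W' := W ⊓ LinearMap.ker (herm σ a) with hW'
  have h := card_filter_eq_of_translate (S := {y : ι → F | y ∈ W ∧ herm σ a y ≠ 0})
    (φ := fun t : F => t • a) (fun y t => by simp [add_smul_mem_iff ha, haa])
    (fun y => herm σ y y = 0) (m := q)
    (fun y hy => card_isotropic_on_line hs haa (by simpa using (mem_filter.1 hy).2.2))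
  have h1 : subCount W = subCount W' + #{y : ι → F | y ∈ W ∧ herm σ a y ≠ 0} := by
    rw [subCount, ← card_filter_add_card_filter_not (fun y => herm σ a y = 0), filter_filter,
      filter_filter, subCount]
    simp [hW']
  have h2 : isoCount σ W = isoCount σ W' +
      #{y ∈ ({y : ι → F | y ∈ W ∧ herm σ a y ≠ 0} : Finset _) | herm σ y y = 0} := by
    rw [isoCount, ← card_filter_add_card_filter_not (fun y => herm σ a y = 0), filter_filter,
      filter_filter, isoCount, filter_filter]
    congr 2 <;> ext y <;> simp [hW'] <;> tauto
  rw [hs.card_eq] at h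
  have h3 : q * #{y ∈ ({y : ι → F | y ∈ W ∧ herm σ a y ≠ 0} : Finset _) | herm σ y y = 0} =
      #{y : ι → F | y ∈ W ∧ herm σ a y ≠ 0} := by
    refine Nat.eq_of_mul_eq_mul_right (by omega : 0 < q) ?_
    rw [← h]
    ring
  rw [h1, h2, mul_add, h3]
  ring

theorem isoCount_of_anisotropic (hs : IsHermConj σ q) {W : Submodule F (ι → F)} {a : ι → F}
    (ha : a ∈ W) (haa : herm σ a a ≠ 0) :
    isoCount σ W + q * isoCount σ (W ⊓ LinearMap.ker (herm σ a)) =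
      (q + 1) * subCount (W ⊓ LinearMap.ker (herm σ a)) := by
  set W' := W ⊓ LinearMap.ker (herm σ a) with hW'
  have hexp : ∀ y ∈ W', ∀ t : F, herm σ (y + t • a) (y + t • a) =
      herm σ y y + σ t * t * herm σ a a := by
    intro y hy t
    have : herm σ y a = 0 := (herm_eq_zero_comm hs).1 (by simpa using hy.2)
    rw [herm_add_smul_self hs, this]
    simp
  have hcount : isoCount σ W =
      #{p ∈ (({y : ι → F | y ∈ W'} : Finset _) ×ˢ (univ : Finset F)) |
        herm σ (p.1 + p.2 • a) (p.1 + p.2 • a) = 0} := by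
    rw [isoCount]
    refine card_nbij' (fun y => (y - (herm σ a y / herm σ a a) • a, herm σ a y / herm σ a a))
      (fun p => p.1 + p.2 • a) ?_ ?_ ?_ ?_
    · intro y hy
      simp only [coe_filter, mem_univ, true_and, Set.mem_ofPred_eq] at hy
      have : y - (herm σ a y / herm σ a a) • a ∈ W' :=
        ⟨W.sub_mem hy.1 (W.smul_mem _ ha), by simp [haa]⟩
      simp [hy.2, this]
    · intro p hp
      simp only [coe_filter, mem_product, mem_filter, mem_univ, true_and, and_true,
        Set.mem_ofPred_eq] at hp ⊢
      exact ⟨W.add_mem hp.1.1 (W.smul_mem _ ha), hp.2⟩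
    · intro y _
      simp
    · intro p hp
      simp only [coe_filter, mem_product, mem_filter, mem_univ, true_and, and_true,
        Set.mem_ofPred_eq] at hp
      have h0 : herm σ a p.1 = 0 := by simpa using hp.1.2
      ext <;> simp [h0, haa]
  have hfib : ∀ y ∈ W', #{t : F | herm σ (y + t • a) (y + t • a) = 0} +
      (if herm σ y y = 0 then q else 0) = q + 1 := by
    intro y hy
    simp only [hexp y hy]
    split_ifs with h0
    · rw [h0, add_comm]
      simp only [zero_add, mul_eq_zero, map_eq_zero, haa, or_false, or_self]
      rw [add_right_inj, card_eq_one]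
      exact ⟨0, by ext; simp⟩
    · rw [add_zero, ← hs.card_norm_fiber (d := -herm σ y y / herm σ a a)
        (by rw [map_div₀, map_neg, conj_herm hs, conj_herm hs])
        (div_ne_zero (neg_ne_zero.2 h0) haa)]
      congr 1
      ext t
      simp only [mem_filter, mem_univ, true_and]
      rw [eq_div_iff haa]
      constructor <;> intro h <;> linear_combination h
  have h1 : isoCount σ W =
      ∑ y : ι → F with y ∈ W', #{t : F | herm σ (y + t • a) (y + t • a) = 0} := by
    rw [hcount, card_filter, sum_product]
    simp only [card_filter]
  have h2 : q * isoCount σ W' = ∑ y : ι → F with y ∈ W', if herm σ y y = 0 then q else 0 := by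
    rw [← sum_filter, sum_const, filter_filter, smul_eq_mul, mul_comm, isoCount]
  rw [h1, h2, ← sum_add_distrib, sum_congr rfl fun y hy => hfib y (mem_filter.1 hy).2, sum_const,
    smul_eq_mul, mul_comm, subCount]

theorem finrank_le_of_forall_isotropic (hs : IsHermConj σ q) {W : Submodule F (ι → F)}
    (hW : ∀ w ∈ W, herm σ w w = 0) : 2 * Module.finrank F W ≤ Fintype.card ι := by
  have h1 : subCount W ≤ Nat.card W.dualAnnihilator := by
    rw [subCount, ← Fintype.card_subtype, ← Nat.card_eq_fintype_card]
    have : Finite (Module.Dual F (ι → F)) := Module.finite_of_finite F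
    refine Nat.card_le_card_of_injective (fun w : W => (⟨herm σ w.1, ?_⟩ : W.dualAnnihilator)) ?_
    · rw [Submodule.mem_dualAnnihilator]
      exact fun v hv => herm_eq_zero_of_forall_isotropic hs hW w.2 hv
    · intro w w' h
      have h' : herm σ w.1 = herm σ w'.1 := congrArg Subtype.val h
      refine Subtype.ext (sub_eq_zero.1 (eq_zero_of_herm_eq_zero (σ := σ) ?_))
      ext v
      have := herm_add_left (σ := σ) (w.1 - w'.1) w'.1
      simp only [sub_add_cancel] at this
      simp [eq_sub_of_add_eq (this _).symm, h']
  rw [Module.natCard_eq_pow_finrank (K := F), subCount_eq_pow, Nat.card_eq_fintype_card,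
    Nat.pow_le_pow_iff_right Fintype.one_lt_card] at h1
  have h2 := Subspace.finrank_add_finrank_dualAnnihilator_eq W
  rw [Module.finrank_fintype_fun_eq_card] at h2
  omega

end Herm

section Threefold

open scoped Classical

variable {F : Type*} [Field F] {σ : F →+* F} {q : ℕ}

/-- The subspace of `F ^ 5` where the first `k` coordinates vanish. -/
def coordSubspace (F : Type*) [Field F] (k : ℕ) : Submodule F (Fin 5 → F) where
  carrier := {x | ∀ i : Fin 5, i.1 < k → x i = 0}
  add_mem' hx hy i hi := by simp [hx i hi, hy i hi]
  zero_mem' _ _ := rfl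
  smul_mem' t x hx i hi := by simp [hx i hi]

theorem coordSubspace_inf_ker (k : Fin 5) :
    coordSubspace F k ⊓ LinearMap.ker (herm σ (Pi.single k 1)) = coordSubspace F (k + 1) := by
  ext x
  simp only [coordSubspace, Submodule.mem_inf, Submodule.mem_mk, AddSubmonoid.mem_mk,
    AddSubsemigroup.mem_mk, Set.mem_ofPred_eq, LinearMap.mem_ker, herm_apply, Pi.single_apply]
  simp only [apply_ite σ, map_one, map_zero, ite_mul, one_mul, zero_mul, sum_ite_eq', mem_univ,
    if_true]
  constructor
  · rintro ⟨h, hk⟩ i hi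
    rcases Nat.lt_succ_iff_lt_or_eq.1 hi with hi | hi
    · exact h i hi
    · rwa [Fin.ext hi]
  · exact fun h => ⟨fun i hi => h i (by omega), h k (by omega)⟩

variable [Fintype F]

theorem subCount_top (hs : IsHermConj σ q) : subCount (⊤ : Submodule F (Fin 5 → F)) = q ^ 10 := by
  rw [subCount_eq_pow, hs.card_eq, finrank_top, Module.finrank_fin_fun, ← pow_mul]

theorem isoCount_top (hs : IsHermConj σ q) :
    isoCount σ (⊤ : Submodule F (Fin 5 → F)) + q ^ 5 = q ^ 9 + q ^ 4 := by
  have step (k : Fin 5) :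
      q ^ 2 * subCount (coordSubspace F (k + 1)) = subCount (coordSubspace F k) ∧
      isoCount σ (coordSubspace F k) + q * isoCount σ (coordSubspace F (k + 1)) =
        (q + 1) * subCount (coordSubspace F (k + 1)) := by
    have hmem : (Pi.single k 1 : Fin 5 → F) ∈ coordSubspace F k := fun i hi =>
      Pi.single_eq_of_ne (Fin.ne_of_val_ne hi.ne) 1
    have hne : herm σ (Pi.single k 1) (Pi.single k 1 : Fin 5 → F) ≠ 0 := by
      simp [herm_apply, Pi.single_apply]
    rw [← coordSubspace_inf_ker (σ := σ), ← hs.card_eq]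
    exact ⟨card_mul_subCount_inf_ker hmem hne, isoCount_of_anisotropic hs hmem hne⟩
  have hbot : coordSubspace F 5 = ⊥ :=
    (Submodule.eq_bot_iff _).2 fun x hx => funext fun i => hx i i.2
  have htop : coordSubspace F 0 = ⊤ :=
    (Submodule.eq_top_iff').2 fun x i hi => absurd hi (Nat.not_lt_zero _)
  have h0 := step 0
  have h1 := step 1
  have h2 := step 2
  have h3 := step 3
  have h4 := step 4
  have hs5 : subCount (coordSubspace F 5) = 1 := by simp [hbot, subCount, filter_eq']
  have hi5 : isoCount σ (coordSubspace F 5) = 1 :=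
    le_antisymm (hs5 ▸ isoCount_le_subCount _) (one_le_isoCount _)
  norm_num [htop, hs5, hi5] at h0 h1 h2 h3 h4
  rw [← h4.1] at h3
  rw [← h3.1] at h2
  rw [← h2.1] at h1
  rw [← h1.1] at h0
  zify at *
  linear_combination h0.2 - q * h1.2 + q ^ 2 * h2.2 - q ^ 3 * h3.2 + q ^ 4 * h4.2

theorem subCount_ker_herm (hs : IsHermConj σ q) {a : Fin 5 → F} (ha : a ≠ 0) :
    subCount (LinearMap.ker (herm σ a)) = q ^ 8 := by
  have hq := hs.two_le
  obtain ⟨b, hb⟩ : ∃ b, herm σ a b ≠ 0 := by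
    by_contra! h
    exact ha (eq_zero_of_herm_eq_zero (LinearMap.ext h))
  have h := card_mul_subCount_inf_ker (W := ⊤) Submodule.mem_top hb
  rw [top_inf_eq, subCount_top hs, hs.card_eq] at h
  refine Nat.eq_of_mul_eq_mul_left (by positivity : 0 < q ^ 2) ?_
  rw [h]
  ring

theorem isoCount_ker_of_isotropic (hs : IsHermConj σ q) {a : Fin 5 → F} (ha : a ≠ 0)
    (haa : herm σ a a = 0) : isoCount σ (LinearMap.ker (herm σ a)) + q ^ 5 = q ^ 7 + q ^ 4 := by
  have hq := hs.two_le
  have h := isoCount_inf_of_isotropic hs (W := ⊤) Submodule.mem_top haa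
  rw [top_inf_eq, subCount_top hs, subCount_ker_herm hs ha] at h
  have ht := isoCount_top hs
  refine Nat.eq_of_mul_eq_mul_left (by omega : 0 < q) ?_
  zify at *
  linear_combination q * ht - h

theorem isoCount_ker_of_anisotropic (hs : IsHermConj σ q) {a : Fin 5 → F}
    (haa : herm σ a a ≠ 0) : isoCount σ (LinearMap.ker (herm σ a)) + q ^ 3 = q ^ 7 + q ^ 4 := by
  have hq := hs.two_le
  have ha : a ≠ 0 := by
    rintro rfl
    simp at haa
  have h := isoCount_of_anisotropic hs (W := ⊤) Submodule.mem_top haa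
  rw [top_inf_eq, subCount_ker_herm hs ha] at h
  have ht := isoCount_top hs
  refine Nat.eq_of_mul_eq_mul_left (by omega : 0 < q) ?_
  zify at *
  linear_combination h - ht

theorem isoCount_ker_le (hs : IsHermConj σ q) {a : Fin 5 → F} (ha : a ≠ 0) :
    isoCount σ (LinearMap.ker (herm σ a)) + q ^ 3 ≤ q ^ 7 + q ^ 4 := by
  by_cases haa : herm σ a a = 0
  · have := isoCount_ker_of_isotropic hs ha haa
    have : q ^ 3 ≤ q ^ 5 := Nat.pow_le_pow_right (by have := hs.two_le; omega) (by norm_num)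
    omega
  · exact (isoCount_ker_of_anisotropic hs haa).le

theorem le_isoCount_inf (hs : IsHermConj σ q) {a b : Fin 5 → F} (haa : herm σ a a ≠ 0)
    (hab : ∀ t : F, b ≠ t • a) :
    q ^ 5 + q ^ 2 ≤ isoCount σ (LinearMap.ker (herm σ a) ⊓ LinearMap.ker (herm σ b)) + q ^ 3 := by
  have hq := hs.two_le
  have ha : a ≠ 0 := by
    rintro rfl
    simp at haa
  set c := herm σ a b / herm σ a a with hc
  set b' := b - c • a with hb'
  have hb0 : b' ≠ 0 := sub_ne_zero.2 (hab c)
  have hab' : herm σ a b' = 0 := by simp [hb', hc, haa]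
  have hb'a : herm σ b' a = 0 := (herm_eq_zero_comm hs).1 hab'
  have hinf : LinearMap.ker (herm σ a) ⊓ LinearMap.ker (herm σ b) =
      LinearMap.ker (herm σ a) ⊓ LinearMap.ker (herm σ b') := by
    ext y
    simp only [Submodule.mem_inf, LinearMap.mem_ker]
    refine and_congr_right fun hy => ?_
    rw [show b = b' + c • a by simp [hb'], herm_add_left, herm_smul_left, hy, mul_zero, add_zero]
  have hmem : b' ∈ LinearMap.ker (herm σ a) := hab'
  obtain ⟨y, hy, hby⟩ : ∃ y ∈ LinearMap.ker (herm σ a), herm σ b' y ≠ 0 := by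
    obtain ⟨y, hy⟩ : ∃ y, herm σ b' y ≠ 0 := by
      by_contra! h
      exact hb0 (eq_zero_of_herm_eq_zero (LinearMap.ext h))
    refine ⟨y - (herm σ a y / herm σ a a) • a, ?_, ?_⟩
    · simp [haa]
    · simpa [hb'a] using hy
  have hcard := card_mul_subCount_inf_ker hy hby
  rw [subCount_ker_herm hs ha, hs.card_eq] at hcard
  have hcard' : subCount (LinearMap.ker (herm σ a) ⊓ LinearMap.ker (herm σ b')) = q ^ 6 := by
    refine Nat.eq_of_mul_eq_mul_left (by positivity : 0 < q ^ 2) ?_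
    rw [hcard]
    ring
  have hz := isoCount_ker_of_anisotropic hs haa
  rw [hinf]
  set p := isoCount σ (LinearMap.ker (herm σ a) ⊓ LinearMap.ker (herm σ b')) with hp
  by_cases hbb : herm σ b' b' = 0
  · have h := isoCount_inf_of_isotropic hs hmem hbb
    rw [hcard', subCount_ker_herm hs ha, ← hp] at h
    have h' : p + q ^ 3 = q ^ 5 + q ^ 4 := by
      refine Nat.eq_of_mul_eq_mul_left (by omega : 0 < q) ?_
      zify at *
      linear_combination q * hz - h
    have : q ^ 2 ≤ q ^ 4 := Nat.pow_le_pow_right (by omega) (by norm_num)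
    omega
  · have h := isoCount_of_anisotropic hs hmem hbb
    rw [hcard', ← hp] at h
    refine le_of_eq (Nat.eq_of_mul_eq_mul_left (by omega : 0 < q) ?_)
    zify at *
    linear_combination hz - h

/-- The union of two hyperplanes of `F ^ 5` has few isotropic vectors. -/
theorem card_isotropic_union_hyperplanes_le (hs : IsHermConj σ q) {a b : Fin 5 → F} (ha : a ≠ 0)
    (hb : b ≠ 0) :
    #{y : Fin 5 → F | (herm σ a y = 0 ∨ herm σ b y = 0) ∧ herm σ y y = 0} + q ^ 5 + q ^ 3 + q ^ 2 ≤
      2 * q ^ 7 + 2 * q ^ 4 := by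
  have hq := hs.two_le
  have key (a b : Fin 5 → F) :
      #{y : Fin 5 → F | (herm σ a y = 0 ∨ herm σ b y = 0) ∧ herm σ y y = 0} +
        isoCount σ (LinearMap.ker (herm σ a) ⊓ LinearMap.ker (herm σ b)) =
      isoCount σ (LinearMap.ker (herm σ a)) + isoCount σ (LinearMap.ker (herm σ b)) := by
    simp only [isoCount]
    symm
    rw [← card_union_add_card_inter, ← filter_or, ← filter_and]
    congr 2 <;> ext y <;> simp <;> tauto
  have h53 : q ^ 3 + q ^ 2 ≤ q ^ 5 := by
      nlinarith [pow_pos (by omega : 0 < q) 2, pow_pos (by omega : 0 < q) 3, Nat.mul_le_mul hq hq]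
  have h75 : q ^ 5 ≤ q ^ 7 := Nat.pow_le_pow_right (by omega) (by norm_num)
  have h42 : q ^ 2 ≤ q ^ 4 := Nat.pow_le_pow_right (by omega) (by norm_num)
  have aniso (a b : Fin 5 → F) (hb : b ≠ 0) (haa : herm σ a a ≠ 0) :
      #{y : Fin 5 → F | (herm σ a y = 0 ∨ herm σ b y = 0) ∧ herm σ y y = 0} +
        q ^ 5 + q ^ 3 + q ^ 2 ≤ 2 * q ^ 7 + 2 * q ^ 4 := by
    have h := key a b
    have h1 := isoCount_ker_of_anisotropic hs haa
    have h2 := isoCount_ker_le hs hb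
    by_cases hab : ∀ t : F, b ≠ t • a
    · have h3 := le_isoCount_inf hs haa hab
      omega
    · push Not at hab
      obtain ⟨t, rfl⟩ := hab
      have h3 : LinearMap.ker (herm σ a) ≤
          LinearMap.ker (herm σ a) ⊓ LinearMap.ker (herm σ (t • a)) := by
        intro y hy
        simp only [LinearMap.mem_ker] at hy
        simp [herm_smul_left, hy]
      have h4 := isoCount_mono (σ := σ) h3
      omega
  by_cases haa : herm σ a a = 0
  · by_cases hbb : herm σ b b = 0
    · have h := key a b
      have h1 := isoCount_ker_of_isotropic hs ha haa
      have h2 := isoCount_ker_of_isotropic hs hb hbb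
      omega
    · have := aniso b a ha hbb
      simpa only [or_comm] using this
  · exact aniso a b hb haa

end Threefold

section Quadric

open scoped Classical

variable {F : Type*} [Field F] {V : Type*} [AddCommGroup V] [Module F V]

theorem QuadraticMap.apply_add_smul (Q : QuadraticForm F V) (x y : V) (t : F) :
    Q (x + t • y) = Q x + t * Q.polarBilin x y + t * t * Q y := by
  rw [QuadraticMap.map_add Q, QuadraticMap.map_smul, QuadraticMap.polar_smul_right,
    QuadraticMap.polarBilin_apply_apply, smul_eq_mul, smul_eq_mul]
  ring

theorem QuadraticMap.polarBilin_comm (Q : QuadraticForm F V) (x y : V) :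
    Q.polarBilin x y = Q.polarBilin y x :=
  QuadraticMap.polar_comm Q x y

theorem QuadraticMap.polarBilin_self (Q : QuadraticForm F V) (x : V) :
    Q.polarBilin x x = 2 * Q x := by
  simp [QuadraticMap.polar_self]

/-- A quadratic form that vanishes on a hyperplane is a product of two linear forms. -/
theorem QuadraticMap.exists_eq_mul_of_vanish_ker (Q : QuadraticForm F V) {f : V →ₗ[F] F}
    (hf : f ≠ 0) (h : ∀ y, f y = 0 → Q y = 0) : ∃ g : V →ₗ[F] F, ∀ x, Q x = f x * g x := by
  obtain ⟨e, he⟩ : ∃ e, f e = 1 := LinearMap.surjective hf 1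
  refine ⟨Q.polarBilin e - Q e • f, fun x => ?_⟩
  have h1 := Q.apply_add_smul (x - f x • e) e (f x)
  rw [sub_add_cancel, h (x - f x • e) (by simp [he]), map_sub Q.polarBilin, map_smul Q.polarBilin,
    LinearMap.sub_apply, LinearMap.smul_apply, Q.polarBilin_self, smul_eq_mul,
    Q.polarBilin_comm x e] at h1
  rw [h1, LinearMap.sub_apply, LinearMap.smul_apply, smul_eq_mul]
  ring

end Quadric

section Threefold

open scoped Classical

variable {F : Type*} [Field F] [Fintype F] {σ : F →+* F} {q : ℕ}

theorem card_quadric_le_of_vanish_ker (hs : IsHermConj σ q) {Q : QuadraticForm F (Fin 5 → F)}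
    (hQ : Q ≠ 0) {f : (Fin 5 → F) →ₗ[F] F} (hf : f ≠ 0) (h : ∀ y, f y = 0 → Q y = 0) :
    #{y : Fin 5 → F | Q y = 0 ∧ herm σ y y = 0} + q ^ 5 + q ^ 3 + q ^ 2 ≤
      2 * q ^ 7 + 2 * q ^ 4 := by
  obtain ⟨g, hg⟩ := Q.exists_eq_mul_of_vanish_ker hf h
  obtain ⟨a, rfl⟩ := exists_herm_eq hs f
  obtain ⟨b, rfl⟩ := exists_herm_eq hs g
  have ha : a ≠ 0 := by
    rintro rfl
    exact hf (by ext; simp [herm_apply])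
  have hb : b ≠ 0 := by
    rintro rfl
    exact hQ (by ext x; simp [hg, herm_apply])
  simpa only [hg, mul_eq_zero] using card_isotropic_union_hyperplanes_le hs ha hb

/-- A two-dimensional affine subspace avoiding the origin has at most `q ^ 2 * (q + 1)` isotropic
vectors. -/
theorem card_isotropic_affine_le (hs : IsHermConj σ q) {K : Submodule F (Fin 5 → F)}
    {v : Fin 5 → F} (hK : Module.finrank F K = 2) (hv : v ∉ K) :
    #{u : Fin 5 → F | u ∈ K ∧ herm σ (v + u) (v + u) = 0} ≤ q ^ 2 * (q + 1) := by
  have hq := hs.two_le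
  have hcard : #{u : Fin 5 → F | u ∈ K} = q ^ 2 * q ^ 2 := by
    have := subCount_eq_pow K
    rw [subCount, hK, hs.card_eq] at this
    rw [this, sq (q ^ 2)]
  have line (m : ℕ) {w : Fin 5 → F} (hw : w ∈ K)
      (hm : ∀ y ∈ K, #{t : F | herm σ (v + (y + t • w)) (v + (y + t • w)) = 0} ≤ m) :
      #{u : Fin 5 → F | u ∈ K ∧ herm σ (v + u) (v + u) = 0} ≤ q ^ 2 * m := by
    have h := card_filter_le_of_translate (S := {y : Fin 5 → F | y ∈ K})
      (φ := fun t : F => t • w) (fun y t => by simpa using add_smul_mem_iff hw y t)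
      (fun u => herm σ (v + u) (v + u) = 0) (m := m) (fun y hy => hm y (by simpa using hy))
    rw [filter_filter, hcard, hs.card_eq, mul_assoc] at h
    exact Nat.le_of_mul_le_mul_left h (by positivity)
  by_cases hiso : ∃ w ∈ K, herm σ w w ≠ 0
  · obtain ⟨w, hw, hww⟩ := hiso
    refine line _ hw fun y _ => ?_
    simp only [← add_assoc]
    exact card_isotropic_on_line_le hs hww _
  push Not at hiso
  have hort {x y : Fin 5 → F} (hx : x ∈ K) (hy : y ∈ K) : herm σ x y = 0 :=
    herm_eq_zero_of_forall_isotropic hs hiso hx hy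
  by_cases hvw : ∃ w ∈ K, herm σ w v ≠ 0
  · obtain ⟨w, hw, hwv⟩ := hvw
    refine (line q hw fun y hy => ?_).trans (Nat.mul_le_mul_left _ (Nat.le_succ q))
    simp only [← add_assoc]
    refine (card_isotropic_on_line hs (hiso w hw) ?_).le
    rwa [map_add, hort hw hy, add_zero]
  push Not at hvw
  have hexp (u) (hu : u ∈ K) (t : F) : herm σ (u + t • v) (u + t • v) = σ t * t * herm σ v v := by
    have := hvw u hu
    simp [herm_add_smul_self hs, hiso u hu, this]
  by_cases hvv : herm σ v v = 0
  · have h3 : Module.finrank F (K ⊔ F ∙ v : Submodule F (Fin 5 → F)) ≤ 2 := by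
      have := finrank_le_of_forall_isotropic hs (W := K ⊔ F ∙ v) fun w hw => by
        obtain ⟨u, hu, z, hz, rfl⟩ := Submodule.mem_sup.1 hw
        obtain ⟨t, rfl⟩ := Submodule.mem_span_singleton.1 hz
        rw [hexp u hu, hvv, mul_zero]
      rw [Fintype.card_fin] at this
      omega
    have h4 : K < K ⊔ F ∙ v := by
      refine lt_of_le_of_ne le_sup_left fun h => hv ?_
      rw [h]
      exact Submodule.mem_sup_right (Submodule.mem_span_singleton_self v)
    have := Submodule.finrank_lt_finrank_of_lt h4
    omega
  · rw [filter_false_of_mem, card_empty]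
    · exact Nat.zero_le _
    · rintro u - ⟨hu, h⟩
      have := hexp u hu 1
      rw [one_smul, add_comm u v, h] at this
      exact hvv (by simpa using this.symm)

/-- A quadric containing a plane but no hyperplane through it has few isotropic vectors. -/
theorem card_quadric_le_of_plane (hs : IsHermConj σ q) {Q : QuadraticForm F (Fin 5 → F)}
    {U : Submodule F (Fin 5 → F)} (hU : Module.finrank F U = 3) (hQU : ∀ u ∈ U, Q u = 0)
    (hmax : ∀ v ∉ U, Q v = 0 → ∃ u ∈ U, Q.polarBilin v u ≠ 0) :
    #{y : Fin 5 → F | Q y = 0 ∧ herm σ y y = 0} + q ^ 5 + q ^ 3 + q ^ 2 ≤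
      2 * q ^ 7 + 2 * q ^ 4 := by
  have hq := hs.two_le
  have hcardU : #{u : Fin 5 → F | u ∈ U} = q ^ 6 := by
    have := subCount_eq_pow U
    rw [subCount, hU, hs.card_eq] at this
    rw [this, ← pow_mul]
  have inside : #{u : Fin 5 → F | u ∈ U ∧ herm σ u u = 0} ≤ q ^ 4 * (q + 1) := by
    obtain ⟨w, hw, hww⟩ : ∃ w ∈ U, herm σ w w ≠ 0 := by
      by_contra! h
      have := finrank_le_of_forall_isotropic hs h
      rw [Fintype.card_fin] at this
      omega
    have h := card_filter_le_of_translate (S := {y : Fin 5 → F | y ∈ U})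
      (φ := fun t : F => t • w) (fun y t => by simpa using add_smul_mem_iff hw y t)
      (fun u => herm σ u u = 0) (fun y _ => card_isotropic_on_line_le hs hww y)
    rw [filter_filter, hcardU, hs.card_eq, show q ^ 6 = q ^ 2 * q ^ 4 by ring, mul_assoc] at h
    exact Nat.le_of_mul_le_mul_left h (by positivity)
  have coset_of_zero (v : Fin 5 → F) (hv : v ∉ U) (hQv : Q v = 0) :
      #{u : Fin 5 → F | u ∈ U ∧ Q (v + u) = 0 ∧ herm σ (v + u) (v + u) = 0} ≤
        q ^ 2 * (q + 1) := by
    obtain ⟨u₁, hu₁, hne⟩ := hmax v hv hQv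
    have hK : Module.finrank F (U ⊓ LinearMap.ker (Q.polarBilin v) :
        Submodule F (Fin 5 → F)) = 2 := by
      have h := card_mul_subCount_inf_ker hu₁ hne
      rw [subCount_eq_pow, subCount_eq_pow, ← pow_succ', hU] at h
      exact Nat.succ_injective (Nat.pow_right_injective Fintype.one_lt_card h)
    refine (card_le_card ?_).trans (card_isotropic_affine_le hs hK (v := v) fun h => hv h.1)
    intro u hu
    simp only [mem_filter, mem_univ, true_and] at hu ⊢
    have := Q.apply_add_smul v u 1
    rw [one_smul, hu.2.1, hQv, hQU u hu.1] at this
    exact ⟨⟨hu.1, by simpa using this.symm⟩, hu.2.2⟩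
  have coset (v : Fin 5 → F) (hv : v ∉ U) :
      #{u : Fin 5 → F | u ∈ U ∧ Q (v + u) = 0 ∧ herm σ (v + u) (v + u) = 0} ≤
        q ^ 2 * (q + 1) := by
    rcases eq_empty_or_nonempty
      ({u : Fin 5 → F | u ∈ U ∧ Q (v + u) = 0 ∧ herm σ (v + u) (v + u) = 0} : Finset _) with h | h
    · rw [h, card_empty]
      exact Nat.zero_le _
    · obtain ⟨u₀, hu₀⟩ := h
      simp only [mem_filter, mem_univ, true_and] at hu₀
      refine le_trans (card_le_card_of_injOn (· - u₀) ?_ (sub_left_injective).injOn)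
        (coset_of_zero (v + u₀) (fun h => hv ((U.add_mem_iff_left hu₀.1).1 h)) hu₀.2.1)
      intro u hu
      simp only [coe_filter, mem_univ, true_and, Set.mem_ofPred_eq] at hu ⊢
      rw [add_add_sub_cancel]
      exact ⟨U.sub_mem hu.1 hu₀.1, hu.2⟩
  have outside : #{y : Fin 5 → F | y ∉ U ∧ Q y = 0 ∧ herm σ y y = 0} ≤
      (q ^ 4 - 1) * (q ^ 2 * (q + 1)) := by
    have h := card_filter_le_of_translate (S := {y : Fin 5 → F | y ∉ U})
      (φ := fun u : U => u.1) (fun y u => by simp [U.add_mem_iff_left u.2])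
      (fun y => Q y = 0 ∧ herm σ y y = 0) (m := q ^ 2 * (q + 1)) ?_
    · have hS : #{y : Fin 5 → F | y ∉ U} = q ^ 6 * (q ^ 4 - 1) := by
        have h1 := card_filter_add_card_filter_not (s := (univ : Finset (Fin 5 → F)))
          (fun y => y ∈ U)
        have h2 := subCount_top (F := F) hs
        simp only [subCount, Submodule.mem_top, filter_true] at h2
        rw [hcardU, h2] at h1
        have h3 : q ^ 10 = q ^ 6 * q ^ 4 := by ring
        rw [Nat.mul_sub, mul_one]
        omega
      rw [filter_filter, hS, Fintype.card_subtype, hcardU, mul_assoc] at h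
      exact Nat.le_of_mul_le_mul_left h (by positivity)
    · intro y hy
      refine le_trans (le_of_eq ?_) (coset y (by simpa using hy))
      refine card_nbij (fun u : U => u.1) ?_ Subtype.val_injective.injOn ?_
      · intro u hu
        simpa using hu
      · intro u hu
        simp only [coe_filter, mem_univ, true_and, Set.mem_ofPred_eq] at hu
        exact ⟨⟨u, hu.1⟩, by simpa using hu.2, rfl⟩
  have total : #{y : Fin 5 → F | Q y = 0 ∧ herm σ y y = 0} ≤
      q ^ 4 * (q + 1) + (q ^ 4 - 1) * (q ^ 2 * (q + 1)) := by
    rw [← card_filter_add_card_filter_not (fun y => y ∈ U), filter_filter, filter_filter]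
    refine add_le_add (le_trans (card_le_card ?_) inside) (le_trans (card_le_card ?_) outside) <;>
    · intro y
      simp only [mem_filter, mem_univ, true_and]
      tauto
  obtain ⟨k, rfl⟩ : ∃ k, q = k + 2 := ⟨q - 2, by omega⟩
  have h4 : 1 ≤ (k + 2) ^ 4 := Nat.one_le_pow _ _ (by omega)
  zify [h4] at total ⊢
  have : (0 : ℤ) ≤ (k + 2) ^ 4 * (k ^ 3 + 5 * k ^ 2 + 6 * k + 1) := by positivity
  nlinarith

end Threefold

section Frames

open scoped Classical

variable {F : Type*} [Field F] {σ : F →+* F} {q : ℕ} {ι : Type*} [Fintype ι]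

/-- A pair of vectors spanning a totally isotropic plane. -/
structure IsFrame (σ : F →+* F) (x y : ι → F) : Prop where
  linearIndependent : LinearIndependent F ![x, y]
  left : herm σ x x = 0
  mid : herm σ x y = 0
  right : herm σ y y = 0

theorem isFrame_of_notMem_span {x y : ι → F} (hx : x ≠ 0) (hxx : herm σ x x = 0)
    (hxy : herm σ x y = 0) (hyy : herm σ y y = 0) (hy : y ∉ Submodule.span F {x}) :
    IsFrame σ x y := by
  refine ⟨(LinearIndependent.pair_iff' hx).2 fun t ht => hy ?_, hxx, hxy, hyy⟩
  rw [← ht]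
  exact Submodule.smul_mem _ _ (Submodule.mem_span_singleton_self x)

theorem IsFrame.ne_zero {x y : ι → F} (h : IsFrame σ x y) : x ≠ 0 :=
  h.linearIndependent.ne_zero 0

theorem IsFrame.notMem_span {x y : ι → F} (h : IsFrame σ x y) : y ∉ Submodule.span F {x} := by
  intro hy
  obtain ⟨t, ht⟩ := Submodule.mem_span_singleton.1 hy
  exact (LinearIndependent.pair_iff' h.ne_zero).1 h.linearIndependent t ht

variable [Fintype F]

theorem IsFrame.symm (hs : IsHermConj σ q) {x y : ι → F} (h : IsFrame σ x y) : IsFrame σ y x :=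
  ⟨LinearIndependent.pair_symm_iff.1 h.linearIndependent, h.right,
    (herm_eq_zero_comm hs).1 h.mid, h.left⟩

theorem isFrame_comm (hs : IsHermConj σ q) {x y : ι → F} : IsFrame σ x y ↔ IsFrame σ y x :=
  ⟨IsFrame.symm hs, IsFrame.symm hs⟩

theorem IsFrame.add_smul (hs : IsHermConj σ q) {x y : ι → F} (h : IsFrame σ x y) (t : F) :
    IsFrame σ (x + t • y) y := by
  refine ⟨?_, ?_, ?_, h.right⟩
  · rw [LinearIndependent.pair_iff]
    intro a b hab
    have := LinearIndependent.pair_iff.1 h.linearIndependent a (a * t + b) (by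
      rw [← hab]
      module)
    refine ⟨this.1, ?_⟩
    simpa [this.1] using this.2
  · simp [herm_add_smul_self hs, h.left, h.mid, h.right]
  · simp [herm_add_left, herm_smul_left, h.mid, h.right]

theorem isFrame_add_smul_iff (hs : IsHermConj σ q) {x y : ι → F} (t : F) :
    IsFrame σ (x + t • y) y ↔ IsFrame σ x y := by
  refine ⟨fun h => ?_, fun h => h.add_smul hs t⟩
  have := h.add_smul hs (-t)
  rwa [neg_smul, add_neg_cancel_right] at this

variable [DecidableEq ι]

theorem subCount_span_singleton {x : ι → F} (hx : x ≠ 0) :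
    subCount (Submodule.span F {x}) = Fintype.card F := by
  rw [subCount_eq_pow, finrank_span_singleton hx, pow_one]

theorem card_isFrame_add (hs : IsHermConj σ q) {x : ι → F} (hx : x ≠ 0) (hxx : herm σ x x = 0) :
    #{y : ι → F | IsFrame σ x y} + q ^ 2 = isoCount σ (LinearMap.ker (herm σ x)) := by
  rw [← hs.card_eq, ← subCount_span_singleton hx, subCount, isoCount, ← card_union_of_disjoint]
  · congr 1
    ext y
    simp only [mem_union, mem_filter, mem_univ, true_and, LinearMap.mem_ker]
    constructor
    · rintro (h | h)
      · exact ⟨h.mid, h.right⟩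
      · obtain ⟨t, rfl⟩ := Submodule.mem_span_singleton.1 h
        simp [herm_smul_left, hxx]
    · rintro ⟨h1, h2⟩
      by_cases hy : y ∈ Submodule.span F {x}
      · exact Or.inr hy
      · exact Or.inl (isFrame_of_notMem_span hx hxx h1 h2 hy)
  · refine disjoint_filter.2 fun y _ h => h.notMem_span

end Frames

section Pencil

open scoped Classical

variable {F : Type*} [Field F] {V : Type*} [AddCommGroup V] [Module F V]

/-- The quadratic form vanishes on the line through the two vectors. -/
def LineIn (Q : QuadraticForm F V) (x y : V) : Prop :=
  Q x = 0 ∧ Q.polarBilin x y = 0 ∧ Q y = 0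

/-- The line through `x` and `y` meets the quadric in `x` only, with multiplicity two. -/
def LineTangent (Q : QuadraticForm F V) (x y : V) : Prop :=
  Q x = 0 ∧ Q.polarBilin x y = 0 ∧ Q y ≠ 0

theorem card_quadratic_zeros_add_le [Fintype F] (a b c : F) :
    #{t : F | c + t * b + t * t * a = 0} + (if a = 0 then 1 else 0) +
      #{t : F | c + t * b + t * t * a = 0 ∧ b + t * (2 * a) = 0 ∧ a ≠ 0} +
      (if a = 0 ∧ b = 0 ∧ c ≠ 0 then 1 else 0) ≤
    2 + if c = 0 ∧ b = 0 ∧ a = 0 then Fintype.card F - 1 else 0 := by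
  have hpos : 1 ≤ Fintype.card F := Fintype.card_pos
  by_cases ha : a = 0
  · subst ha
    by_cases hb : b = 0
    · subst hb
      by_cases hc : c = 0
      · simp [hc]
        omega
      · simp [hc]
    · have : #{t : F | c + t * b = 0} ≤ 1 := by
        rw [card_le_one]
        simp only [mem_filter, mem_univ, true_and]
        intro t ht u hu
        exact mul_right_cancel₀ hb (by linear_combination ht - hu)
      simp [hb]
      omega
  · simp only [ha, if_false, false_and, and_false, add_zero, ne_eq, not_false_eq_true, and_true]
    by_cases hd : ∃ t : F, c + t * b + t * t * a = 0 ∧ b + t * (2 * a) = 0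
    · obtain ⟨t, h1, h2⟩ := hd
      have h3 : #{t : F | c + t * b + t * t * a = 0} ≤ 1 := by
        have key (u : F) (hu : c + u * b + u * u * a = 0) : u = t := by
          have : (u - t) * (u - t) * a = 0 := by linear_combination hu - h1 - (u - t) * h2
          simpa [ha, sub_eq_zero] using this
        rw [card_le_one]
        simp only [mem_filter, mem_univ, true_and]
        intro u hu v hv
        rw [key u hu, key v hv]
      have h4 := card_le_card (s := ({t : F | c + t * b + t * t * a = 0 ∧ b + t * (2 * a) = 0} :
        Finset F)) (monotone_filter_right univ fun t _ h => h.1)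
      exact (add_le_add h3 (h4.trans h3))
    · rw [filter_false_of_mem (s := univ)
        (p := fun t : F => c + t * b + t * t * a = 0 ∧ b + t * (2 * a) = 0)
        (fun t _ h => hd ⟨t, h⟩), card_empty, add_zero]
      refine card_le_of_forall_eval_eq_zero
        (p := Polynomial.C a * Polynomial.X ^ 2 + Polynomial.C b * Polynomial.X + Polynomial.C c)
        ?_ (Polynomial.natDegree_quadratic_le) ?_
      · intro h
        have := congrArg (fun p => Polynomial.coeff p 2) h
        simp at this
        exact ha this
      · intro t ht
        simp only [mem_filter, mem_univ, true_and] at ht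
        simp only [Polynomial.eval_add, Polynomial.eval_mul, Polynomial.eval_C,
          Polynomial.eval_pow, Polynomial.eval_X]
        linear_combination ht

theorem card_zeros_add_card_tangent_le [Fintype F] (Q : QuadraticForm F V) (x y : V) :
    #{t : F | Q (x + t • y) = 0} + (if Q y = 0 then 1 else 0) +
      #{t : F | LineTangent Q (x + t • y) y} + (if LineTangent Q y x then 1 else 0) ≤
    2 + if LineIn Q x y then Fintype.card F - 1 else 0 := by
  have hB (t : F) : Q.polarBilin (x + t • y) y = Q.polarBilin x y + t * (2 * Q y) := by
    rw [map_add Q.polarBilin, map_smul Q.polarBilin, LinearMap.add_apply, LinearMap.smul_apply,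
      Q.polarBilin_self, smul_eq_mul]
  simp only [LineIn, LineTangent, Q.apply_add_smul x y, hB, Q.polarBilin_comm y x]
  convert card_quadratic_zeros_add_le (Q y) (Q.polarBilin x y) (Q x)
  congr

end Pencil

section DoubleCount

theorem sum_card_filter_comm {α : Type*} [Fintype α] (P : α → α → Prop)
    [∀ x y, Decidable (P x y)] :
    ∑ y, #{x | P x y} = ∑ x, #{y | P x y} := by
  simp only [card_filter]
  exact sum_comm

open scoped Classical

variable {F : Type*} [Field F] [Fintype F] {σ : F →+* F} {q : ℕ} {ι : Type*} [Fintype ι]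
  [DecidableEq ι]

theorem card_frames_le_of_right (hs : IsHermConj σ q) (Q : QuadraticForm F (ι → F)) (y : ι → F) :
    q ^ 2 * #{x | IsFrame σ x y ∧ Q x = 0} + #{x | IsFrame σ x y ∧ Q y = 0} +
      q ^ 2 * #{x | IsFrame σ x y ∧ LineTangent Q x y} +
      #{x | IsFrame σ x y ∧ LineTangent Q y x} ≤
    2 * #{x | IsFrame σ x y} + (q ^ 2 - 1) * #{x | IsFrame σ x y ∧ LineIn Q x y} := by
  have hS (x : ι → F) (t : F) : x + t • y ∈ ({x | IsFrame σ x y} : Finset (ι → F)) ↔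
      x ∈ ({x | IsFrame σ x y} : Finset (ι → F)) := by
    simpa using isFrame_add_smul_iff hs t
  have h := sum_le_sum (s := ({x | IsFrame σ x y} : Finset (ι → F)))
    fun x _ => card_zeros_add_card_tangent_le Q x y
  simp only [sum_add_distrib] at h
  rw [← card_mul_card_filter_of_translate hS (fun x => Q x = 0),
    ← card_mul_card_filter_of_translate hS (fun x => LineTangent Q x y), ← card_filter,
    ← card_filter, ← sum_filter, sum_const, sum_const, smul_eq_mul, smul_eq_mul, hs.card_eq] at h
  simp only [filter_filter] at h
  linarith

theorem card_frames_le (hs : IsHermConj σ q) (Q : QuadraticForm F (ι → F)) :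
    (q ^ 2 + 1) * ∑ x : ι → F, #{y | IsFrame σ x y ∧ Q x = 0} +
      (q ^ 2 + 1) * ∑ x : ι → F, #{y | IsFrame σ x y ∧ LineTangent Q x y} ≤
    2 * ∑ x : ι → F, #{y | IsFrame σ x y} +
      (q ^ 2 - 1) * ∑ x : ι → F, #{y | IsFrame σ x y ∧ LineIn Q x y} := by
  have h := sum_le_sum (s := univ) fun y _ => card_frames_le_of_right hs Q y
  simp only [sum_add_distrib, ← mul_sum] at h
  have h1 : ∑ y : ι → F, #{x | IsFrame σ x y ∧ Q y = 0} =
      ∑ x : ι → F, #{y | IsFrame σ x y ∧ Q x = 0} :=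
    sum_congr rfl fun x _ => by simp only [isFrame_comm hs (y := x)]
  have h2 : ∑ y : ι → F, #{x | IsFrame σ x y ∧ LineTangent Q y x} =
      ∑ x : ι → F, #{y | IsFrame σ x y ∧ LineTangent Q x y} :=
    sum_congr rfl fun x _ => by simp only [isFrame_comm hs (x := x)]
  rw [h1, h2, sum_card_filter_comm (fun x y => IsFrame σ x y ∧ Q x = 0),
    sum_card_filter_comm (fun x y => IsFrame σ x y ∧ LineTangent Q x y),
    sum_card_filter_comm (fun x y => IsFrame σ x y),
    sum_card_filter_comm (fun x y => IsFrame σ x y ∧ LineIn Q x y)] at h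
  linarith

end DoubleCount

section Pencil

variable {F : Type*} [Field F] {V : Type*} [AddCommGroup V] [Module F V]

theorem mem_sup_span_singleton_iff {W : Submodule F V} {z u : V} :
    u ∈ W ⊔ F ∙ z ↔ ∃ w ∈ W, ∃ t : F, w + t • z = u := by
  simp [Submodule.mem_sup, Submodule.mem_span_singleton]

theorem vanish_sup_span {Q : QuadraticForm F V} {W : Submodule F V} {z : V} (hW : ∀ w ∈ W, Q w = 0)
    (hz : Q z = 0) (hB : ∀ w ∈ W, Q.polarBilin w z = 0) : ∀ u ∈ W ⊔ F ∙ z, Q u = 0 := by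
  intro u hu
  obtain ⟨w, hw, t, rfl⟩ := mem_sup_span_singleton_iff.1 hu
  simp [Q.apply_add_smul, hW w hw, hz, hB w hw]

theorem finrank_sup_span [FiniteDimensional F V] {W : Submodule F V} {z : V} (hz : z ∉ W) :
    Module.finrank F (W ⊔ F ∙ z : Submodule F V) = Module.finrank F W + 1 := by
  have h0 : z ≠ 0 := fun h => hz (h ▸ W.zero_mem)
  have hd : Disjoint W (F ∙ z) := (Submodule.disjoint_span_singleton' h0).2 hz
  rw [← finrank_span_singleton (K := F) h0, ← Submodule.finrank_sup_add_finrank_inf_eq, hd.eq_bot,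
    finrank_bot, add_zero]

theorem mem_span_pair_iff {x y u : V} :
    u ∈ (F ∙ x ⊔ F ∙ y : Submodule F V) ↔ ∃ a b : F, a • x + b • y = u := by
  simp [Submodule.mem_sup, Submodule.mem_span_singleton]

theorem polarBilin_smul_add_smul (Q : QuadraticForm F V) (a b : F) (x y z : V) :
    Q.polarBilin (a • x + b • y) z = a * Q.polarBilin x z + b * Q.polarBilin y z := by
  rw [map_add Q.polarBilin, map_smul Q.polarBilin, map_smul Q.polarBilin]
  rfl

theorem LineIn.apply_eq_zero {Q : QuadraticForm F V} {x y : V} (h : LineIn Q x y) :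
    ∀ u ∈ (F ∙ x ⊔ F ∙ y : Submodule F V), Q u = 0 := by
  intro u hu
  obtain ⟨a, b, rfl⟩ := mem_span_pair_iff.1 hu
  simp [Q.apply_add_smul, QuadraticMap.map_smul, h.1, h.2.2, h.2.1]

/-- If a quadric contains no plane, then three of its points that are pairwise joined by lines of
the quadric are collinear. -/
theorem mem_span_pair_of_lineIn [FiniteDimensional F V] {Q : QuadraticForm F V}
    (hQ : ∀ U : Submodule F V, Module.finrank F U = 3 → ∃ u ∈ U, Q u ≠ 0) {x y z : V}
    (hx : x ≠ 0) (hy : y ∉ F ∙ x) (hxy : LineIn Q x y) (hxz : LineIn Q x z)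
    (hyz : Q.polarBilin y z = 0) : z ∈ (F ∙ x ⊔ F ∙ y : Submodule F V) := by
  by_contra hz
  obtain ⟨u, hu, hne⟩ := hQ (F ∙ x ⊔ F ∙ y ⊔ F ∙ z)
    (by rw [finrank_sup_span hz, finrank_sup_span hy, finrank_span_singleton hx])
  refine hne (vanish_sup_span hxy.apply_eq_zero hxz.2.2 (fun w hw => ?_) u hu)
  obtain ⟨a, b, rfl⟩ := mem_span_pair_iff.1 hw
  rw [polarBilin_smul_add_smul, hxz.2.1, hyz]
  simp

end Pencil

section Local

open scoped Classical

variable {F : Type*} [Field F] [Fintype F] {σ : F →+* F} {q : ℕ}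

theorem card_sdiff_span {ι : Type*} [Fintype ι] [DecidableEq ι] {x y : ι → F} (hx : x ≠ 0)
    (hy : y ∉ F ∙ x) :
    #{u : ι → F | u ∈ (F ∙ x ⊔ F ∙ y : Submodule F (ι → F)) ∧ u ∉ F ∙ x} + Fintype.card F =
      Fintype.card F ^ 2 := by
  have h1 : subCount (F ∙ x ⊔ F ∙ y : Submodule F (ι → F)) = Fintype.card F ^ 2 := by
    rw [subCount_eq_pow, finrank_sup_span hy, finrank_span_singleton hx]
  have h2 := card_filter_add_card_filter_not
    (s := ({u : ι → F | u ∈ (F ∙ x ⊔ F ∙ y : Submodule F (ι → F))} : Finset (ι → F)))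
    (fun u => u ∈ F ∙ x)
  rw [filter_filter, filter_filter] at h2
  rw [← h1, ← subCount_span_singleton hx, subCount, subCount, ← h2, add_comm]
  refine congrArg₂ (· + ·) (congrArg card ?_) rfl
  ext u
  simp only [mem_filter, mem_univ, true_and]
  exact ⟨fun h => ⟨le_sup_left (a := F ∙ x) h, h⟩, fun h => h.2⟩

theorem card_frames_lineIn_le_of_tangent (hs : IsHermConj σ q) {Q : QuadraticForm F (Fin 5 → F)}
    (hQ : ∀ U : Submodule F (Fin 5 → F), Module.finrank F U = 3 → ∃ u ∈ U, Q u ≠ 0)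
    {x : Fin 5 → F} (hx : x ≠ 0) (hxx : herm σ x x = 0) (hQx : Q x = 0)
    (htan : ∀ y, herm σ x y = 0 → Q.polarBilin x y = 0) :
    (q ^ 2 - 1) * #{y | IsFrame σ x y ∧ LineIn Q x y} ≤
      (q ^ 2 + 1) * #{y | IsFrame σ x y ∧ LineTangent Q x y} +
        (q ^ 2 - 1) * (q ^ 2 * (q ^ 2 - 1)) := by
  have hq := hs.two_le
  have hK : #{y | IsFrame σ x y ∧ LineIn Q x y} + #{y | IsFrame σ x y ∧ LineTangent Q x y} +
      q ^ 2 + q ^ 5 = q ^ 7 + q ^ 4 := by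
    rw [← isoCount_ker_of_isotropic hs hx hxx, ← card_isFrame_add hs hx hxx,
      ← card_filter_add_card_filter_not (s := {y | IsFrame σ x y}) (fun y => Q y = 0),
      filter_filter, filter_filter]
    refine congrArg₂ (fun a b => a + b + q ^ 2 + q ^ 5) (congrArg card ?_) (congrArg card ?_) <;>
    · ext y
      rw [mem_filter, mem_filter]
      simp only [mem_univ, true_and, LineIn, LineTangent]
      have := htan y
      exact ⟨fun h => ⟨h.1, h.2.2.2⟩, fun h => ⟨h.1, hQx, this h.1.mid, h.2⟩⟩
  rcases eq_empty_or_nonempty ({y | IsFrame σ x y ∧ LineIn Q x y} : Finset (Fin 5 → F)) with h | h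
  · rw [h, card_empty, mul_zero]
    exact Nat.zero_le _
  obtain ⟨y₀, hy₀⟩ := h
  simp only [mem_filter, mem_univ, true_and] at hy₀
  obtain ⟨hfr, hin⟩ := hy₀
  set P : Submodule F (Fin 5 → F) := F ∙ x ⊔ F ∙ y₀ with hP
  have hy₀P : y₀ ∈ P := Submodule.mem_sup_right (Submodule.mem_span_singleton_self y₀)
  have hPle : P ≤ LinearMap.ker (herm σ x) := by
    rw [hP, sup_le_iff, Submodule.span_singleton_le_iff_mem, Submodule.span_singleton_le_iff_mem]
    exact ⟨hxx, hfr.mid⟩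
  have hS : #{y | herm σ x y = 0 ∧ y ∉ P} + q ^ 4 = q ^ 8 := by
    have h1 : subCount P = q ^ 4 := by
      rw [subCount_eq_pow, hP, finrank_sup_span hfr.notMem_span, finrank_span_singleton hx,
        hs.card_eq, ← pow_mul]
    rw [← h1, ← subCount_ker_herm hs hx, subCount, subCount, add_comm]
    have h2 := card_filter_add_card_filter_not
      (s := ({y | y ∈ LinearMap.ker (herm σ x)} : Finset (Fin 5 → F))) (fun y => y ∈ P)
    rw [filter_filter, filter_filter] at h2
    rw [← h2]
    refine congrArg₂ (· + ·) (congrArg card ?_) rfl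
    ext u
    simp only [mem_filter, mem_univ, true_and]
    exact ⟨fun h => ⟨hPle h, h⟩, fun h => h.2⟩
  have hlines := card_filter_le_of_translate (S := {y | herm σ x y = 0 ∧ y ∉ P})
    (φ := fun t : F => t • y₀) (fun y t => by simp [add_smul_mem_iff hy₀P, hfr.mid])
    (fun y => Q y = 0) (m := 1) (fun y hy => ?_)
  · have hC : #{y | IsFrame σ x y ∧ LineIn Q x y} + q ^ 2 ≤
        q ^ 4 + #{y ∈ ({y | herm σ x y = 0 ∧ y ∉ P} : Finset (Fin 5 → F)) | Q y = 0} := by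
      have h1 := card_sdiff_span hx hfr.notMem_span
      rw [hs.card_eq, ← pow_mul] at h1
      rw [← h1, ← card_filter_add_card_filter_not (s := {y | IsFrame σ x y ∧ LineIn Q x y})
        (fun y => y ∈ P), add_right_comm _ (q ^ 2)]
      refine add_le_add_left (add_le_add (card_le_card ?_) (card_le_card ?_)) _
      · intro y
        simp only [mem_filter, mem_univ, true_and]
        exact fun h => ⟨h.2, h.1.1.notMem_span⟩
      · intro y
        simp only [mem_filter, mem_univ, true_and]
        exact fun h => ⟨⟨h.1.1.mid, h.2⟩, h.1.2.2.2⟩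
    rw [hs.card_eq, mul_one] at hlines
    generalize #{y | IsFrame σ x y ∧ LineIn Q x y} = c at *
    generalize #{y | IsFrame σ x y ∧ LineTangent Q x y} = e at *
    generalize #{y ∈ ({y | herm σ x y = 0 ∧ y ∉ P} : Finset (Fin 5 → F)) | Q y = 0} = n at *
    have h1 : n + q ^ 2 ≤ q ^ 6 := by
      refine Nat.le_of_mul_le_mul_left (c := q ^ 2) ?_ (by positivity)
      nlinarith
    have h2 : 1 ≤ q ^ 2 := Nat.one_le_pow _ _ (by omega)
    have h3 : c + 2 * q ^ 2 ≤ q ^ 6 + q ^ 4 := by omega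
    obtain ⟨k, rfl⟩ : ∃ k, q = k + 2 := ⟨q - 2, by omega⟩
    have hk : (0 : ℤ) ≤ ((k + 2) ^ 2 - 1) * (k + 2) ^ 2 * ((k + 2) ^ 2 + 1) * (k + 2) ^ 2 * k := by
      have : (0 : ℤ) ≤ (k + 2) ^ 2 - 1 := by nlinarith
      positivity
    zify [h2] at h3 hK ⊢
    have he : (e : ℤ) = (k + 2) ^ 7 + (k + 2) ^ 4 - (k + 2) ^ 5 - (k + 2) ^ 2 - c := by
      linarith
    have h4 := mul_le_mul_of_nonneg_left h3 (a := 2 * ((k : ℤ) + 2) ^ 2) (by positivity)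
    rw [he]
    nlinarith
  · simp only [mem_filter, mem_univ, true_and] at hy
    simp only [Q.apply_add_smul, hin.2.2, mul_zero, add_zero]
    rw [card_le_one]
    simp only [mem_filter, mem_univ, true_and]
    by_cases hb : Q.polarBilin y y₀ = 0
    · intro t ht
      rw [hb, mul_zero, add_zero] at ht
      refine absurd (mem_span_pair_of_lineIn hQ hx hfr.notMem_span hin
        ⟨hQx, htan y hy.1, ht⟩ ?_) hy.2
      rwa [Q.polarBilin_comm]
    · intro t ht u hu
      exact mul_right_cancel₀ hb (by linear_combination ht - hu)

theorem exists_herm_add_smul_eq_zero (hs : IsHermConj σ q) {y z : Fin 5 → F}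
    (hyy : herm σ y y = 0) (hzz : herm σ z z = 0) :
    ∃ t : F, t ≠ 0 ∧ herm σ (y + t • z) (y + t • z) = 0 := by
  have hq := hs.two_le
  simp only [herm_add_smul_self hs, hyy, hzz, mul_zero, add_zero]
  by_cases h : herm σ y z = 0
  · exact ⟨1, one_ne_zero, by simp [h]⟩
  · have h1 := hs.card_trace_mul_fiber h (map_zero σ)
    obtain ⟨t, ht, hne⟩ := exists_mem_ne (by rw [h1]; omega) (0 : F)
    exact ⟨t, hne, by simpa using ht⟩

theorem card_frames_lineIn_le_of_not_tangent (hs : IsHermConj σ q)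
    {Q : QuadraticForm F (Fin 5 → F)}
    (hQ : ∀ U : Submodule F (Fin 5 → F), Module.finrank F U = 3 → ∃ u ∈ U, Q u ≠ 0)
    {x : Fin 5 → F} (hx : x ≠ 0) (hxx : herm σ x x = 0) (hQx : Q x = 0)
    (htan : ∃ y, herm σ x y = 0 ∧ Q.polarBilin x y ≠ 0) :
    (q ^ 2 - 1) * #{y | IsFrame σ x y ∧ LineIn Q x y} ≤
      (q ^ 2 + 1) * #{y | IsFrame σ x y ∧ LineTangent Q x y} +
        (q ^ 2 - 1) * (q ^ 2 * (q ^ 2 - 1)) := by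
  have hq := hs.two_le
  have hpos : 1 ≤ q ^ 2 := Nat.one_le_pow _ _ (by omega)
  have hsd {y : Fin 5 → F} (hy : y ∉ F ∙ x) :
      #{u | u ∈ (F ∙ x ⊔ F ∙ y : Submodule F (Fin 5 → F)) ∧ u ∉ F ∙ x} = q ^ 2 * (q ^ 2 - 1) := by
    have h := card_sdiff_span hx hy
    rw [hs.card_eq] at h
    rw [Nat.mul_sub, mul_one, ← sq]
    omega
  rcases eq_empty_or_nonempty ({y | IsFrame σ x y ∧ LineIn Q x y} : Finset (Fin 5 → F)) with h | h
  · rw [h, card_empty, mul_zero]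
    exact Nat.zero_le _
  obtain ⟨y₀, hy₀⟩ := h
  simp only [mem_filter, mem_univ, true_and] at hy₀
  obtain ⟨hfr, hin⟩ := hy₀
  by_cases hC : ∀ y, IsFrame σ x y → LineIn Q x y → y ∈ (F ∙ x ⊔ F ∙ y₀ : Submodule F _)
  · refine (Nat.mul_le_mul_left _ ?_).trans (Nat.le_add_left _ _)
    rw [← hsd hfr.notMem_span]
    refine card_le_card fun y => ?_
    simp only [mem_filter, mem_univ, true_and]
    exact fun h => ⟨hC y h.1 h.2, h.1.notMem_span⟩
  push Not at hC
  obtain ⟨y, hyfr, hyin, hyP⟩ := hC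
  have hne : Q.polarBilin y₀ y ≠ 0 := fun h =>
    hyP (mem_span_pair_of_lineIn hQ hx hfr.notMem_span hin hyin h)
  have hU : F ∙ x ⊔ F ∙ y₀ ⊔ F ∙ y =
      LinearMap.ker (herm σ x) ⊓ LinearMap.ker (Q.polarBilin x) := by
    obtain ⟨y₁, hy₁, hne₁⟩ := htan
    refine Submodule.eq_of_le_of_finrank_eq ?_ ?_
    · simp only [sup_le_iff, Submodule.span_singleton_le_iff_mem]
      exact ⟨⟨⟨hxx, by simp [Q.polarBilin_self, hQx]⟩, hfr.mid, hin.2.1⟩, hyfr.mid, hyin.2.1⟩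
    · rw [finrank_sup_span hyP, finrank_sup_span hfr.notMem_span, finrank_span_singleton hx]
      have h := card_mul_subCount_inf_ker (W := LinearMap.ker (herm σ x)) hy₁ hne₁
      rw [subCount_ker_herm hs hx, subCount_eq_pow, hs.card_eq, ← pow_mul, ← pow_add] at h
      have := Nat.pow_right_injective hq h
      omega
  have hCle : #{z | IsFrame σ x z ∧ LineIn Q x z} ≤ 2 * (q ^ 2 * (q ^ 2 - 1)) := by
    rw [two_mul]
    nth_rw 1 [← hsd hfr.notMem_span]
    rw [← hsd hyfr.notMem_span]
    refine le_trans (card_le_card fun z hz => ?_) (card_union_le _ _)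
    simp only [mem_union, mem_filter, mem_univ, true_and] at hz ⊢
    obtain ⟨hz1, hz2⟩ := hz
    have hzU : z ∈ F ∙ x ⊔ F ∙ y₀ ⊔ F ∙ y := hU ▸ ⟨hz1.mid, hz2.2.1⟩
    obtain ⟨w, hw, c, rfl⟩ := mem_sup_span_singleton_iff.1 hzU
    obtain ⟨a, b, rfl⟩ := mem_span_pair_iff.1 hw
    have h0 := hz2.2.2
    rw [Q.apply_add_smul, hin.apply_eq_zero _ hw, polarBilin_smul_add_smul, hyin.2.1, hyin.2.2]
      at h0
    simp only [mul_zero, zero_add, add_zero, mul_eq_zero, hne, or_false] at h0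
    rcases h0 with rfl | rfl
    · left
      exact ⟨by simpa using hw, hz1.notMem_span⟩
    · right
      exact ⟨mem_span_pair_iff.2 ⟨a, c, by simp⟩, hz1.notMem_span⟩
  have hT : q ^ 2 * (q ^ 2 - 1) ≤ #{z | IsFrame σ x z ∧ LineTangent Q x z} := by
    obtain ⟨t, ht, hw⟩ := exists_herm_add_smul_eq_zero hs hfr.right hyfr.right
    have hQw : Q (y₀ + t • y) ≠ 0 := by
      rw [Q.apply_add_smul, hin.2.2, hyin.2.2]
      simpa [ht] using hne
    have hwx : y₀ + t • y ∉ F ∙ x := by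
      intro h
      obtain ⟨a, ha⟩ := Submodule.mem_span_singleton.1 h
      rw [← ha, QuadraticMap.map_smul, hQx] at hQw
      simp at hQw
    have hmid : herm σ x (y₀ + t • y) = 0 := by simp [hfr.mid, hyfr.mid]
    have hBw : Q.polarBilin x (y₀ + t • y) = 0 := by
      rw [map_add, map_smul, hin.2.1, hyin.2.1, smul_zero, add_zero]
    rw [← hsd hwx]
    refine card_le_card fun z => ?_
    simp only [mem_filter, mem_univ, true_and]
    rintro ⟨hz, hzx⟩
    obtain ⟨a, b, rfl⟩ := mem_span_pair_iff.1 hz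
    have hb : b ≠ 0 := by
      rintro rfl
      exact hzx (by simpa using Submodule.smul_mem _ a (Submodule.mem_span_singleton_self x))
    refine ⟨isFrame_of_notMem_span hx hxx ?_ ?_ hzx, hQx, ?_, ?_⟩
    · rw [map_add, map_smul, map_smul, hxx, hmid, smul_zero, smul_zero, add_zero]
    · rw [herm_add_smul_self hs, hw, herm_smul_left, herm_smul_left, hmid, map_smul, hxx]
      simp
    · rw [map_add, map_smul, map_smul, Q.polarBilin_self, hQx, hBw]
      simp
    · rw [Q.apply_add_smul, QuadraticMap.map_smul, hQx, map_smul Q.polarBilin,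
        LinearMap.smul_apply, hBw]
      simp [hb, hQw]
  generalize #{y | IsFrame σ x y ∧ LineIn Q x y} = c at *
  generalize #{y | IsFrame σ x y ∧ LineTangent Q x y} = e at *
  generalize hn : q ^ 2 * (q ^ 2 - 1) = n at *
  calc (q ^ 2 - 1) * c ≤ (q ^ 2 - 1) * (2 * n) := Nat.mul_le_mul_left _ hCle
    _ = (q ^ 2 - 1) * n + (q ^ 2 - 1) * n := by ring
    _ ≤ (q ^ 2 + 1) * e + (q ^ 2 - 1) * n :=
      Nat.add_le_add_right (Nat.mul_le_mul (by omega) hT) _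

theorem card_frames_lineIn_le (hs : IsHermConj σ q) {Q : QuadraticForm F (Fin 5 → F)}
    (hQ : ∀ U : Submodule F (Fin 5 → F), Module.finrank F U = 3 → ∃ u ∈ U, Q u ≠ 0)
    {x : Fin 5 → F} (hx : x ≠ 0) (hxx : herm σ x x = 0) (hQx : Q x = 0) :
    (q ^ 2 - 1) * #{y | IsFrame σ x y ∧ LineIn Q x y} ≤
      (q ^ 2 + 1) * #{y | IsFrame σ x y ∧ LineTangent Q x y} +
        (q ^ 2 - 1) * (q ^ 2 * (q ^ 2 - 1)) := by
  by_cases htan : ∀ y, herm σ x y = 0 → Q.polarBilin x y = 0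
  · exact card_frames_lineIn_le_of_tangent hs hQ hx hxx hQx htan
  · push Not at htan
    exact card_frames_lineIn_le_of_not_tangent hs hQ hx hxx hQx htan

end Local

section Total

open scoped Classical

variable {F : Type*} [Field F] [Fintype F] {σ : F →+* F} {q : ℕ}

theorem sum_ite_eq_card_mul {α : Type*} [Fintype α] (P : α → Prop)
    [DecidablePred P] (m : ℕ) :
    ∑ x, (if P x then m else 0) = #{x | P x} * m := by
  rw [← sum_filter, sum_const, smul_eq_mul]

theorem card_isFrame (hs : IsHermConj σ q) {x : Fin 5 → F} (hx : x ≠ 0) (hxx : herm σ x x = 0) :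
    #{y | IsFrame σ x y} = q ^ 2 * (q ^ 2 - 1) * (q ^ 3 + 1) := by
  have h1 := isoCount_ker_of_isotropic hs hx hxx
  rw [← card_isFrame_add hs hx hxx] at h1
  have h2 : 1 ≤ q ^ 2 := Nat.one_le_pow _ _ (by have := hs.two_le; omega)
  zify [h2] at h1 ⊢
  linear_combination h1

theorem card_ne_zero_add_one {ι : Type*} [Fintype ι] [DecidableEq ι] {P : (ι → F) → Prop}
    [DecidablePred P] (hP : P 0) : #{x | x ≠ 0 ∧ P x} + 1 = #{x | P x} := by
  rw [← card_filter_add_card_filter_not (s := {x | P x}) (fun x => x ≠ 0), filter_filter,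
    filter_filter]
  refine congrArg₂ (· + ·) (congrArg card ?_) (Eq.symm (card_eq_one.2 ⟨0, ?_⟩))
  · ext x
    simp only [mem_filter, mem_univ, true_and]
    exact and_comm
  · ext x
    simp only [mem_filter, mem_univ, true_and, not_not, mem_singleton]
    exact ⟨fun h => h.2, fun h => ⟨h.symm ▸ hP, h⟩⟩

theorem card_quadric_le_of_no_plane (hs : IsHermConj σ q) {Q : QuadraticForm F (Fin 5 → F)}
    (hQ : ∀ U : Submodule F (Fin 5 → F), Module.finrank F U = 3 → ∃ u ∈ U, Q u ≠ 0) :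
    #{y : Fin 5 → F | Q y = 0 ∧ herm σ y y = 0} + q ^ 5 + q ^ 3 + q ^ 2 ≤
      2 * q ^ 7 + 2 * q ^ 4 := by
  have hq := hs.two_le
  have hpos : 1 ≤ q ^ 2 := Nat.one_le_pow _ _ (by omega)
  set K := q ^ 2 * (q ^ 2 - 1) * (q ^ 3 + 1) with hK
  have hX : #{x : Fin 5 → F | x ≠ 0 ∧ Q x = 0 ∧ herm σ x x = 0} + 1 =
      #{y : Fin 5 → F | Q y = 0 ∧ herm σ y y = 0} :=
    card_ne_zero_add_one (P := fun x => Q x = 0 ∧ herm σ x x = 0) (by simp)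
  have hn : #{x : Fin 5 → F | x ≠ 0 ∧ herm σ x x = 0} + 1 + q ^ 5 = q ^ 9 + q ^ 4 := by
    rw [← isoCount_top hs, card_ne_zero_add_one (P := fun x => herm σ x x = 0) (by simp)]
    simp [isoCount]
  have hframes : ∑ x : Fin 5 → F, #{y | IsFrame σ x y} =
      #{x : Fin 5 → F | x ≠ 0 ∧ herm σ x x = 0} * K := by
    rw [← sum_ite_eq_card_mul]
    refine sum_congr rfl fun x _ => ?_
    split_ifs with h
    · exact card_isFrame hs h.1 h.2
    · rw [card_eq_zero, filter_false_of_mem]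
      exact fun y _ hy => h ⟨hy.ne_zero, hy.left⟩
  have hpoints : ∑ x : Fin 5 → F, #{y | IsFrame σ x y ∧ Q x = 0} =
      #{x : Fin 5 → F | x ≠ 0 ∧ Q x = 0 ∧ herm σ x x = 0} * K := by
    rw [← sum_ite_eq_card_mul]
    refine sum_congr rfl fun x _ => ?_
    split_ifs with h
    · rw [hK, ← card_isFrame hs h.1 h.2.2]
      simp [h.2.1]
    · rw [card_eq_zero, filter_false_of_mem]
      exact fun y _ hy => h ⟨hy.1.ne_zero, hy.2, hy.1.left⟩
  have hlines : (q ^ 2 - 1) * ∑ x : Fin 5 → F, #{y | IsFrame σ x y ∧ LineIn Q x y} ≤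
      (q ^ 2 + 1) * ∑ x : Fin 5 → F, #{y | IsFrame σ x y ∧ LineTangent Q x y} +
        #{x : Fin 5 → F | x ≠ 0 ∧ Q x = 0 ∧ herm σ x x = 0} *
          ((q ^ 2 - 1) * (q ^ 2 * (q ^ 2 - 1))) := by
    rw [← sum_ite_eq_card_mul, mul_sum, mul_sum, ← sum_add_distrib]
    refine sum_le_sum fun x _ => ?_
    split_ifs with h
    · exact card_frames_lineIn_le hs hQ h.1 h.2.2 h.2.1
    · rw [filter_false_of_mem (p := fun y => IsFrame σ x y ∧ LineIn Q x y)
        (fun y _ hy => h ⟨hy.1.ne_zero, hy.2.1, hy.1.left⟩), card_empty, mul_zero]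
      exact Nat.zero_le _
  have hmain := card_frames_le hs Q
  rw [hframes, hpoints] at hmain
  rw [← hX]
  generalize #{x : Fin 5 → F | x ≠ 0 ∧ Q x = 0 ∧ herm σ x x = 0} = X at *
  generalize #{x : Fin 5 → F | x ≠ 0 ∧ herm σ x x = 0} = n at *
  have h1 : (q ^ 2 + 1) * (X * K) ≤ 2 * (n * K) + X * ((q ^ 2 - 1) * (q ^ 2 * (q ^ 2 - 1))) := by
    linarith
  have h2 : 0 < q ^ 2 * (q ^ 2 - 1) := by
    have : 2 ^ 2 ≤ q ^ 2 := Nat.pow_le_pow_left hq 2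
    exact Nat.mul_pos (by omega) (by omega)
  have h3 : (q ^ 2 + 1) * (X * (q ^ 3 + 1)) ≤ 2 * (n * (q ^ 3 + 1)) + X * (q ^ 2 - 1) := by
    refine Nat.le_of_mul_le_mul_left ?_ h2
    rw [hK] at h1
    linarith
  by_contra! hlt
  zify [hpos] at h3 hn hlt
  have hn' : (n : ℤ) = q ^ 9 + q ^ 4 - q ^ 5 - 1 := by linarith
  have h4 := mul_le_mul_of_nonneg_left (Int.add_one_le_iff.2 hlt)
    (a := ((q : ℤ) ^ 2 + 1) * q ^ 3 + 2) (by positivity)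
  have h5 : (0 : ℤ) ≤ (q ^ 2 - 1) * (q ^ 8 + q ^ 6 + 3 * q ^ 5 + q ^ 3 + 2 * q ^ 2) := by
    have : (1 : ℤ) ≤ q ^ 2 := by exact_mod_cast hpos
    exact mul_nonneg (by linarith) (by positivity)
  have h6 : (0 : ℤ) ≤ (q ^ 2 + 1) * q ^ 3 := by positivity
  rw [hn'] at h3
  nlinarith

end Total

section Threefold

open scoped Classical

variable {F : Type*} [Field F] [Fintype F] {σ : F →+* F} {q : ℕ}

/-- A nonzero quadric has at most `(q ^ 2 - 1) * (2 * (q ^ 5 + q ^ 2) + q ^ 3 + 1) + 1` isotropic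
vectors. -/
theorem card_quadric_le (hs : IsHermConj σ q) {Q : QuadraticForm F (Fin 5 → F)} (hQ : Q ≠ 0) :
    #{y : Fin 5 → F | Q y = 0 ∧ herm σ y y = 0} + q ^ 5 + q ^ 3 + q ^ 2 ≤
      2 * q ^ 7 + 2 * q ^ 4 := by
  by_cases hpl : ∀ U : Submodule F (Fin 5 → F), Module.finrank F U = 3 → ∃ u ∈ U, Q u ≠ 0
  · exact card_quadric_le_of_no_plane hs hpl
  push Not at hpl
  obtain ⟨U, hU, hQU⟩ := hpl
  by_cases hmax : ∀ v ∉ U, Q v = 0 → ∃ u ∈ U, Q.polarBilin v u ≠ 0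
  · exact card_quadric_le_of_plane hs hU hQU hmax
  push Not at hmax
  obtain ⟨v, hv, hQv, hB⟩ := hmax
  have hfin := finrank_sup_span hv
  rw [hU] at hfin
  have hlt : U ⊔ F ∙ v < ⊤ := by
    refine lt_top_iff_ne_top.2 fun h => ?_
    rw [h, finrank_top, Module.finrank_fin_fun] at hfin
    omega
  obtain ⟨f, hf, hle⟩ := Submodule.exists_le_ker_of_lt_top _ hlt
  refine card_quadric_le_of_vanish_ker hs hQ hf fun y hy => ?_
  have heq : U ⊔ F ∙ v = LinearMap.ker f := by
    refine Submodule.eq_of_le_of_finrank_le hle ?_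
    have h1 := Submodule.finrank_lt (s := LinearMap.ker f)
      (by rwa [Ne, LinearMap.ker_eq_top])
    rw [Module.finrank_fin_fun] at h1
    omega
  refine vanish_sup_span hQU hQv (fun w hw => ?_) y (heq ▸ hy)
  rw [Q.polarBilin_comm, hB w hw]

end Threefold

section Polynomial

theorem MvPolynomial.IsHomogeneous.exists_quadraticForm {F : Type*} [Field F] {ι : Type*}
    [Fintype ι] {G : MvPolynomial ι F} (hG : G.IsHomogeneous 2) :
    ∃ Q : QuadraticForm F (ι → F), ∀ x, Q x = eval x G := by
  classical
  have hmon (d : ι →₀ ℕ) : ∃ Q : QuadraticForm F (ι → F), d.degree = 2 →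
      ∀ x, Q x = ∏ i, x i ^ d i := by
    by_cases hd : d.degree = 2
    · obtain ⟨i, j, hij⟩ : ∃ i j, Finsupp.toMultiset d = {i, j} := by
        rw [← Multiset.card_eq_two, Finsupp.card_toMultiset, ← hd]
        rfl
      obtain rfl : d = Finsupp.single i 1 + Finsupp.single j 1 := by
        rw [Finsupp.toMultiset_eq_iff.1 hij, Multiset.insert_eq_cons, ← Multiset.singleton_add,
          map_add, Multiset.toFinsupp_singleton, Multiset.toFinsupp_singleton]
      refine ⟨QuadraticMap.linMulLin (LinearMap.proj i) (LinearMap.proj j), fun _ x => ?_⟩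
      simp only [Finsupp.add_apply, pow_add, prod_mul_distrib]
      simp [Finsupp.single_apply, pow_ite]
    · exact ⟨0, fun h => absurd h hd⟩
  choose Q hQ using hmon
  refine ⟨∑ d ∈ G.support, coeff d G • Q d, fun x => ?_⟩
  rw [_root_.sum_apply, eval_eq']
  refine sum_congr rfl fun d hd => ?_
  rw [_root_.smul_apply, hQ d, smul_eq_mul]
  rw [Finsupp.degree_eq_weight_one]
  exact hG (mem_support_iff.1 hd)

theorem MvPolynomial.IsHomogeneous.exists_eval_ne_zero {F : Type} [Field F] [Fintype F]
    {ι : Type} [Finite ι] {n : ℕ} (hn : n < Fintype.card F) {G : MvPolynomial ι F}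
    (hG : G.IsHomogeneous n) (h0 : G ≠ 0) : ∃ x, eval x G ≠ 0 := by
  by_contra! h
  refine h0 (eq_zero_of_eval_eq_zero ι F G h ?_)
  rw [mem_restrictDegree]
  intro d hd i
  have h1 : d.degree = n := by
    rw [Finsupp.degree_eq_weight_one]
    exact hG (mem_support_iff.1 hd)
  have := Finsupp.le_degree i d
  omega

end Polynomial

theorem exists_isHermConj {q : ℕ} (hq : IsPrimePow q) {F : Type*} [Field F] [Fintype F]
    (hF : Fintype.card F = q ^ 2) : ∃ σ : F →+* F, IsHermConj σ q := by
  obtain ⟨p, k, hp, hk, rfl⟩ := hq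
  have hp' := hp.nat_prime
  have : Fact p.Prime := ⟨hp'⟩
  have : CharP F p :=
    charP_of_card_eq_prime_pow (f := k * 2) (by rw [hF, pow_mul])
  exact ⟨iterateFrobenius F p k, (Nat.one_lt_pow hk.ne' hp'.one_lt), hF,
    fun t => iterateFrobenius_def p k t⟩

theorem ncard_mul_le_card {q : ℕ} {F : Type} [Field F] [Fintype F] {σ : F →+* F}
    (hs : IsHermConj σ q) {G : MvPolynomial (Fin 5) F} {Q : QuadraticForm F (Fin 5 → F)}
    (hQ : ∀ x, Q x = eval x G) [DecidableEq F] :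
    (VG G ∩ hermV3 q F).ncard * (q ^ 2 - 1) ≤
      #{x : Fin 5 → F | x ≠ 0 ∧ Q x = 0 ∧ herm σ x x = 0} := by
  classical
  have hfin : (VG G ∩ hermV3 q F).Finite := Set.toFinite _
  rw [Set.ncard_eq_toFinset_card _ hfin, ← hs.card_eq, ← Fintype.card_units, ← card_univ,
    ← card_product]
  refine card_le_card_of_injOn (fun p => p.2 • p.1.rep) ?_ ?_
  · rintro ⟨p, u⟩ hp
    simp only [coe_product, Set.mem_prod, mem_coe, hfin.mem_toFinset, coe_univ, Set.mem_univ,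
      and_true] at hp
    have h1 : Q p.rep = 0 := (hQ _).trans hp.1
    have h2 : herm σ p.rep p.rep = 0 := by
      rw [herm_apply, ← hp.2]
      simp [hs.apply_eq, pow_succ]
    simp [Units.smul_def, QuadraticMap.map_smul, herm_smul_left, h1, h2, p.rep_nonzero]
  · rintro ⟨p, u⟩ - ⟨p', u'⟩ - h
    simp only [Units.smul_def] at h
    have h1 : p = p' := by
      rw [← p.mk_rep, ← p'.mk_rep, Projectivization.mk_eq_mk_iff']
      refine ⟨(u : F)⁻¹ * u', ?_⟩
      rw [mul_smul, ← h, inv_smul_smul₀ u.ne_zero]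
    subst h1
    have h2 := smul_left_injective F p.rep_nonzero h
    rw [Units.ext h2]

theorem stmt10 (q : ℕ) (hq : IsPrimePow q)
    (F : Type) [Field F] [Fintype F] (hF : Fintype.card F = q ^ 2)
    (G : MvPolynomial (Fin 5) F) (hG : G ≠ 0) (hGd : G.IsHomogeneous 2) :
    (VG G ∩ hermV3 q F).ncard ≤ 2 * (q ^ 5 + q ^ 2) + q ^ 3 + 1 := by
  classical
  obtain ⟨σ, hs⟩ := exists_isHermConj hq hF
  have h4 : 2 ^ 2 ≤ q ^ 2 := Nat.pow_le_pow_left hs.two_le 2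
  obtain ⟨Q, hQ⟩ := hGd.exists_quadraticForm
  have hQ0 : Q ≠ 0 := by
    rintro rfl
    obtain ⟨x, hx⟩ := hGd.exists_eval_ne_zero (by omega) hG
    exact hx (hQ x).symm
  have h1 := ncard_mul_le_card hs hQ
  have h2 := card_quadric_le hs hQ0
  have h3 := card_ne_zero_add_one (P := fun x => Q x = 0 ∧ herm σ x x = 0) (by simp)
  refine Nat.le_of_mul_le_mul_right (c := q ^ 2 - 1) (h1.trans ?_) (by omega)
  zify [show 1 ≤ q ^ 2 by omega] at h2 h3 ⊢
  nlinarith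
end
end

section
/- Let q be a prime power, F a finite field with q^2 elements, and G ∈ F[x_0,...,x_4] a nonzero homogeneous polynomial of degree 2. Then |V(G)(F) ∩ V_3| = 2(q^5 + q^2) + q^3 + 1 holds if and only if there exist a nonzero scalar c ∈ F and linear forms L_1, L_2 ∈ F[x_0,...,x_4] with G = c·L_1·L_2 such that the hyperplanes Σ_1 = V(L_1)(F) and Σ_2 = V(L_2)(F) are distinct, neither is tangent to V_3, and |Σ_1 ∩ Σ_2 ∩ V_3| = q^3 + 1. -/
open MvPolynomial

noncomputable section

namespace HermitianQuadric

open Finset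

section Field

variable {q : ℕ} {F : Type} [Field F] [Fintype F]

/-- The `q`-power map on a field with `q ^ 2` elements is a ring homomorphism. -/
lemma exists_frobenius (hq : IsPrimePow q) (hF : Fintype.card F = q ^ 2) :
    ∃ σ : F →+* F, ∀ x, σ x = x ^ q := by
  obtain ⟨p, k, hp, hk, rfl⟩ := hq
  have hp' : p.Prime := hp.nat_prime
  obtain ⟨p', hp'c⟩ := CharP.exists F
  obtain ⟨n, hn, hcard⟩ := FiniteField.card F p'
  have : p' = p := by
    have h1 : p' ∣ (p ^ k) ^ 2 := by
      rw [← hF, hcard]; exact dvd_pow_self _ n.ne_zero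
    exact (Nat.prime_dvd_prime_iff_eq hn hp').1 (hn.dvd_of_dvd_pow (hn.dvd_of_dvd_pow h1))
  subst this
  have : Fact p'.Prime := ⟨hp'⟩
  exact ⟨iterateFrobenius F p' k, fun x => rfl⟩

variable {σ : F →+* F}

lemma frobenius_frobenius (hF : Fintype.card F = q ^ 2) (hσ : ∀ x, σ x = x ^ q) (x : F) :
    σ (σ x) = x := by
  rw [hσ, hσ, ← pow_mul, ← sq, ← hF, FiniteField.pow_card]

lemma card_pow_eq_le (n : ℕ) (hn : 0 < n) (c : F) [DecidableEq F] :
    #{x : F | x ^ n = c} ≤ n := by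
  calc #{x : F | x ^ n = c} ≤ #(Polynomial.nthRoots n c).toFinset := by
        refine card_le_card fun x hx => ?_
        simp only [mem_filter, mem_univ, true_and] at hx
        simpa [Polynomial.mem_nthRoots hn] using hx
    _ ≤ Multiset.card (Polynomial.nthRoots n c) := Multiset.toFinset_card_le _
    _ ≤ n := Polynomial.card_nthRoots n c

lemma card_mul_add_pow_eq_zero_le (hq : 2 ≤ q) (e : F) [DecidableEq F] :
    #{x : F | e * x + x ^ q = 0} ≤ q := by
  let P : Polynomial F := Polynomial.X ^ q + Polynomial.C e * Polynomial.X
  have hdeg : P.natDegree = q := by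
    have : (Polynomial.C e * Polynomial.X : Polynomial F).degree <
        (Polynomial.X ^ q : Polynomial F).degree := by
      rw [Polynomial.degree_X_pow]
      exact (Polynomial.degree_C_mul_X_le e).trans_lt (by exact_mod_cast hq)
    apply Polynomial.natDegree_eq_of_degree_eq_some
    rw [Polynomial.degree_add_eq_left_of_degree_lt this, Polynomial.degree_X_pow]
  have hP : P ≠ 0 := by
    intro h; rw [h] at hdeg; simp at hdeg; omega
  calc #{x : F | e * x + x ^ q = 0} ≤ #P.roots.toFinset := by
        refine card_le_card fun x hx => ?_
        simp only [mem_filter, mem_univ, true_and] at hx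
        simp only [Multiset.mem_toFinset, Polynomial.mem_roots hP, P, Polynomial.IsRoot.def,
          Polynomial.eval_add, Polynomial.eval_pow, Polynomial.eval_X, Polynomial.eval_mul,
          Polynomial.eval_C]
        rw [add_comm, hx]
    _ ≤ Multiset.card P.roots := Multiset.toFinset_card_le _
    _ ≤ q := hdeg ▸ P.card_roots'

/-- The trace to the fixed field of `σ` has kernel of size `q`. -/
lemma card_trace_eq_zero (hq : 2 ≤ q) (hF : Fintype.card F = q ^ 2) (hσ : ∀ x, σ x = x ^ q)
    [DecidableEq F] : #{x : F | x + σ x = 0} = q := by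
  refine le_antisymm ?_ ?_
  · simpa [hσ] using card_mul_add_pow_eq_zero_le hq (1 : F)
  have himage : #(univ.image fun x : F => x + σ x) ≤ q := by
    refine (card_le_card fun x hx => ?_).trans (card_mul_add_pow_eq_zero_le hq (-1 : F))
    obtain ⟨y, -, rfl⟩ := mem_image.1 hx
    simp only [mem_filter, mem_univ, true_and]
    rw [← hσ, map_add, frobenius_frobenius hF hσ]
    ring
  have hfib : #(univ : Finset F) ≤
      #{x : F | x + σ x = 0} * #(univ.image fun x : F => x + σ x) := by
    refine card_le_mul_card_image _ _ fun w hw => ?_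
    obtain ⟨y, -, rfl⟩ := mem_image.1 hw
    refine card_le_card_of_injOn (fun x => x - y) (fun x hx => ?_)
      (fun x _ z _ h => sub_left_injective h)
    simp only [coe_filter, mem_univ, true_and, Set.mem_ofPred_eq] at hx ⊢
    rw [map_sub]
    linear_combination hx
  rw [card_univ, hF, sq] at hfib
  exact Nat.le_of_mul_le_mul_right (hfib.trans (Nat.mul_le_mul_left _ himage)) (by omega)

/-- An additive character invariant under `σ` and trivial on the kernel of the trace. -/
lemma exists_addChar (hq : 2 ≤ q) (hF : Fintype.card F = q ^ 2) (hσ : ∀ x, σ x = x ^ q) :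
    ∃ ψ : AddChar F ℂ, ψ ≠ 1 ∧ (∀ z, ψ (σ z) = ψ z) ∧ ∀ z, z + σ z = 0 → ψ z = 1 := by
  classical
  obtain ⟨z₀, hz₀⟩ : ∃ z₀ : F, z₀ + σ z₀ ≠ 0 := by
    by_contra! h
    have := card_trace_eq_zero hq hF hσ
    rw [filter_true_of_mem fun x _ => h x, card_univ, hF] at this
    nlinarith
  obtain ⟨χ, hχ⟩ := AddChar.exists_apply_ne_zero.2 hz₀
  refine ⟨χ.compAddMonoidHom ((AddMonoidHom.id F) + σ.toAddMonoidHom), ?_, fun z => ?_,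
    fun z hz => ?_⟩
  · rw [AddChar.ne_one_iff]
    exact ⟨z₀, by simpa using hχ⟩
  · simp [frobenius_frobenius hF hσ, add_comm]
  · simp [hz]

omit [Fintype F] in
lemma exists_mul_apply_ne_one {ψ : AddChar F ℂ} (hψ : ψ ≠ 1) {a : F} (ha : a ≠ 0) :
    ∃ c, ψ (a * c) ≠ 1 := by
  obtain ⟨x, hx⟩ := AddChar.ne_one_iff.1 hψ
  exact ⟨a⁻¹ * x, by rwa [mul_inv_cancel_left₀ ha]⟩

lemma sum_mul_apply {ψ : AddChar F ℂ} (hψ : ψ ≠ 1) [DecidableEq F] (a : F) :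
    ∑ c, ψ (a * c) = if a = 0 then (Fintype.card F : ℂ) else 0 := by
  split_ifs with ha
  · simp [ha]
  · have h : ψ.compAddMonoidHom (AddMonoidHom.mulLeft a) ≠ 0 := by
      obtain ⟨c, hc⟩ := exists_mul_apply_ne_one hψ ha
      exact AddChar.ne_one_iff.2 ⟨c, by simpa using hc⟩
    simpa using AddChar.sum_eq_zero_iff_ne_zero.2 h

end Field

section Sums

open Matrix

variable {q : ℕ} {F : Type} [Field F] [Fintype F] [DecidableEq F]
  {ι : Type} [Fintype ι] [DecidableEq ι] {σ : F →+* F} {ψ : AddChar F ℂ}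

omit [Fintype F] [DecidableEq F] [DecidableEq ι] in
lemma addChar_sum (ψ : AddChar F ℂ) (f : ι → F) : ψ (∑ i, f i) = ∏ i, ψ (f i) :=
  map_sum ψ.toMonoidHom.toAdditiveRight _ _

lemma sum_apply_dotProduct (hψ : ψ ≠ 1) (w : ι → F) :
    ∑ x : ι → F, ψ (x ⬝ᵥ w) = if w = 0 then (Fintype.card F : ℂ) ^ Fintype.card ι else 0 := by
  have h : ∀ x : ι → F, ψ (x ⬝ᵥ w) = ∏ i, ψ (w i * x i) := fun x => by
    rw [dotProduct, addChar_sum]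
    simp only [mul_comm]
  simp_rw [h]
  rw [← Fintype.piFinset_univ, ← prod_univ_sum (fun _ => univ) fun i c => ψ (w i * c)]
  simp_rw [sum_mul_apply hψ]
  split_ifs with hw
  · simp [hw]
  · obtain ⟨i, hi⟩ := Function.ne_iff.1 hw
    exact prod_eq_zero (mem_univ i) (if_neg hi)

/-- The square of the modulus of a quadratic exponential sum is controlled by its radical. -/
lemma quadraticSum_mul_conj (hψ : ψ ≠ 1) (f : (ι → F) → F) (L : (ι → F) → ι → F)
    (h : ∀ x y, ψ (f (x + y)) = ψ (f x) * ψ (f y) * ψ (x ⬝ᵥ L y)) :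
    (∑ x, ψ (f x)) * (starRingEnd ℂ) (∑ x, ψ (f x)) =
      (Fintype.card F : ℂ) ^ Fintype.card ι * ∑ y with L y = 0, ψ (f y) := by
  rw [map_sum, sum_mul_sum, sum_comm]
  calc ∑ x, ∑ z, ψ (f z) * (starRingEnd ℂ) (ψ (f x))
      = ∑ x, ∑ y, ψ (f y) * ψ (x ⬝ᵥ L y) := by
        refine sum_congr rfl fun x _ => ?_
        rw [← Equiv.sum_comp (Equiv.addLeft x)]
        refine sum_congr rfl fun y _ => ?_
        rw [Equiv.coe_addLeft, h, ← AddChar.map_neg_eq_conj]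
        have : ψ (f x) * ψ (-f x) = 1 := by rw [← AddChar.map_add_eq_mul]; simp
        linear_combination (ψ (f y) * ψ (x ⬝ᵥ L y)) * this
    _ = ∑ y, ψ (f y) * ∑ x, ψ (x ⬝ᵥ L y) := by
        rw [sum_comm]; simp only [mul_sum]
    _ = _ := by
        simp_rw [sum_apply_dotProduct hψ, mul_ite, mul_zero]
        rw [← sum_filter, mul_sum]
        exact sum_congr rfl fun y _ => mul_comm _ _

lemma norm_quadraticSum_sq_le (hψ : ψ ≠ 1) (f : (ι → F) → F) (L : (ι → F) → ι → F)
    (h : ∀ x y, ψ (f (x + y)) = ψ (f x) * ψ (f y) * ψ (x ⬝ᵥ L y)) :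
    ‖∑ x, ψ (f x)‖ ^ 2 ≤ (Fintype.card F : ℝ) ^ Fintype.card ι * #{y | L y = 0} := by
  have := congrArg norm (quadraticSum_mul_conj hψ f L h)
  rw [norm_mul, RCLike.norm_conj, ← sq, norm_mul, norm_pow, Complex.norm_natCast] at this
  rw [this]
  gcongr
  refine (norm_sum_le _ _).trans ?_
  simp

lemma norm_quadraticSum_sq (hψ : ψ ≠ 1) (f : (ι → F) → F) (L : (ι → F) → ι → F)
    (h : ∀ x y, ψ (f (x + y)) = ψ (f x) * ψ (f y) * ψ (x ⬝ᵥ L y)) (hL : ∀ y, L y = 0 ↔ y = 0) :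
    ‖∑ x, ψ (f x)‖ ^ 2 = (Fintype.card F : ℝ) ^ Fintype.card ι := by
  have := congrArg norm (quadraticSum_mul_conj hψ f L h)
  rw [norm_mul, RCLike.norm_conj, ← sq, norm_mul, norm_pow, Complex.norm_natCast] at this
  rw [this]
  simp [hL, filter_eq']

variable (σ) in
/-- The standard Hermitian form `∑ xᵢ σ(xᵢ)`. -/
def herm (x : ι → F) : F := ∑ i, x i * σ (x i)

omit [Fintype F] [DecidableEq F] [DecidableEq ι] in
lemma herm_smul (c : F) (x : ι → F) : herm σ (c • x) = c * σ c * herm σ x := by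
  simp only [herm, mul_sum, Pi.smul_apply, smul_eq_mul, map_mul]
  exact sum_congr rfl fun i _ => by ring

omit [Fintype F] [DecidableEq F] [DecidableEq ι] in
lemma map_herm (hσσ : ∀ x, σ (σ x) = x) (x : ι → F) : σ (herm σ x) = herm σ x := by
  simp only [herm, map_sum, map_mul, hσσ, mul_comm]

omit [Fintype F] [DecidableEq F] [DecidableEq ι] in
lemma apply_mul_herm_add (hσσ : ∀ x, σ (σ x) = x) (hψσ : ∀ z, ψ (σ z) = ψ z) (a : F)
    (x y : ι → F) : ψ (a * herm σ (x + y)) =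
      ψ (a * herm σ x) * ψ (a * herm σ y) * ψ (x ⬝ᵥ fun i => (a + σ a) * σ (y i)) := by
  have h1 : a * herm σ (x + y) = a * herm σ x + a * herm σ y +
      ((∑ i, a * (x i * σ (y i))) + ∑ i, a * (y i * σ (x i))) := by
    simp only [herm, mul_sum, ← sum_add_distrib, Pi.add_apply, map_add]
    exact sum_congr rfl fun i _ => by ring
  have h2 : ψ (∑ i, a * (y i * σ (x i))) = ψ (∑ i, σ a * (x i * σ (y i))) := by
    rw [← hψσ]
    simp only [map_sum, map_mul, hσσ, mul_comm (x _)]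
  rw [h1, AddChar.map_add_eq_mul, AddChar.map_add_eq_mul, AddChar.map_add_eq_mul, h2,
    ← AddChar.map_add_eq_mul _ (∑ i, _) (∑ i, _), ← sum_add_distrib]
  congr 2
  exact sum_congr rfl fun i _ => by ring

omit [Fintype F] [DecidableEq F] [DecidableEq ι] in
lemma apply_mul_herm_eq_one (hσσ : ∀ x, σ (σ x) = x) (hψ0 : ∀ z, z + σ z = 0 → ψ z = 1) {a : F}
    (ha : a + σ a = 0) (x : ι → F) : ψ (a * herm σ x) = 1 := by
  apply hψ0
  rw [map_mul, map_herm hσσ, ← add_mul, ha, zero_mul]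

lemma norm_sum_apply_herm_add_linear (hψ : ψ ≠ 1) (hσσ : ∀ x, σ (σ x) = x)
    (hψσ : ∀ z, ψ (σ z) = ψ z) {a : F} (ha : a + σ a ≠ 0) (l : ι → F) :
    ‖∑ x : ι → F, ψ (a * herm σ x + l ⬝ᵥ x)‖ ^ 2 =
      (Fintype.card F : ℝ) ^ Fintype.card ι := by
  refine norm_quadraticSum_sq hψ _ (fun y i => (a + σ a) * σ (y i)) (fun x y => ?_) fun y => ?_
  · rw [AddChar.map_add_eq_mul, AddChar.map_add_eq_mul, AddChar.map_add_eq_mul,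
      apply_mul_herm_add hσσ hψσ, dotProduct_add, AddChar.map_add_eq_mul]
    ring
  · simp [funext_iff, ha]

lemma sum_apply_mul_norm (hq : 2 ≤ q) (hF : Fintype.card F = q ^ 2) (hσ : ∀ x, σ x = x ^ q)
    (hψ : ψ ≠ 1) (hψσ : ∀ z, ψ (σ z) = ψ z) (hψ0 : ∀ z, z + σ z = 0 → ψ z = 1)
    {a : F} (ha : a + σ a ≠ 0) : ∑ x, ψ (a * (x * σ x)) = -q := by
  have hσσ := frobenius_frobenius hF hσ
  set g : F → ℂ := fun a => ∑ x, ψ (a * (x * σ x)) with hg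
  have hnorm : ∀ a, a + σ a ≠ 0 → ‖g a‖ = q := by
    intro a ha
    have h := norm_sum_apply_herm_add_linear (ι := Unit) hψ hσσ hψσ ha 0
    have h2 : ∑ x : Unit → F, ψ (a * herm σ x + 0 ⬝ᵥ x) = g a := by
      simp only [hg]
      rw [← Equiv.sum_comp (Equiv.funUnique Unit F)]
      simp [herm]
    rw [h2, hF] at h
    have : (0 : ℝ) ≤ q := by positivity
    simpa [pow_left_inj₀] using h
  have hsum : ∑ a, g a = q ^ 2 := by
    simp only [hg]
    rw [sum_comm]
    simp_rw [mul_comm _ (_ * σ _), sum_mul_apply hψ]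
    simp [sum_ite_eq', hF]
  have hzero : ∀ a, a + σ a = 0 → g a = q ^ 2 := by
    intro a ha
    have h := fun x : F => apply_mul_herm_eq_one hσσ hψ0 ha (fun _ : Unit => x)
    simp only [herm, univ_unique, sum_const, card_singleton, one_smul] at h
    simp [hg, h, hF]
  have hsplit := sum_filter_add_sum_filter_not univ (fun a : F => a + σ a = 0) g
  have hc := card_trace_eq_zero hq hF hσ
  have hc' : (#{a : F | ¬ a + σ a = 0} : ℝ) = q ^ 2 - q := by
    have := card_filter_add_card_filter_not (s := univ) (fun a : F => a + σ a = 0)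
    rw [hc, card_univ, hF] at this
    rw [eq_sub_iff_add_eq']
    exact_mod_cast this
  rw [sum_congr rfl fun a ha => hzero a (mem_filter.1 ha).2, sum_const, hc, hsum] at hsplit
  have hre : ∑ a with ¬ a + σ a = 0, ((g a).re + q) = 0 := by
    have h1 := congrArg Complex.re (eq_sub_iff_add_eq'.2 hsplit)
    rw [sum_add_distrib, ← Complex.re_sum, sum_const, nsmul_eq_mul, hc', h1, nsmul_eq_mul]
    have h2 : ((q : ℂ) ^ 2 - q * q ^ 2) = ((q ^ 2 - q * q ^ 2 : ℝ) : ℂ) := by push_cast; rfl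
    rw [h2, Complex.ofReal_re]
    ring
  rw [sum_eq_zero_iff_of_nonneg] at hre
  · have h1 := hre a (by simpa using ha)
    have h2 := hnorm a ha
    have h3 : (g a).re = -q := by linarith
    have h4 := Complex.sq_norm (g a)
    rw [Complex.normSq_apply, h2, h3] at h4
    have h5 : (g a).im = 0 := by nlinarith
    exact Complex.ext (by simpa only [Complex.neg_re, Complex.natCast_re] using h3)
      (by simpa only [Complex.neg_im, Complex.natCast_im, neg_zero] using h5)
  · intro b hb
    have h1 := hnorm b (by simpa using hb)
    have := (abs_le.1 (Complex.abs_re_le_norm (g b))).1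
    linarith

lemma sum_apply_mul_herm (hq : 2 ≤ q) (hF : Fintype.card F = q ^ 2) (hσ : ∀ x, σ x = x ^ q)
    (hψ : ψ ≠ 1) (hψσ : ∀ z, ψ (σ z) = ψ z) (hψ0 : ∀ z, z + σ z = 0 → ψ z = 1)
    {a : F} (ha : a + σ a ≠ 0) :
    ∑ x : ι → F, ψ (a * herm σ x) = (-q) ^ Fintype.card ι := by
  simp_rw [herm, mul_sum, addChar_sum]
  rw [← Fintype.piFinset_univ, ← prod_univ_sum (fun _ => univ) fun (_ : ι) x => ψ (a * (x * σ x))]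
  rw [sum_apply_mul_norm hq hF hσ hψ hψσ hψ0 ha, prod_const, card_univ]

end Sums

section Sections

open Matrix

variable {q : ℕ} {F : Type} [Field F] [Fintype F] [DecidableEq F]
  {X : Type} [Fintype X] {σ : F →+* F} {ψ : AddChar F ℂ}

lemma card_mul_sum_filter (hψ : ψ ≠ 1) (f : X → F) (w : X → ℂ) :
    (Fintype.card F : ℂ) * ∑ x with f x = 0, w x = ∑ a, ∑ x, ψ (a * f x) * w x := by
  rw [sum_comm]
  simp_rw [← sum_mul, mul_comm _ (f _), sum_mul_apply hψ, ite_mul, zero_mul]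
  rw [← sum_filter, mul_sum]

/-- The number of common zeros of two functions as an exponential sum. -/
lemma card_sq_mul_card_zeros (hψ : ψ ≠ 1) (f g : X → F) :
    (Fintype.card F : ℂ) ^ 2 * #{x | f x = 0 ∧ g x = 0} =
      ∑ a, ∑ c, ∑ x, ψ (a * f x + c * g x) := by
  have h1 : (#{x | f x = 0 ∧ g x = 0} : ℂ) = ∑ x with f x = 0, if g x = 0 then 1 else 0 := by
    rw [← sum_filter, filter_filter]; simp
  have h2 : ∀ a, (Fintype.card F : ℂ) * ∑ x with g x = 0, ψ (a * f x) =
      ∑ c, ∑ x, ψ (a * f x + c * g x) := fun a => by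
    rw [card_mul_sum_filter hψ]
    simp_rw [AddChar.map_add_eq_mul, mul_comm]
  rw [h1, sq, mul_assoc, card_mul_sum_filter hψ, mul_sum]
  refine sum_congr rfl fun a _ => ?_
  rw [← h2, sum_filter]
  simp

lemma card_trace_ne_zero (hq : 2 ≤ q) (hF : Fintype.card F = q ^ 2) (hσ : ∀ x, σ x = x ^ q) :
    (#{a : F | ¬ a + σ a = 0} : ℝ) = q ^ 2 - q := by
  have := card_filter_add_card_filter_not (s := univ) (fun a : F => a + σ a = 0)
  rw [card_trace_eq_zero hq hF hσ, card_univ, hF] at this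
  rw [eq_sub_iff_add_eq']
  exact_mod_cast this

lemma sum_apply_herm_add_linear (hq : 2 ≤ q) (hF : Fintype.card F = q ^ 2)
    (hσ : ∀ x, σ x = x ^ q) (hψ : ψ ≠ 1) (hψσ : ∀ z, ψ (σ z) = ψ z)
    (hψ0 : ∀ z, z + σ z = 0 → ψ z = 1) {a : F} (ha : a + σ a ≠ 0) (l : Fin 5 → F) :
    ∑ x : Fin 5 → F, ψ (a * herm σ x + l ⬝ᵥ x) =
      -q ^ 5 * ψ (-a / (a + σ a) ^ 2 * herm σ l) := by
  have hσσ := frobenius_frobenius hF hσ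
  set t := a + σ a with ht
  have hσt : σ t = t := by rw [ht, map_add, hσσ, add_comm]
  let z : Fin 5 → F := fun i => σ (l i) / t
  have hz : (fun i => t * σ (z i)) = l := by
    ext i
    simp only [z, map_div₀, hσσ, hσt]
    field_simp
  have hHz : herm σ z = herm σ l / t ^ 2 := by
    simp only [herm, z, sum_div, map_div₀, hσσ, hσt]
    exact sum_congr rfl fun i _ => by field_simp
  have h := sum_apply_mul_herm (ι := Fin 5) hq hF hσ hψ hψσ hψ0 ha
  rw [← Equiv.sum_comp (Equiv.addRight z)] at h
  simp only [Equiv.coe_addRight, apply_mul_herm_add hσσ hψσ, ← ht, hz] at h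
  have h2 : ψ (a * herm σ z) * ψ (-a / t ^ 2 * herm σ l) = 1 := by
    rw [← AddChar.map_add_eq_mul, hHz]
    convert ψ.map_zero_eq_one using 2
    ring
  have h3 : ∑ x : Fin 5 → F, ψ (a * herm σ x + l ⬝ᵥ x) =
      (∑ x : Fin 5 → F, ψ (a * herm σ x) * ψ (a * herm σ z) * ψ (x ⬝ᵥ l)) *
        ψ (-a / t ^ 2 * herm σ l) := by
    rw [sum_mul]
    refine sum_congr rfl fun x _ => ?_
    rw [AddChar.map_add_eq_mul, dotProduct_comm l x]
    linear_combination -(ψ (a * herm σ x) * ψ (x ⬝ᵥ l)) * h2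
  rw [h3, h, Fintype.card_fin]
  ring

/-- The terms of trace zero in the exponential sum counting the points of a hyperplane section. -/
lemma sum_trace_zero_linear (hF : Fintype.card F = q ^ 2) (hσ : ∀ x, σ x = x ^ q) (hψ : ψ ≠ 1)
    (hψ0 : ∀ z, z + σ z = 0 → ψ z = 1) {a : F} (ha : a + σ a = 0) (l : Fin 5 → F) :
    ∑ x : Fin 5 → F, ψ (a * herm σ x + l ⬝ᵥ x) = if l = 0 then (q : ℂ) ^ 10 else 0 := by
  have hσσ := frobenius_frobenius hF hσ
  simp_rw [AddChar.map_add_eq_mul, apply_mul_herm_eq_one hσσ hψ0 ha, one_mul, dotProduct_comm l]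
  rw [sum_apply_dotProduct hψ, hF, Fintype.card_fin]
  congr 1
  push_cast
  ring

lemma card_hyperplane_section (hq : 2 ≤ q) (hF : Fintype.card F = q ^ 2)
    (hσ : ∀ x, σ x = x ^ q) (l : Fin 5 → F) (hl : l ≠ 0) :
    #{x : Fin 5 → F | herm σ x = 0 ∧ l ⬝ᵥ x = 0} +
      (if herm σ l = 0 then q ^ 5 else q ^ 3) = q ^ 7 + q ^ 4 := by
  obtain ⟨ψ, hψ, hψσ, hψ0⟩ := exists_addChar hq hF hσ
  have hσσ := frobenius_frobenius hF hσ
  have key := card_sq_mul_card_zeros hψ (herm σ) (fun x : Fin 5 → F => l ⬝ᵥ x)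
  have hsmul : ∀ (c : F) x, c * l ⬝ᵥ x = (c • l) ⬝ᵥ x := fun c x => (smul_dotProduct c l x).symm
  have h0 : ∀ a : F, a + σ a = 0 →
      ∑ c, ∑ x : Fin 5 → F, ψ (a * herm σ x + c * l ⬝ᵥ x) = (q : ℂ) ^ 10 := by
    intro a ha
    simp_rw [hsmul,
      sum_trace_zero_linear hF hσ hψ hψ0 ha]
    simp [hl]
  have h1 : ∀ a : F, ¬ a + σ a = 0 →
      ∑ c, ∑ x : Fin 5 → F, ψ (a * herm σ x + c * l ⬝ᵥ x) =
        -q ^ 5 * (if herm σ l = 0 then (q : ℂ) ^ 2 else -q) := by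
    intro a ha
    simp_rw [hsmul,
      sum_apply_herm_add_linear hq hF hσ hψ hψσ hψ0 ha, ← mul_sum, herm_smul]
    congr 1
    split_ifs with h
    · simp [h, hF]
    · have hσt : σ (a + σ a) = a + σ a := by rw [map_add, hσσ, add_comm]
      rw [← sum_apply_mul_norm hq hF hσ hψ hψσ hψ0
        (a := -a / (a + σ a) ^ 2 * herm σ l)]
      · exact sum_congr rfl fun c _ => by congr 1; ring
      · rw [map_mul, map_div₀, map_pow, hσt, map_herm hσσ, map_neg, ← add_mul, ← add_div,
          ← neg_add]
        exact mul_ne_zero (div_ne_zero (neg_ne_zero.2 ha) (pow_ne_zero _ ha)) h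
  rw [← sum_filter_add_sum_filter_not univ (fun a : F => a + σ a = 0),
    sum_congr rfl fun a ha => h0 a (mem_filter.1 ha).2,
    sum_congr rfl fun a ha => h1 a (mem_filter.1 ha).2, sum_const, sum_const,
    card_trace_eq_zero hq hF hσ, nsmul_eq_mul, nsmul_eq_mul, hF] at key
  have hc : (#{a : F | ¬ a + σ a = 0} : ℂ) = q ^ 2 - q := by
    exact_mod_cast congrArg ((↑) : ℝ → ℂ) (card_trace_ne_zero hq hF hσ)
  rw [hc] at key
  have hq0 : (q : ℂ) ^ 4 ≠ 0 := pow_ne_zero _ (by norm_cast; omega)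
  have : ((#{x : Fin 5 → F | herm σ x = 0 ∧ l ⬝ᵥ x = 0} +
      (if herm σ l = 0 then q ^ 5 else q ^ 3) : ℕ) : ℂ) = ((q ^ 7 + q ^ 4 : ℕ) : ℂ) := by
    apply mul_left_cancel₀ hq0
    push_cast at key ⊢
    split_ifs at key ⊢ <;> linear_combination key
  exact_mod_cast this

lemma card_plane_section_ge (hq : 2 ≤ q) (hF : Fintype.card F = q ^ 2)
    (hσ : ∀ x, σ x = x ^ q) (l m : Fin 5 → F) :
    q ^ 4 ≤ #{x : Fin 5 → F | herm σ x = 0 ∧ l ⬝ᵥ x = 0 ∧ m ⬝ᵥ x = 0} := by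
  obtain ⟨ψ, hψ, hψσ, hψ0⟩ := exists_addChar hq hF hσ
  have hσσ := frobenius_frobenius hF hσ
  set N := #{x : Fin 5 → F | herm σ x = 0 ∧ l ⬝ᵥ x = 0 ∧ m ⬝ᵥ x = 0} with hN
  have key : (q : ℂ) ^ 6 * N =
      ∑ a : F, ∑ c : F, ∑ d : F, ∑ x : Fin 5 → F, ψ (a * herm σ x + (c • l + d • m) ⬝ᵥ x) := by
    have h1 : (N : ℂ) = ∑ x : Fin 5 → F with herm σ x = 0,
        if l ⬝ᵥ x = 0 ∧ m ⬝ᵥ x = 0 then 1 else 0 := by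
      rw [← sum_filter, filter_filter]; simp [hN]
    have h2 : (q : ℂ) ^ 6 * N = (Fintype.card F : ℂ) * ((Fintype.card F : ℂ) *
        ((Fintype.card F : ℂ) * N)) := by
      rw [hF]; push_cast; ring
    rw [h2, h1, card_mul_sum_filter hψ, mul_sum, mul_sum]
    refine sum_congr rfl fun a _ => ?_
    have h3 : ∑ x : Fin 5 → F, ψ (a * herm σ x) *
        (if l ⬝ᵥ x = 0 ∧ m ⬝ᵥ x = 0 then 1 else 0) =
        ∑ x with l ⬝ᵥ x = 0, if m ⬝ᵥ x = 0 then ψ (a * herm σ x) else 0 := by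
      rw [← sum_filter, filter_filter, sum_filter]
      simp
    rw [h3, card_mul_sum_filter hψ, mul_sum]
    refine sum_congr rfl fun c _ => ?_
    have h4 : ∑ x : Fin 5 → F, ψ (c * l ⬝ᵥ x) *
        (if m ⬝ᵥ x = 0 then ψ (a * herm σ x) else 0) =
        ∑ x with m ⬝ᵥ x = 0, ψ (c * l ⬝ᵥ x) * ψ (a * herm σ x) := by
      rw [sum_filter]
      simp
    rw [h4, card_mul_sum_filter hψ]
    refine sum_congr rfl fun d _ => sum_congr rfl fun x _ => ?_
    rw [add_dotProduct, smul_dotProduct, smul_dotProduct, smul_eq_mul, smul_eq_mul,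
      AddChar.map_add_eq_mul, AddChar.map_add_eq_mul]
    ring
  have h0 : ∀ a : F, a + σ a = 0 → (q : ℝ) ^ 10 ≤
      (∑ c : F, ∑ d : F, ∑ x : Fin 5 → F, ψ (a * herm σ x + (c • l + d • m) ⬝ᵥ x)).re := by
    intro a ha
    simp_rw [sum_trace_zero_linear hF hσ hψ hψ0 ha, Complex.re_sum]
    have hnn : ∀ c d : F, 0 ≤ (if c • l + d • m = 0 then (q : ℂ) ^ 10 else 0).re := by
      intro c d
      split_ifs
      · norm_cast; positivity
      · simp
    calc (q : ℝ) ^ 10 = (if (0 : F) • l + (0 : F) • m = 0 then (q : ℂ) ^ 10 else 0).re := by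
          simp; norm_cast
      _ ≤ ∑ d, (if (0 : F) • l + d • m = 0 then (q : ℂ) ^ 10 else 0).re :=
          single_le_sum (f := fun d => (if (0 : F) • l + d • m = 0 then (q : ℂ) ^ 10 else 0).re)
            (fun d _ => hnn 0 d) (mem_univ 0)
      _ ≤ _ :=
          single_le_sum
            (f := fun c => ∑ d, (if c • l + d • m = 0 then (q : ℂ) ^ 10 else 0).re)
            (fun c _ => sum_nonneg fun d _ => hnn c d) (mem_univ 0)
  have h1 : ∀ a : F, ¬ a + σ a = 0 → -(q : ℝ) ^ 9 ≤
      (∑ c : F, ∑ d : F, ∑ x : Fin 5 → F, ψ (a * herm σ x + (c • l + d • m) ⬝ᵥ x)).re := by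
    intro a ha
    refine (abs_le.1 ((Complex.abs_re_le_norm _).trans ?_)).1
    have hle : ∀ c d : F, ‖∑ x : Fin 5 → F, ψ (a * herm σ x + (c • l + d • m) ⬝ᵥ x)‖ ≤
        (q : ℝ) ^ 5 := by
      intro c d
      have h := norm_sum_apply_herm_add_linear hψ hσσ hψσ ha (c • l + d • m)
      rw [hF, Fintype.card_fin] at h
      refine le_of_eq ((pow_left_inj₀ (norm_nonneg _) (by positivity) two_ne_zero).1 ?_)
      rw [h]; push_cast; ring
    refine (norm_sum_le_of_le _ fun c _ => norm_sum_le_of_le _ fun d _ => hle c d).trans ?_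
    · simp only [sum_const, card_univ, hF, nsmul_eq_mul]
      push_cast
      exact le_of_eq (by ring)
  have hre := congrArg Complex.re key
  rw [← sum_filter_add_sum_filter_not univ (fun a : F => a + σ a = 0), Complex.add_re,
    Complex.re_sum, Complex.re_sum] at hre
  have h2 := card_nsmul_le_sum {a : F | a + σ a = 0} _ _ fun a ha => h0 a (mem_filter.1 ha).2
  have h3 := card_nsmul_le_sum {a : F | ¬ a + σ a = 0} _ _ fun a ha => h1 a (mem_filter.1 ha).2
  rw [nsmul_eq_mul, card_trace_eq_zero hq hF hσ] at h2
  rw [nsmul_eq_mul, card_trace_ne_zero hq hF hσ] at h3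
  have h4 : ((q : ℂ) ^ 6 * N).re = (q : ℝ) ^ 6 * N := by norm_cast
  rw [h4] at hre
  have hq0 : (0 : ℝ) < (q : ℝ) ^ 6 := by positivity
  have : (q : ℝ) ^ 4 ≤ N := le_of_mul_le_mul_left (by nlinarith) hq0
  exact_mod_cast this

end Sections

section Quadrics

open Matrix

variable {q : ℕ} {F : Type} [Field F] {σ : F →+* F} {ψ : AddChar F ℂ}
  {n : Type} [Fintype n]

lemma dotProduct_mulVec_add (A : Matrix n n F) (x y : n → F) :
    (x + y) ⬝ᵥ A *ᵥ (x + y) = x ⬝ᵥ A *ᵥ x + y ⬝ᵥ A *ᵥ y + x ⬝ᵥ (A + Aᵀ) *ᵥ y := by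
  have h : y ⬝ᵥ A *ᵥ x = x ⬝ᵥ Aᵀ *ᵥ y := by
    rw [mulVec_transpose, dotProduct_mulVec, dotProduct_comm]
  rw [mulVec_add, add_dotProduct, dotProduct_add, dotProduct_add, add_mulVec, dotProduct_add, h]
  ring

lemma dotProduct_mulVec_smul (A : Matrix n n F) (c : F) (x : n → F) :
    (c • x) ⬝ᵥ A *ᵥ (c • x) = c ^ 2 * x ⬝ᵥ A *ᵥ x := by
  rw [mulVec_smul, smul_dotProduct, dotProduct_smul, smul_eq_mul, smul_eq_mul]
  ring

variable [Fintype F] [DecidableEq F] [DecidableEq n]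

omit [DecidableEq F] in
lemma card_filter_mem_submodule (W : Submodule F (n → F)) [DecidablePred (· ∈ W)] :
    #{x | x ∈ W} = Fintype.card F ^ Module.finrank F W := by
  rw [← Module.card_eq_pow_finrank (K := F) (V := W), Fintype.card_subtype]

/-- The radical of `a H + b Q` spans a subspace of an eigenspace of `σ(M) M`. -/
lemma card_radical_le (hq : 2 ≤ q) (hF : Fintype.card F = q ^ 2) (hσ : ∀ x, σ x = x ^ q)
    (M : Matrix n n F) {t b : F} (ht : t ≠ 0) (hσt : σ t = t) (hb : b ≠ 0) :
    #{y : n → F | (fun i => t * σ (y i)) + b • M *ᵥ y = 0} ≤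
      q ^ Module.finrank F
        (Module.End.eigenspace (Matrix.toLin' (M.map σ * M)) (t ^ 2 / (b * σ b))) := by
  classical
  have hσσ := frobenius_frobenius hF hσ
  set E := Module.End.eigenspace (Matrix.toLin' (M.map σ * M)) (t ^ 2 / (b * σ b))
  set R : Finset (n → F) := {y | (fun i => t * σ (y i)) + b • M *ᵥ y = 0}
  have hR : ∀ y, y ∈ R ↔ ∀ i, t * σ (y i) + b * (M *ᵥ y) i = 0 := fun y => by
    simp [R, funext_iff]
  have hσb : σ b ≠ 0 := by simpa using hb
  have hRE : ∀ y ∈ R, y ∈ E := by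
    intro y hy
    rw [hR] at hy
    rw [Module.End.mem_eigenspace_iff, toLin'_apply, ← mulVec_mulVec]
    have h1 : M *ᵥ y = fun i => (-t / b) * σ (y i) := by
      ext i
      field_simp
      linear_combination hy i
    have h2 : ∀ i, (M.map σ *ᵥ fun j => σ (y j)) i = -t / σ b * y i := by
      intro i
      have h3 : (M.map σ *ᵥ fun j => σ (y j)) i = σ ((M *ᵥ y) i) := by
        simp [mulVec, dotProduct]
      rw [h3, h1]
      simp [hσσ, hσt]
    ext i
    have h4 : (fun i => (-t / b) * σ (y i)) = (-t / b) • fun i => σ (y i) := rfl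
    rw [h1, h4, mulVec_smul, Pi.smul_apply, h2]
    simp only [smul_eq_mul, Pi.smul_apply]
    field_simp
  obtain ⟨ω, hω⟩ : ∃ ω : F, σ ω ≠ ω := by
    by_contra! h
    have h1 := card_mul_add_pow_eq_zero_le hq (-1 : F)
    rw [filter_true_of_mem fun x _ => by rw [← hσ, h]; ring, card_univ, hF] at h1
    nlinarith
  have hcard : #(R ×ˢ R) ≤ #{x | x ∈ E} := by
    refine card_le_card_of_injOn (fun p => p.1 + ω • p.2) (fun p hp => ?_) ?_
    · simp only [coe_product, Set.mem_prod, mem_coe] at hp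
      simpa using E.add_mem (hRE _ hp.1) (E.smul_mem ω (hRE _ hp.2))
    · rintro ⟨x, y⟩ hp ⟨x', y'⟩ hp' heq
      simp only [coe_product, Set.mem_prod, mem_coe, hR] at hp hp' heq
      have hy : y = y' := by
        ext i
        have e1 : x i + ω * y i = x' i + ω * y' i := by simpa using congrFun heq i
        have e2 : (M *ᵥ x) i + ω * (M *ᵥ y) i = (M *ᵥ x') i + ω * (M *ᵥ y') i := by
          simpa [mulVec_add, mulVec_smul] using congrFun (congrArg (M *ᵥ ·) heq) i
        have e3 : σ (x i) + σ ω * σ (y i) = σ (x' i) + σ ω * σ (y' i) := by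
          simpa using congrArg σ e1
        have e4 : t * (σ ω - ω) * (σ (y i) - σ (y' i)) = 0 := by
          linear_combination t * e3 + b * e2 - hp.1 i - ω * hp.2 i + hp'.1 i + ω * hp'.2 i
        have e5 : σ (y i) = σ (y' i) := by
          simpa [ht, sub_eq_zero, hω] using e4
        exact σ.injective e5
      subst hy
      simpa using heq
  rw [card_product, card_filter_mem_submodule, hF, ← sq, ← pow_mul, mul_comm 2, pow_mul] at hcard
  exact (Nat.pow_le_pow_iff_left two_ne_zero).1 hcard

/-- A degenerate quadratic form which does not vanish on its polar radical has vanishing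
exponential sums. -/
lemma sum_radical_eq_zero (hψ : ψ ≠ 1) (A : Matrix n n F) {b : F} (hb : b ≠ 0) {y₀ : n → F}
    (h₀ : (A + Aᵀ) *ᵥ y₀ = 0) (h₁ : y₀ ⬝ᵥ A *ᵥ y₀ ≠ 0) :
    ∑ y with (A + Aᵀ) *ᵥ y = 0, ψ (b * y ⬝ᵥ A *ᵥ y) = 0 := by
  classical
  have h2 : (2 : F) = 0 := by
    have := dotProduct_mulVec_add A y₀ y₀
    rw [h₀, dotProduct_zero, ← two_smul F y₀, dotProduct_mulVec_smul] at this
    have h3 : (2 : F) * y₀ ⬝ᵥ A *ᵥ y₀ = 0 := by linear_combination this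
    exact (mul_eq_zero.1 h3).resolve_right h₁
  have hchar : ringChar F = 2 :=
    CharP.ringChar_of_prime_eq_zero Nat.prime_two (by exact_mod_cast h2)
  obtain ⟨z, hz⟩ := exists_mul_apply_ne_one hψ (mul_ne_zero hb h₁)
  obtain ⟨c, rfl⟩ := FiniteField.isSquare_of_char_two hchar z
  set S := ∑ y with (A + Aᵀ) *ᵥ y = 0, ψ (b * y ⬝ᵥ A *ᵥ y) with hS
  have hshift : S = ψ (b * y₀ ⬝ᵥ A *ᵥ y₀ * (c * c)) * S := by
    rw [hS, mul_sum]
    refine sum_equiv (Equiv.addRight (c • y₀)).symm (fun y => ?_) fun y hy => ?_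
    · simp [mulVec_add, mulVec_neg, mulVec_smul, h₀]
    · have hy' := (mem_filter.1 hy).2
      obtain ⟨w, rfl⟩ := (Equiv.addRight (c • y₀)).surjective y
      rw [Equiv.symm_apply_apply, Equiv.coe_addRight, dotProduct_mulVec_add, mulVec_smul (A + Aᵀ),
        h₀, smul_zero, dotProduct_zero, dotProduct_mulVec_smul, ← AddChar.map_add_eq_mul]
      congr 1
      ring
  by_contra hne
  exact hz (mul_right_cancel₀ hne (by rw [one_mul]; exact hshift.symm))

end Quadrics

section Bound

open Matrix

variable {q : ℕ} {F : Type} [Field F] [Fintype F] [DecidableEq F] {σ : F →+* F}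
  {ψ : AddChar F ℂ}

omit [Field F] [Fintype F] [DecidableEq F] in
lemma norm_sum_le_card_mul (s : Finset F) (f : F → ℂ) {c : ℝ} (h : ∀ a ∈ s, ‖f a‖ ≤ c) :
    ‖∑ a ∈ s, f a‖ ≤ #s * c :=
  ((norm_sum_le _ _).trans (sum_le_card_nsmul _ _ _ h)).trans_eq (nsmul_eq_mul _ _)

/-- The quadratic form of `A` vanishes on no subspace of dimension at least three of its
polar radical. -/
def HasSmallRadical (A : Matrix (Fin 5) (Fin 5) F) : Prop :=
  ∀ R : Submodule F (Fin 5 → F), (∀ y ∈ R, (A + Aᵀ) *ᵥ y = 0 ∧ y ⬝ᵥ A *ᵥ y = 0) →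
    Module.finrank F R ≤ 2

lemma norm_sum_quadratic_le (hF : Fintype.card F = q ^ 2) (hψ : ψ ≠ 1)
    {A : Matrix (Fin 5) (Fin 5) F} (hA : HasSmallRadical A) {b : F} (hb : b ≠ 0) :
    ‖∑ x : Fin 5 → F, ψ (b * x ⬝ᵥ A *ᵥ x)‖ ≤ q ^ 7 := by
  have hL : ∀ y, b • (A + Aᵀ) *ᵥ y = 0 ↔ (A + Aᵀ) *ᵥ y = 0 := fun y => by simp [hb]
  have hadd : ∀ x y : Fin 5 → F, ψ (b * (x + y) ⬝ᵥ A *ᵥ (x + y)) =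
      ψ (b * x ⬝ᵥ A *ᵥ x) * ψ (b * y ⬝ᵥ A *ᵥ y) * ψ (x ⬝ᵥ b • (A + Aᵀ) *ᵥ y) := fun x y => by
    rw [dotProduct_mulVec_add, dotProduct_smul, smul_eq_mul, ← AddChar.map_add_eq_mul,
      ← AddChar.map_add_eq_mul, mul_add, mul_add]
  by_cases h : ∃ y, (A + Aᵀ) *ᵥ y = 0 ∧ y ⬝ᵥ A *ᵥ y ≠ 0
  · obtain ⟨y, h₀, h₁⟩ := h
    have := quadraticSum_mul_conj hψ (fun x : Fin 5 → F => b * x ⬝ᵥ A *ᵥ x)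
      (fun y => b • (A + Aᵀ) *ᵥ y) hadd
    simp_rw [hL] at this
    rw [sum_radical_eq_zero hψ A hb h₀ h₁, mul_zero, mul_eq_zero, map_eq_zero, or_self] at this
    rw [this, norm_zero]
    positivity
  · push Not at h
    have hdim := hA (LinearMap.ker (toLin' (A + Aᵀ))) fun y hy => by
      rw [LinearMap.mem_ker, toLin'_apply] at hy
      exact ⟨hy, h y hy⟩
    have hcard : #{y : Fin 5 → F | (A + Aᵀ) *ᵥ y = 0} ≤ q ^ 4 := by
      classical
      have := card_filter_mem_submodule (LinearMap.ker (toLin' (A + Aᵀ)))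
      simp only [LinearMap.mem_ker, toLin'_apply] at this
      rw [this, show q ^ 4 = (Fintype.card F) ^ 2 by rw [hF]; ring]
      exact Nat.pow_le_pow_right Fintype.card_pos hdim
    have := norm_quadraticSum_sq_le hψ (fun x : Fin 5 → F => b * x ⬝ᵥ A *ᵥ x)
      (fun y => b • (A + Aᵀ) *ᵥ y) hadd
    simp_rw [hL] at this
    have h2 : ‖∑ x : Fin 5 → F, ψ (b * x ⬝ᵥ A *ᵥ x)‖ ^ 2 ≤ ((q : ℝ) ^ 7) ^ 2 := by
      refine this.trans ?_
      rw [hF, Fintype.card_fin]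
      calc ((q ^ 2 : ℕ) : ℝ) ^ 5 * #{y : Fin 5 → F | (A + Aᵀ) *ᵥ y = 0}
          ≤ ((q ^ 2 : ℕ) : ℝ) ^ 5 * (q ^ 4 : ℕ) := by gcongr
        _ = _ := by push_cast; ring
    exact (pow_le_pow_iff_left₀ (norm_nonneg _) (by positivity) two_ne_zero).1 h2

lemma norm_sum_trace_zero_le (hF : Fintype.card F = q ^ 2) (hσσ : ∀ x, σ (σ x) = x)
    (hψ : ψ ≠ 1) (hψ0 : ∀ z, z + σ z = 0 → ψ z = 1)
    {A : Matrix (Fin 5) (Fin 5) F} (hA : HasSmallRadical A) {a : F} (ha : a + σ a = 0) :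
    ‖∑ b, ∑ x : Fin 5 → F, ψ (a * herm σ x + b * x ⬝ᵥ A *ᵥ x) - q ^ 10‖ ≤
      (q ^ 2 - 1) * q ^ 7 := by
  have h0 : ∑ x : Fin 5 → F, ψ (a * herm σ x + 0 * x ⬝ᵥ A *ᵥ x) = q ^ 10 := by
    simp_rw [zero_mul, add_zero, apply_mul_herm_eq_one hσσ hψ0 ha]
    simp [hF]
    ring
  rw [← add_sum_erase univ _ (mem_univ 0), h0, add_sub_cancel_left]
  refine (norm_sum_le_card_mul _ _ (c := q ^ 7) fun b hb => ?_).trans_eq ?_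
  · simp_rw [AddChar.map_add_eq_mul, apply_mul_herm_eq_one hσσ hψ0 ha, one_mul]
    exact norm_sum_quadratic_le hF hψ hA (ne_of_mem_erase hb)
  · rw [card_erase_of_mem (mem_univ _), card_univ,
      Nat.cast_sub Fintype.card_pos, hF]
    push_cast
    ring

/-- Scalars `b` for which the radical of `a H + b Q` can have dimension at least three. -/
lemma card_large_eigenspace_le (hσ : ∀ x, σ x = x ^ q)
    (N : Module.End F (Fin 5 → F)) {t : F} (ht : t ≠ 0) :
    #{b : F | b ≠ 0 ∧ 3 ≤ Module.finrank F (N.eigenspace (t ^ 2 / (b * σ b)))} ≤ q + 1 := by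
  set B : Finset F := {b : F | b ≠ 0 ∧ 3 ≤ Module.finrank F (N.eigenspace (t ^ 2 / (b * σ b)))}
  rcases B.eq_empty_or_nonempty with h | ⟨b₀, hb₀⟩
  · simp [h]
  refine (card_le_card fun b hb => ?_).trans (card_pow_eq_le (q + 1) q.succ_pos (b₀ ^ (q + 1)))
  simp only [B, mem_filter, mem_univ, true_and] at hb hb₀ ⊢
  have hn : ∀ b, b ^ (q + 1) = b * σ b := fun b => by rw [hσ]; ring
  by_contra hne
  have hne' : t ^ 2 / (b * σ b) ≠ t ^ 2 / (b₀ * σ b₀) := by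
    intro heq
    rw [← hn, ← hn, div_eq_div_iff (pow_ne_zero _ hb.1) (pow_ne_zero _ hb₀.1)] at heq
    exact hne (mul_left_cancel₀ (pow_ne_zero 2 ht) heq).symm
  have hdisj := Module.End.disjoint_genEigenspace N hne' 1 1
  have := Submodule.finrank_add_finrank_le_of_disjoint hdisj
  rw [Module.finrank_fin_fun] at this
  have h1 := hb.2
  have h2 := hb₀.2
  unfold Module.End.eigenspace at h1 h2
  omega

lemma norm_sum_trace_ne_zero_le (hq : 2 ≤ q) (hF : Fintype.card F = q ^ 2)
    (hσ : ∀ x, σ x = x ^ q) (hψ : ψ ≠ 1) (hψσ : ∀ z, ψ (σ z) = ψ z)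
    (hψ0 : ∀ z, z + σ z = 0 → ψ z = 1) (A : Matrix (Fin 5) (Fin 5) F) {a : F}
    (ha : a + σ a ≠ 0) :
    ‖∑ b, ∑ x : Fin 5 → F, ψ (a * herm σ x + b * x ⬝ᵥ A *ᵥ x) + q ^ 5‖ ≤
      (q + 1) * (q ^ 7 * √q) + (q ^ 2 - q - 2) * q ^ 6 := by
  have hσσ := frobenius_frobenius hF hσ
  have hq1 : (1 : ℝ) ≤ q := by exact_mod_cast (by omega : 1 ≤ q)
  set t := a + σ a with ht
  have hσt : σ t = t := by rw [ht, map_add, hσσ, add_comm]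
  set S : F → ℂ := fun b => ∑ x : Fin 5 → F, ψ (a * herm σ x + b * x ⬝ᵥ A *ᵥ x) with hS
  set e : F → ℕ := fun b => Module.finrank F
    (Module.End.eigenspace (toLin' ((A + Aᵀ).map σ * (A + Aᵀ))) (t ^ 2 / (b * σ b)))
  have hle5 : ∀ b, e b ≤ 5 := fun b => (Submodule.finrank_le _).trans_eq (Module.finrank_fin_fun F)
  have hbound : ∀ b, b ≠ 0 → ‖S b‖ ^ 2 ≤ (q : ℝ) ^ 10 * (q : ℝ) ^ e b := by
    intro b hb
    have hadd : ∀ x y : Fin 5 → F,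
        ψ (a * herm σ (x + y) + b * (x + y) ⬝ᵥ A *ᵥ (x + y)) =
        ψ (a * herm σ x + b * x ⬝ᵥ A *ᵥ x) * ψ (a * herm σ y + b * y ⬝ᵥ A *ᵥ y) *
        ψ (x ⬝ᵥ ((fun i => t * σ (y i)) + b • (A + Aᵀ) *ᵥ y)) := fun x y => by
      rw [AddChar.map_add_eq_mul, apply_mul_herm_add hσσ hψσ, dotProduct_mulVec_add,
        dotProduct_add, dotProduct_smul, smul_eq_mul, mul_add, mul_add]
      simp only [AddChar.map_add_eq_mul]
      ring
    refine (norm_quadraticSum_sq_le hψ (fun x : Fin 5 → F => a * herm σ x + b * x ⬝ᵥ A *ᵥ x)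
      (fun y => (fun i => t * σ (y i)) + b • (A + Aᵀ) *ᵥ y) hadd).trans ?_
    have := card_radical_le hq hF hσ (A + Aᵀ) ha hσt hb
    rw [hF, Fintype.card_fin]
    calc _ ≤ ((q ^ 2 : ℕ) : ℝ) ^ 5 * (q ^ e b : ℕ) := by gcongr
      _ = _ := by push_cast; ring
  have hlarge : ∀ b, b ≠ 0 → ‖S b‖ ≤ q ^ 7 * √q := by
    intro b hb
    refine (pow_le_pow_iff_left₀ (norm_nonneg _) (by positivity) two_ne_zero).1 ?_
    refine (hbound b hb).trans ?_
    rw [mul_pow, Real.sq_sqrt (by positivity)]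
    calc (q : ℝ) ^ 10 * (q : ℝ) ^ e b ≤ (q : ℝ) ^ 10 * (q : ℝ) ^ 5 := by gcongr; exact hle5 b
      _ = _ := by ring
  have hsmall : ∀ b, b ≠ 0 → ¬ 3 ≤ e b → ‖S b‖ ≤ q ^ 6 := by
    intro b hb he
    refine (pow_le_pow_iff_left₀ (norm_nonneg _) (by positivity) two_ne_zero).1 ?_
    refine (hbound b hb).trans ?_
    calc (q : ℝ) ^ 10 * (q : ℝ) ^ e b ≤ (q : ℝ) ^ 10 * (q : ℝ) ^ 2 := by
          gcongr
          · omega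
      _ = _ := by ring
  have h0 : S 0 = -q ^ 5 := by
    simp only [hS, zero_mul, add_zero]
    rw [sum_apply_mul_herm hq hF hσ hψ hψσ hψ0 ha, Fintype.card_fin]
    ring
  set B : Finset F := {b : F | b ≠ 0 ∧ 3 ≤ e b} with hB
  have hBcard : #B ≤ q + 1 := card_large_eigenspace_le hσ _ ha
  have hBsub : B ⊆ univ.erase 0 := fun b hb => by simpa using (mem_filter.1 hb).2.1
  have hcard : #(univ.erase 0 \ B) + #B = q ^ 2 - 1 := by
    rw [card_sdiff_add_card_eq_card hBsub, card_erase_of_mem (mem_univ _), card_univ, hF]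
  have hcard' : (#(univ.erase 0 \ B) : ℝ) = q ^ 2 - 1 - #B := by
    have h1 : 1 ≤ q ^ 2 := Nat.one_le_pow _ _ (by omega)
    have := congrArg (Nat.cast (R := ℝ)) hcard
    push_cast [Nat.cast_sub h1] at this
    linarith
  change ‖∑ b, S b + q ^ 5‖ ≤ _
  rw [← add_sum_erase univ _ (mem_univ 0), h0, neg_add_cancel_comm, ← sum_sdiff hBsub]
  have h1 : ‖∑ b ∈ univ.erase 0 \ B, S b‖ ≤ (q ^ 2 - 1 - #B) * q ^ 6 := by
    refine (norm_sum_le_card_mul _ _ (c := q ^ 6) fun b hb => ?_).trans_eq ?_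
    · rw [mem_sdiff, mem_erase] at hb
      exact hsmall b hb.1.1 fun h => hb.2 (by simp [hB, hb.1.1, h])
    · rw [hcard']
  have h2 : ‖∑ b ∈ B, S b‖ ≤ #B * (q ^ 7 * √q) := by
    exact norm_sum_le_card_mul _ _ fun b hb => hlarge b (mem_filter.1 hb).2.1
  have h3 : (q : ℝ) ^ 6 ≤ q ^ 7 * √q := by
    have : 1 ≤ √(q : ℝ) := Real.one_le_sqrt.2 hq1
    calc (q : ℝ) ^ 6 = q ^ 6 * 1 * 1 := by ring
      _ ≤ q ^ 6 * q * √q := by gcongr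
      _ = _ := by ring
  have h4 : (#B : ℝ) ≤ q + 1 := by exact_mod_cast hBcard
  have h5 := norm_add_le (∑ b ∈ univ.erase 0 \ B, S b) (∑ b ∈ B, S b)
  nlinarith [mul_nonneg (sub_nonneg.2 h4) (sub_nonneg.2 h3)]

lemma sqrt_bound (hq : 2 ≤ q) : (q : ℝ) ^ 2 * √q < q ^ 3 - 2 * q ^ 2 + 2 * q + 2 := by
  have hs := Real.sq_sqrt (Nat.cast_nonneg (α := ℝ) q)
  have hs0 := Real.sqrt_nonneg (q : ℝ)
  rcases hq.lt_or_eq with h3 | rfl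
  · rcases (show 3 ≤ q from h3).lt_or_eq with h4 | rfl
    · have h4' : (4 : ℝ) ≤ q := by exact_mod_cast h4
      have h2 : (2 : ℝ) ≤ √q := Real.le_sqrt_of_sq_le (by linarith)
      have : √(q : ℝ) ≤ q - 2 := by nlinarith
      nlinarith [mul_le_mul_of_nonneg_left this (sq_nonneg (q : ℝ))]
    · have : √((3 : ℕ) : ℝ) < 17 / 9 := by
        rw [Real.sqrt_lt' (by norm_num)]; norm_num
      push_cast at *
      linarith
  · have : √((2 : ℕ) : ℝ) < 3 / 2 := by
      rw [Real.sqrt_lt' (by norm_num)]; norm_num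
    push_cast at *
    linarith

lemma card_zeros_lt_of_hasSmallRadical (hq : 2 ≤ q) (hF : Fintype.card F = q ^ 2)
    (hσ : ∀ x, σ x = x ^ q) {A : Matrix (Fin 5) (Fin 5) F} (hA : HasSmallRadical A) :
    #{x : Fin 5 → F | herm σ x = 0 ∧ x ⬝ᵥ A *ᵥ x = 0} + q ^ 5 + q ^ 3 + q ^ 2 <
      2 * q ^ 7 + 2 * q ^ 4 := by
  obtain ⟨ψ, hψ, hψσ, hψ0⟩ := exists_addChar hq hF hσ
  have hσσ := frobenius_frobenius hF hσ
  set N := #{x : Fin 5 → F | herm σ x = 0 ∧ x ⬝ᵥ A *ᵥ x = 0}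
  have key := card_sq_mul_card_zeros hψ (herm σ) (fun x : Fin 5 → F => x ⬝ᵥ A *ᵥ x)
  set T : F → ℂ := fun a => ∑ b, ∑ x : Fin 5 → F, ψ (a * herm σ x + b * x ⬝ᵥ A *ᵥ x)
  have hz := card_trace_eq_zero hq hF hσ
  have hnz := card_trace_ne_zero hq hF hσ
  have h0 : ‖∑ a with a + σ a = 0, (T a - q ^ 10)‖ ≤ q * ((q ^ 2 - 1) * q ^ 7) := by
    refine (norm_sum_le_card_mul _ _ fun a ha =>
      norm_sum_trace_zero_le hF hσσ hψ hψ0 hA (mem_filter.1 ha).2).trans_eq ?_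
    rw [hz]
  have h1 : ‖∑ a with ¬ a + σ a = 0, (T a + q ^ 5)‖ ≤
      (q ^ 2 - q) * ((q + 1) * (q ^ 7 * √q) + (q ^ 2 - q - 2) * q ^ 6) := by
    refine (norm_sum_le_card_mul _ _ fun a ha =>
      norm_sum_trace_ne_zero_le hq hF hσ hψ hψσ hψ0 A (mem_filter.1 ha).2).trans_eq ?_
    rw [hnz]
  have hsum : ((q ^ 4 * N - q ^ 11 + (q ^ 2 - q) * q ^ 5 : ℝ) : ℂ) =
      ∑ a with a + σ a = 0, (T a - q ^ 10) + ∑ a with ¬ a + σ a = 0, (T a + q ^ 5) := by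
    have hnz' : (#{a : F | ¬ a + σ a = 0} : ℂ) = q ^ 2 - q := by
      exact_mod_cast congrArg Complex.ofReal hnz
    have hT := sum_filter_add_sum_filter_not univ (fun a : F => a + σ a = 0) T
    rw [sum_sub_distrib, sum_add_distrib, sum_const, sum_const, hz, nsmul_eq_mul, nsmul_eq_mul,
      hnz']
    rw [hF] at key
    push_cast at key ⊢
    linear_combination key - hT
  have h2 := (norm_add_le _ _).trans (add_le_add h0 h1)
  rw [← hsum, Complex.norm_real, Real.norm_eq_abs] at h2
  have h3 := (le_abs_self _).trans h2
  have hs := sqrt_bound hq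
  have hq2 : (2 : ℝ) ≤ q := by exact_mod_cast hq
  have h4 : 0 < (q : ℝ) ^ 6 * (q ^ 2 - 1) := by
    have : (0 : ℝ) < q ^ 2 - 1 := by nlinarith
    positivity
  have h5 := mul_lt_mul_of_pos_left hs h4
  have h6 : (q : ℝ) ^ 4 * (N + q ^ 5 + q ^ 3 + q ^ 2) < q ^ 4 * (2 * q ^ 7 + 2 * q ^ 4) := by
    nlinarith
  exact_mod_cast lt_of_mul_lt_mul_left h6 (by positivity)

end Bound

section Forms

open Matrix

variable {q : ℕ} {F : Type} [Field F]

lemma exists_eq_single_add {n : ℕ} (d : Fin 5 →₀ ℕ) (hd : d.degree = n + 1) :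
    ∃ (i : Fin 5) (e : Fin 5 →₀ ℕ), d = Finsupp.single i 1 + e ∧ e.degree = n := by
  have hne : d ≠ 0 := by
    rintro rfl
    simp at hd
  obtain ⟨i, hi⟩ := Finsupp.ne_iff.1 hne
  have hle : Finsupp.single i 1 ≤ d := by
    rw [Finsupp.single_le_iff]
    exact Nat.one_le_iff_ne_zero.2 (by simpa using hi)
  have hsum := add_tsub_cancel_of_le hle
  refine ⟨i, d - Finsupp.single i 1, hsum.symm, ?_⟩
  have := congrArg Finsupp.degree hsum
  rw [map_add, Finsupp.degree_single, hd] at this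
  omega

lemma degree_of_mem_support {G : MvPolynomial (Fin 5) F} {n : ℕ} (hG : G.IsHomogeneous n)
    {d : Fin 5 →₀ ℕ} (hd : d ∈ G.support) : d.degree = n := by
  by_contra h
  exact mem_support_iff.1 hd (hG.coeff_eq_zero h)

lemma exists_eval_eq_dotProduct {G : MvPolynomial (Fin 5) F} (hG : G.IsHomogeneous 1) :
    ∃ l : Fin 5 → F, ∀ x, eval x G = l ⬝ᵥ x := by
  have h : ∀ d ∈ G.support, ∃ l : Fin 5 → F, ∀ x, eval x (monomial d (coeff d G)) = l ⬝ᵥ x := by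
    intro d hd
    obtain ⟨i, e, rfl, he⟩ := exists_eq_single_add d (degree_of_mem_support hG hd)
    rw [Finsupp.degree_eq_zero_iff] at he
    subst he
    refine ⟨Pi.single i (coeff (Finsupp.single i 1 + 0) G), fun x => ?_⟩
    simp [eval_monomial]
  choose! l hl using h
  refine ⟨∑ d ∈ G.support, l d, fun x => ?_⟩
  conv_lhs => rw [G.as_sum, map_sum]
  rw [sum_dotProduct]
  exact sum_congr rfl fun d hd => hl d hd x

lemma exists_eval_eq_quadratic {G : MvPolynomial (Fin 5) F} (hG : G.IsHomogeneous 2) :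
    ∃ A : Matrix (Fin 5) (Fin 5) F, ∀ x, eval x G = x ⬝ᵥ A *ᵥ x := by
  have h : ∀ d ∈ G.support, ∃ A : Matrix (Fin 5) (Fin 5) F,
      ∀ x, eval x (monomial d (coeff d G)) = x ⬝ᵥ A *ᵥ x := by
    intro d hd
    obtain ⟨i, e, rfl, he⟩ := exists_eq_single_add d (degree_of_mem_support hG hd)
    obtain ⟨j, e', rfl, he'⟩ := exists_eq_single_add e he
    rw [Finsupp.degree_eq_zero_iff] at he'
    subst he'
    generalize coeff _ G = c
    refine ⟨Matrix.single i j c, fun x => ?_⟩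
    have hc : monomial (Finsupp.single i 1 + (Finsupp.single j 1 + 0)) c = C c * X i * X j := by
      rw [X, X, C_mul_monomial, monomial_mul, add_zero, mul_one, mul_one]
    rw [hc]
    simp [ dotProduct, Matrix.single_mulVec, Function.update_apply]
    ring
  choose! A hA using h
  refine ⟨∑ d ∈ G.support, A d, fun x => ?_⟩
  conv_lhs => rw [G.as_sum, map_sum]
  rw [sum_mulVec, dotProduct_sum]
  exact sum_congr rfl fun d hd => hA d hd x

/-- A binary quadratic form with a nontrivial zero is a product of linear forms. -/
lemma binary_factor {α β γ s t : F} (hst : s ≠ 0 ∨ t ≠ 0)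
    (h : α * s ^ 2 + β * (s * t) + γ * t ^ 2 = 0) :
    ∃ a b c d : F, ∀ x y,
      α * x ^ 2 + β * (x * y) + γ * y ^ 2 = (a * x + b * y) * (c * x + d * y) := by
  by_cases hs : s = 0
  · subst hs
    have hγ : γ = 0 := by simpa [hst.resolve_left (fun h => h rfl)] using h
    exact ⟨1, 0, α, β, fun x y => by rw [hγ]; ring⟩
  · obtain ⟨τ, rfl⟩ : ∃ τ, t = τ * s := ⟨t / s, by field_simp⟩
    have h' : α + β * τ + γ * τ ^ 2 = 0 :=
      (mul_eq_zero.1 (by linear_combination h : s ^ 2 * _ = 0)).resolve_left (pow_ne_zero 2 hs)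
    exact ⟨-τ, 1, β + γ * τ, γ, fun x y => by linear_combination x ^ 2 * h'⟩

/-- A quadratic form vanishing on a three-dimensional subspace of its polar radical is a form
in two linear functionals. -/
lemma exists_binary_form (A : Matrix (Fin 5) (Fin 5) F) (hA : ¬ HasSmallRadical A) :
    ∃ (R : Submodule F (Fin 5 → F)) (l m : Fin 5 → F) (α β γ : F), Module.finrank F R = 3 ∧
      (∀ x, l ⬝ᵥ x = 0 → m ⬝ᵥ x = 0 → x ∈ R) ∧
      ∀ x, x ⬝ᵥ A *ᵥ x = α * (l ⬝ᵥ x) ^ 2 + β * (l ⬝ᵥ x * m ⬝ᵥ x) + γ * (m ⬝ᵥ x) ^ 2 := by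
  unfold HasSmallRadical at hA
  push Not at hA
  obtain ⟨R₀, hR₀, hdim⟩ := hA
  obtain ⟨f, hf⟩ := exists_linearIndependent_of_le_finrank (show 3 ≤ Module.finrank F R₀ from hdim)
  have hf' : LinearIndependent F fun i => (f i : Fin 5 → F) :=
    hf.map' R₀.subtype R₀.ker_subtype
  set R : Submodule F (Fin 5 → F) := Submodule.span F (Set.range fun i => (f i : Fin 5 → F))
  have hR3 : Module.finrank F R = 3 := by
    rw [finrank_span_eq_card hf', Fintype.card_fin]
  have hRR : R ≤ R₀ := by
    rw [Submodule.span_le]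
    rintro _ ⟨i, rfl⟩
    exact (f i).2
  have hquot : Module.finrank F ((Fin 5 → F) ⧸ R) = 2 := by
    have := R.finrank_quotient_add_finrank
    rw [hR3, Module.finrank_fin_fun] at this
    omega
  let B := Module.finBasisOfFinrankEq F ((Fin 5 → F) ⧸ R) hquot
  obtain ⟨u, hu⟩ := R.mkQ_surjective (B 0)
  obtain ⟨v, hv⟩ := R.mkQ_surjective (B 1)
  let l := (dotProductEquiv F (Fin 5)).symm (B.coord 0 ∘ₗ R.mkQ)
  let m := (dotProductEquiv F (Fin 5)).symm (B.coord 1 ∘ₗ R.mkQ)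
  have hl : ∀ x, l ⬝ᵥ x = B.coord 0 (R.mkQ x) := fun x =>
    LinearMap.congr_fun ((dotProductEquiv F (Fin 5)).apply_symm_apply (B.coord 0 ∘ₗ R.mkQ)) x
  have hm : ∀ x, m ⬝ᵥ x = B.coord 1 (R.mkQ x) := fun x =>
    LinearMap.congr_fun ((dotProductEquiv F (Fin 5)).apply_symm_apply (B.coord 1 ∘ₗ R.mkQ)) x
  have hmem : ∀ x, x - ((l ⬝ᵥ x) • u + (m ⬝ᵥ x) • v) ∈ R := by
    intro x
    rw [← R.ker_mkQ, LinearMap.mem_ker, map_sub, map_add, map_smul, map_smul, hu, hv, hl, hm,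
      sub_eq_zero]
    conv_lhs => rw [← B.sum_repr (R.mkQ x), Fin.sum_univ_two]
    rfl
  refine ⟨R, l, m, u ⬝ᵥ A *ᵥ u, u ⬝ᵥ (A + Aᵀ) *ᵥ v, v ⬝ᵥ A *ᵥ v, hR3, fun x h₁ h₂ => ?_,
    fun x => ?_⟩
  · have := hmem x
    rwa [h₁, h₂, zero_smul, zero_smul, add_zero, sub_zero] at this
  · obtain ⟨h₁, h₂⟩ := hR₀ _ (hRR (hmem x))
    have := dotProduct_mulVec_add A ((l ⬝ᵥ x) • u + (m ⬝ᵥ x) • v)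
      (x - ((l ⬝ᵥ x) • u + (m ⬝ᵥ x) • v))
    rw [h₁, h₂, dotProduct_zero, add_zero, add_zero, add_sub_cancel, dotProduct_mulVec_add,
      dotProduct_mulVec_smul, dotProduct_mulVec_smul, mulVec_smul, smul_dotProduct,
      dotProduct_smul, smul_eq_mul, smul_eq_mul] at this
    rw [this]
    ring

variable [Fintype F] [DecidableEq F] {σ : F →+* F}

/-- A quadric with many points on the Hermitian variety is a pair of hyperplanes. -/
lemma exists_eq_dotProduct_mul (hq : 2 ≤ q) (hF : Fintype.card F = q ^ 2) (hσ : ∀ x, σ x = x ^ q)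
    (A : Matrix (Fin 5) (Fin 5) F)
    (hN : 2 * q ^ 7 + 2 * q ^ 4 ≤
      #{x : Fin 5 → F | herm σ x = 0 ∧ x ⬝ᵥ A *ᵥ x = 0} + q ^ 5 + q ^ 3 + q ^ 2) :
    ∃ l m : Fin 5 → F, ∀ x, x ⬝ᵥ A *ᵥ x = l ⬝ᵥ x * m ⬝ᵥ x := by
  classical
  have hA : ¬ HasSmallRadical A := fun h =>
    (card_zeros_lt_of_hasSmallRadical hq hF hσ h).not_ge hN
  obtain ⟨R, l, m, α, β, γ, hR, hmem, hQ⟩ := exists_binary_form A hA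
  by_cases h : ∃ s t, (s ≠ 0 ∨ t ≠ 0) ∧ α * s ^ 2 + β * (s * t) + γ * t ^ 2 = 0
  · obtain ⟨s, t, hst, h⟩ := h
    obtain ⟨a, b, c, d, hfac⟩ := binary_factor hst h
    refine ⟨a • l + b • m, c • l + d • m, fun x => ?_⟩
    simp only [hQ, hfac, add_dotProduct, smul_dotProduct, smul_eq_mul]
  · push Not at h
    exfalso
    have hsub : #{x : Fin 5 → F | herm σ x = 0 ∧ x ⬝ᵥ A *ᵥ x = 0} ≤ q ^ 6 := by
      calc _ ≤ #{x | x ∈ R} := by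
            refine card_le_card fun x hx => ?_
            have hx' := (mem_filter.1 hx).2.2
            rw [hQ] at hx'
            rw [mem_filter]
            refine ⟨mem_univ _, ?_⟩
            by_contra hxR
            refine h _ _ ?_ hx'
            by_contra! h0
            exact hxR (hmem x h0.1 h0.2)
        _ = q ^ 6 := by rw [card_filter_mem_submodule, hR, hF]; ring
    have h1 : q ^ 6 * 2 ≤ q ^ 7 := by rw [pow_succ q 6]; gcongr
    have h2 : q ^ 5 * 2 ≤ q ^ 6 := by rw [pow_succ q 5]; gcongr
    have h3 : q ^ 4 * 2 ≤ q ^ 5 := by rw [pow_succ q 4]; gcongr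
    have h4 : q ^ 3 * 2 ≤ q ^ 4 := by rw [pow_succ q 3]; gcongr
    have h5 : q ^ 2 * 2 ≤ q ^ 3 := by rw [pow_succ q 2]; gcongr
    have h6 : 0 < q ^ 2 := by positivity
    omega

end Forms

section Projective

open Matrix

variable {q : ℕ} {F : Type} [Field F] {σ : F →+* F}

/-- The hyperplane with coefficient vector `l`. -/
def hyp (l : Fin 5 → F) : Set (P4 F) := {x | l ⬝ᵥ x.rep = 0}

lemma VG_eq_hyp {L : MvPolynomial (Fin 5) F} {l : Fin 5 → F} (hl : ∀ x, eval x L = l ⬝ᵥ x) :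
    VG L = hyp l := by
  simp [VG, hyp, hl]

lemma VG_C_mul_mul {c : F} (hc : c ≠ 0) (L M : MvPolynomial (Fin 5) F) :
    VG (C c * (L * M)) = VG L ∪ VG M := by
  ext x
  simp [VG, hc]

lemma mem_hermV3 (hσ : ∀ x, σ x = x ^ q) (x : P4 F) : x ∈ hermV3 q F ↔ herm σ x.rep = 0 := by
  have : herm σ x.rep = ∑ i, x.rep i ^ (q + 1) :=
    sum_congr rfl fun i _ => by rw [hσ, pow_succ']
  rw [this]
  rfl

lemma herm_map (hσσ : ∀ x, σ (σ x) = x) (x : Fin 5 → F) : herm σ (fun i => σ (x i)) = herm σ x :=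
  sum_congr rfl fun i _ => by rw [hσσ, mul_comm]

lemma isHomogeneous_linearForm (l : Fin 5 → F) :
    (∑ i, C (l i) * X i : MvPolynomial (Fin 5) F).IsHomogeneous 1 :=
  IsHomogeneous.sum _ _ _ fun i _ => isHomogeneous_C_mul_X (l i) i

lemma eval_linearForm (l x : Fin 5 → F) : eval x (∑ i, C (l i) * X i) = l ⬝ᵥ x := by
  simp [dotProduct]

variable [Fintype F]

/-- A scaling-invariant set of vectors is a cone over a set of projective points. -/
lemma card_cone (hF : Fintype.card F = q ^ 2) (P : (Fin 5 → F) → Prop) [DecidablePred P]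
    (h0 : P 0) (hP : ∀ (c : F) v, c ≠ 0 → (P (c • v) ↔ P v)) :
    #{v : Fin 5 → F | P v} = (q ^ 2 - 1) * {x : P4 F | P x.rep}.ncard + 1 := by
  classical
  have hfin : Fintype (P4 F) := Fintype.ofFinite _
  have hcard : #(({x : P4 F | P x.rep} : Finset (P4 F)) ×ˢ (univ : Finset Fˣ)) =
      #{v : Fin 5 → F | v ≠ 0 ∧ P v} := by
    refine card_bij (fun p _ => (p.2 : F) • p.1.rep) (fun p hp => ?_) ?_ fun v hv => ?_
    · rw [mem_product, mem_filter] at hp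
      rw [mem_filter]
      exact ⟨mem_univ _, smul_ne_zero p.2.ne_zero p.1.rep_nonzero,
        (hP _ _ p.2.ne_zero).2 hp.1.2⟩
    · rintro ⟨x, a⟩ - ⟨y, b⟩ - heq
      have hxy : x = y := by
        rw [← x.mk_rep, ← y.mk_rep, Projectivization.mk_eq_mk_iff]
        have heq' : a • x.rep = b • y.rep := heq
        exact ⟨a⁻¹ * b, by rw [mul_smul, ← heq', inv_smul_smul]⟩
      subst hxy
      have hab : a = b := Units.ext (smul_left_injective F x.rep_nonzero heq)
      rw [hab]
    · obtain ⟨hv0, hPv⟩ := (mem_filter.1 hv).2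
      obtain ⟨a, ha⟩ := Projectivization.exists_smul_eq_mk_rep F v hv0
      have ha' : (a⁻¹ : Fˣ) • (Projectivization.mk F v hv0).rep = v := by rw [← ha, inv_smul_smul]
      refine ⟨(Projectivization.mk F v hv0, a⁻¹), ?_, ha'⟩
      rw [mem_product, mem_filter]
      refine ⟨⟨mem_univ _, ?_⟩, mem_univ _⟩
      rw [← ha]
      exact (hP _ _ a.ne_zero).2 hPv
  have hins : ({v : Fin 5 → F | P v} : Finset _) =
      insert 0 ({v : Fin 5 → F | v ≠ 0 ∧ P v} : Finset _) := by
    ext v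
    by_cases hv : v = 0
    · simp [hv, h0]
    · simp [hv]
  rw [hins, card_insert_of_notMem (by simp), ← hcard, card_product, card_univ,
    Fintype.card_units, hF, mul_comm, Set.ncard_eq_toFinset_card', Set.toFinset_ofPred]

lemma card_zeros_eq [DecidableEq F] (hF : Fintype.card F = q ^ 2) (hσ : ∀ x, σ x = x ^ q)
    (P : (Fin 5 → F) → Prop) [DecidablePred P]
    (h0 : P 0) (hP : ∀ (c : F) v, c ≠ 0 → (P (c • v) ↔ P v)) :
    #{v : Fin 5 → F | herm σ v = 0 ∧ P v} =
      (q ^ 2 - 1) * ({x : P4 F | P x.rep} ∩ hermV3 q F).ncard + 1 := by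
  rw [card_cone hF (fun v => herm σ v = 0 ∧ P v) ⟨by simp [herm], h0⟩ fun c v hc => by
    simp [herm_smul, hc, hP]]
  congr 3
  ext x
  rw [Set.mem_inter_iff, mem_hermV3 hσ, and_comm]
  rfl

lemma ncard_hyp_inter (hq : 2 ≤ q) (hF : Fintype.card F = q ^ 2) (hσ : ∀ x, σ x = x ^ q)
    {l : Fin 5 → F} (hl : l ≠ 0) :
    (herm σ l = 0 → (hyp l ∩ hermV3 q F).ncard = q ^ 5 + q ^ 2 + 1) ∧
      (herm σ l ≠ 0 → (hyp l ∩ hermV3 q F).ncard = q ^ 5 + q ^ 3 + q ^ 2 + 1) := by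
  classical
  have h1 := card_zeros_eq hF hσ (fun x => l ⬝ᵥ x = 0) (by simp) fun c v hc => by simp [hc]
  have h2 := card_hyperplane_section hq hF hσ l hl
  have hq1 : 1 ≤ q ^ 2 := Nat.one_le_pow _ _ (by omega)
  have hpos : (0 : ℤ) < q ^ 2 - 1 := by
    have : (2 : ℤ) ≤ q := by exact_mod_cast hq
    nlinarith
  rw [h1] at h2
  change (q ^ 2 - 1) * (hyp l ∩ hermV3 q F).ncard + 1 + _ = _ at h2
  constructor <;> intro h
  · rw [if_pos h] at h2
    zify [hq1] at h2 ⊢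
    exact mul_left_cancel₀ hpos.ne' (by linear_combination h2)
  · rw [if_neg h] at h2
    zify [hq1] at h2 ⊢
    exact mul_left_cancel₀ hpos.ne' (by linear_combination h2)

lemma le_ncard_hyp_inter_hyp (hq : 2 ≤ q) (hF : Fintype.card F = q ^ 2) (hσ : ∀ x, σ x = x ^ q)
    (l m : Fin 5 → F) :
    q ^ 4 ≤ (q ^ 2 - 1) * ((hyp l ∩ hyp m) ∩ hermV3 q F).ncard + 1 := by
  classical
  have := card_zeros_eq hF hσ (fun x => l ⬝ᵥ x = 0 ∧ m ⬝ᵥ x = 0) (by simp) fun c v hc => by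
    simp [hc]
  exact (card_plane_section_ge hq hF hσ l m).trans_eq this

lemma isTangentHyp_hyp (hq : 2 ≤ q) (hF : Fintype.card F = q ^ 2) (hσ : ∀ x, σ x = x ^ q)
    {l : Fin 5 → F} (hl : l ≠ 0) : IsTangentHyp q (hyp l) ↔ herm σ l = 0 := by
  have hσσ := frobenius_frobenius hF hσ
  have hmap : ∀ {v : Fin 5 → F}, v ≠ 0 → (fun i => σ (v i)) ≠ 0 := fun hv h =>
    hv (funext fun i => by simpa using congrFun h i)
  have htan : ∀ P : P4 F, tangentHyp q P = hyp fun i => σ (P.rep i) := fun P => by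
    simp [tangentHyp, hyp, dotProduct, hσ]
  constructor
  · rintro ⟨P, hP, heq⟩
    rw [mem_hermV3 hσ, ← herm_map hσσ] at hP
    rw [htan] at heq
    by_contra h
    have h1 := (ncard_hyp_inter hq hF hσ hl).2 h
    have h2 := (ncard_hyp_inter hq hF hσ (hmap P.rep_nonzero)).1 hP
    have h3 : 0 < q ^ 3 := by positivity
    rw [heq] at h1
    omega
  · intro h
    obtain ⟨a, ha⟩ := Projectivization.exists_smul_eq_mk_rep F _ (hmap hl)
    refine ⟨Projectivization.mk F _ (hmap hl), ?_, ?_⟩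
    · rw [mem_hermV3 hσ, ← ha, Units.smul_def, herm_smul, herm_map hσσ, h, mul_zero]
    · rw [htan, ← ha]
      have h1 : (fun i => σ ((a • fun i => σ (l i)) i)) = σ a • l := by
        ext i
        simp [Units.smul_def, hσσ]
      rw [h1]
      ext x
      simp [hyp]

lemma eq_zero_of_eval_eq_zero (hq : 2 ≤ q) (hF : Fintype.card F = q ^ 2)
    {G : MvPolynomial (Fin 5) F} (hG : G.IsHomogeneous 2) (h : ∀ x, eval x G = 0) : G = 0 := by
  refine hG.funext_of_le_card (isHomogeneous_zero _ _ _) (fun x => by rw [h, map_zero]) ?_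
  rw [Cardinal.mk_fintype, hF]
  exact_mod_cast hq.trans (Nat.le_self_pow two_ne_zero q)

lemma ncard_add_ncard_inter (l m : Fin 5 → F) :
    ((hyp l ∪ hyp m) ∩ hermV3 q F).ncard + ((hyp l ∩ hyp m) ∩ hermV3 q F).ncard =
      (hyp l ∩ hermV3 q F).ncard + (hyp m ∩ hermV3 q F).ncard := by
  rw [Set.union_inter_distrib_right, Set.inter_inter_distrib_right]
  exact Set.ncard_union_add_ncard_inter _ _

lemma ncard_union_iff (hq : 2 ≤ q) (hF : Fintype.card F = q ^ 2) (hσ : ∀ x, σ x = x ^ q)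
    {l m : Fin 5 → F} (hl : l ≠ 0) (hm : m ≠ 0) :
    ((hyp l ∪ hyp m) ∩ hermV3 q F).ncard = 2 * (q ^ 5 + q ^ 2) + q ^ 3 + 1 ↔
      hyp l ≠ hyp m ∧ ¬ IsTangentHyp q (hyp l) ∧ ¬ IsTangentHyp q (hyp m) ∧
        ((hyp l ∩ hyp m) ∩ hermV3 q F).ncard = q ^ 3 + 1 := by
  rw [isTangentHyp_hyp hq hF hσ hl, isTangentHyp_hyp hq hF hσ hm]
  have hsum := ncard_add_ncard_inter (q := q) l m
  obtain ⟨hl0, hl1⟩ := ncard_hyp_inter hq hF hσ hl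
  obtain ⟨hm0, hm1⟩ := ncard_hyp_inter hq hF hσ hm
  have hplane := le_ncard_hyp_inter_hyp hq hF hσ l m
  have hq3 : 2 ≤ q ^ 3 := hq.trans (Nat.le_self_pow (by norm_num) q)
  have hq4 : q ^ 2 < q ^ 4 := Nat.pow_lt_pow_right (by omega) (by norm_num)
  have hq5 : 0 < q ^ 5 := by positivity
  have hone : ((hyp l ∩ hyp m) ∩ hermV3 q F).ncard ≠ 1 := by
    intro h
    rw [h, mul_one] at hplane
    have : 0 < q ^ 2 := by positivity
    omega
  constructor
  · intro h
    refine ⟨fun heq => ?_, ?_⟩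
    · rw [heq, Set.union_self] at h
      by_cases h0 : herm σ m = 0
      · have := hm0 h0
        omega
      · have := hm1 h0
        omega
    · by_cases h0 : herm σ l = 0 <;> by_cases h1 : herm σ m = 0
      · have := hl0 h0
        have := hm0 h1
        omega
      · have := hl0 h0
        have := hm1 h1
        omega
      · have := hl1 h0
        have := hm0 h1
        omega
      · have := hl1 h0
        have := hm1 h1
        exact ⟨h0, h1, by omega⟩
  · rintro ⟨-, h0, h1, h⟩
    have := hl1 h0
    have := hm1 h1
    omega

theorem ncard_quadric_inter_iff (hq : IsPrimePow q) (hF : Fintype.card F = q ^ 2)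
    (G : MvPolynomial (Fin 5) F) (hG : G ≠ 0) (hGd : G.IsHomogeneous 2) :
    (VG G ∩ hermV3 q F).ncard = 2 * (q ^ 5 + q ^ 2) + q ^ 3 + 1 ↔
      ∃ (c : F) (L₁ L₂ : MvPolynomial (Fin 5) F), c ≠ 0 ∧
        L₁.IsHomogeneous 1 ∧ L₂.IsHomogeneous 1 ∧
        G = C c * (L₁ * L₂) ∧
        VG L₁ ≠ VG L₂ ∧
        ¬ IsTangentHyp q (VG L₁) ∧ ¬ IsTangentHyp q (VG L₂) ∧
        ((VG L₁ ∩ VG L₂) ∩ hermV3 q F).ncard = q ^ 3 + 1 := by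
  classical
  obtain ⟨σ, hσ⟩ := exists_frobenius hq hF
  have hq2 := hq.two_le
  have hne : ∀ {c : F} {L M : MvPolynomial (Fin 5) F} {l m : Fin 5 → F},
      (∀ x, eval x L = l ⬝ᵥ x) → (∀ x, eval x M = m ⬝ᵥ x) → G = C c * (L * M) →
      l ≠ 0 ∧ m ≠ 0 := by
    intro c L M l m hl hm hGLM
    constructor <;> rintro rfl <;>
      exact hG (eq_zero_of_eval_eq_zero hq2 hF hGd fun x => by simp [hGLM, hl, hm])
  constructor
  · intro h
    obtain ⟨A, hA⟩ := exists_eval_eq_quadratic hGd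
    have hcard := card_zeros_eq hF hσ (fun x => x ⬝ᵥ A *ᵥ x = 0) (by simp) fun c v hc => by
      rw [dotProduct_mulVec_smul]
      simp [hc]
    simp_rw [← hA] at hcard
    change _ = (q ^ 2 - 1) * (VG G ∩ hermV3 q F).ncard + 1 at hcard
    rw [h] at hcard
    obtain ⟨l, m, hlm⟩ := exists_eq_dotProduct_mul hq2 hF hσ A (by
      simp_rw [← hA]
      rw [hcard]
      have : 1 ≤ q ^ 2 := Nat.one_le_pow _ _ (by omega)
      zify [this]
      linarith)
    have hfac : G = C 1 * ((∑ i, C (l i) * X i) * ∑ i, C (m i) * X i) := by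
      rw [← sub_eq_zero]
      refine eq_zero_of_eval_eq_zero hq2 hF (hGd.sub ?_) fun x => ?_
      · rw [C_1, one_mul]
        exact (isHomogeneous_linearForm l).mul (isHomogeneous_linearForm m)
      · rw [map_sub, map_mul, map_mul, eval_linearForm, eval_linearForm, hA, hlm, C_1, map_one,
          one_mul, sub_self]
    obtain ⟨hl, hm⟩ := hne (eval_linearForm l) (eval_linearForm m) hfac
    refine ⟨1, _, _, one_ne_zero, isHomogeneous_linearForm l, isHomogeneous_linearForm m, hfac, ?_⟩
    rw [hfac, VG_C_mul_mul one_ne_zero] at h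
    rw [VG_eq_hyp (eval_linearForm l), VG_eq_hyp (eval_linearForm m)] at h ⊢
    exact (ncard_union_iff hq2 hF hσ hl hm).1 h
  · rintro ⟨c, L, M, hc, hL, hM, hfac, h⟩
    obtain ⟨l, hl⟩ := exists_eval_eq_dotProduct hL
    obtain ⟨m, hm⟩ := exists_eval_eq_dotProduct hM
    obtain ⟨hl0, hm0⟩ := hne hl hm hfac
    rw [hfac, VG_C_mul_mul hc]
    rw [VG_eq_hyp hl, VG_eq_hyp hm] at h ⊢
    exact (ncard_union_iff hq2 hF hσ hl0 hm0).2 h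

end Projective

end HermitianQuadric

theorem stmt11 (q : ℕ) (hq : IsPrimePow q)
    (F : Type) [Field F] [Fintype F] (hF : Fintype.card F = q ^ 2)
    (G : MvPolynomial (Fin 5) F) (hG : G ≠ 0) (hGd : G.IsHomogeneous 2) :
    (VG G ∩ hermV3 q F).ncard = 2 * (q ^ 5 + q ^ 2) + q ^ 3 + 1 ↔
      ∃ (c : F) (L₁ L₂ : MvPolynomial (Fin 5) F), c ≠ 0 ∧
        L₁.IsHomogeneous 1 ∧ L₂.IsHomogeneous 1 ∧
        G = C c * (L₁ * L₂) ∧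
        VG L₁ ≠ VG L₂ ∧
        ¬ IsTangentHyp q (VG L₁) ∧ ¬ IsTangentHyp q (VG L₂) ∧
        ((VG L₁ ∩ VG L₂) ∩ hermV3 q F).ncard = q ^ 3 + 1 :=
  HermitianQuadric.ncard_quadric_inter_iff hq hF G hG hGd
end
end

section
/- Let q be a prime power and F a finite field with q^2 elements. Let P ∈ V_3 and let ℓ_P be a line of ℙ^4(F) with ℓ_P ∩ V_3 = {P} (a tangent line to V_3 at P). If Π is a plane of ℙ^4(F) with ℓ_P ⊆ Π and Π is not contained in T_P(V_3), then no generator of V_3 is contained in Π. -/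
open MvPolynomial

noncomputable section

section HermitianForm

variable {K V : Type*} [Field K] [AddCommGroup V] [Module K V] {σ : K →+* K}
  {h : V →ₛₗ[σ] V →ₗ[K] K}

/-- If the trace `s ↦ s + σ s` of an involution is nonzero, it maps onto the fixed field. -/
theorem exists_add_map_eq (hσ : ∀ x, σ (σ x) = x) (hs : ∃ s, s + σ s ≠ 0) {n : K}
    (hn : σ n = n) : ∃ u, u + σ u = n := by
  obtain ⟨s, hs⟩ := hs
  refine ⟨n / (s + σ s) * s, ?_⟩
  have : σ (n / (s + σ s) * s) = n / (s + σ s) * σ s := by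
    simp [hσ, hn, add_comm]
  rw [this, ← mul_add, div_mul_cancel₀ _ hs]

/-- A subspace whose isotropic vectors are all multiples of `a` is orthogonal to `a`. -/
theorem le_ker_of_isotropic_mem_span (hσ : ∀ x, σ (σ x) = x) (hs : ∃ s, s + σ s ≠ 0)
    (hh : ∀ x y, h y x = σ (h x y)) {L : Submodule K V} {a : V} (ha : a ∈ L)
    (haa : h a a = 0) (hL : ∀ v ∈ L, h v v = 0 → v ∈ K ∙ a) : L ≤ LinearMap.ker (h a) := by
  intro b hb
  rw [LinearMap.mem_ker]
  by_contra hab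
  have hba : h b a ≠ 0 := by simpa [hh a b] using hab
  obtain ⟨u, hu⟩ := exists_add_map_eq hσ hs (n := -h b b) (by simp [← hh])
  have hiso : h (b + (u / h b a) • a) (b + (u / h b a) • a) = 0 := by
    have h1 : σ (h b a) = h a b := (hh b a).symm
    simp only [map_add, map_smulₛₗ, LinearMap.add_apply, LinearMap.smul_apply, smul_eq_mul,
      haa, map_div₀, h1, RingHom.id_apply]
    field_simp
    linear_combination h a b * h b a * hu
  have hmem := hL _ (L.add_mem hb (L.smul_mem _ ha)) hiso
  obtain ⟨c, hc⟩ := Submodule.mem_span_singleton.1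
    ((Submodule.add_mem_iff_left _
      (Submodule.smul_mem _ _ (Submodule.mem_span_singleton_self a))).1 hmem)
  exact hab (by rw [← hc]; simp [haa])

/-- Polarization: any two vectors of a totally isotropic subspace are orthogonal. -/
theorem apply_eq_zero_of_isotropic (hs : ∃ s, s + σ s ≠ 0)
    (hh : ∀ x y, h y x = σ (h x y)) {G : Submodule K V} (hG : ∀ v ∈ G, h v v = 0) {x y : V}
    (hx : x ∈ G) (hy : y ∈ G) : h x y = 0 := by
  by_contra hxy
  obtain ⟨s, hs⟩ := hs
  apply hs
  have hz := hG _ (G.add_mem hx (G.smul_mem (s / h x y) hy))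
  have h1 : σ (h x y) = h y x := (hh x y).symm
  have hyx : h y x ≠ 0 := by simpa [hh x y] using hxy
  simp only [map_add, map_smulₛₗ, LinearMap.add_apply, LinearMap.smul_apply, smul_eq_mul,
      hG x hx, hG y hy, map_div₀, h1, RingHom.id_apply] at hz
  field_simp at hz
  have hprod : h x y * h y x * (s + σ s) = 0 := by linear_combination hz
  exact (mul_eq_zero.1 hprod).resolve_left (mul_ne_zero hxy hyx)

/-- If a three-dimensional space contains a plane `L` whose isotropic vectors are the multiples of
`a` and a totally isotropic plane `G`, then it is orthogonal to `a`. -/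
theorem le_ker_of_finrank_eq_three [FiniteDimensional K V]
    (hσ : ∀ x, σ (σ x) = x) (hs : ∃ s, s + σ s ≠ 0)
    (hh : ∀ x y, h y x = σ (h x y)) {L G W : Submodule K V} {a : V} (ha : a ∈ L)
    (haa : h a a = 0) (hL : ∀ v ∈ L, h v v = 0 → v ∈ K ∙ a)
    (hG : ∀ v ∈ G, h v v = 0) (hLW : L ≤ W) (hGW : G ≤ W)
    (hL2 : Module.finrank K L = 2) (hG2 : Module.finrank K G = 2)
    (hW3 : Module.finrank K W = 3) : W ≤ LinearMap.ker (h a) := by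
  have hle : L ⊓ G ≤ K ∙ a := fun v hv => hL v hv.1 (hG v hv.2)
  have hdim := Submodule.finrank_sup_add_finrank_inf_eq L G
  have hsupW : L ⊔ G ≤ W := sup_le hLW hGW
  have h1 := Submodule.finrank_mono hsupW
  have h2 := (Submodule.finrank_mono hle).trans (finrank_span_le_card {a})
  rw [Set.toFinset_singleton, Finset.card_singleton] at h2
  have hsup : L ⊔ G = W := Submodule.eq_of_le_of_finrank_le hsupW (by omega)
  have hne : L ⊓ G ≠ ⊥ := by
    intro h0
    rw [h0, finrank_bot] at hdim
    omega
  obtain ⟨v, hv, hv0⟩ := Submodule.exists_mem_ne_zero_of_ne_bot hne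
  obtain ⟨c, rfl⟩ := Submodule.mem_span_singleton.1 (hle hv)
  have haG : a ∈ G := (G.smul_mem_iff (fun hc => hv0 (by simp [hc]))).1 hv.2
  rw [← hsup]
  exact sup_le (le_ker_of_isotropic_mem_span hσ hs hh ha haa hL)
    fun y hy => apply_eq_zero_of_isotropic hs hh hG haG hy

end HermitianForm

/-- The Hermitian form `∑ i, σ (x i) * y i`. -/
def hermForm {K ι : Type*} [Field K] [Fintype ι] (σ : K →+* K) :
    (ι → K) →ₛₗ[σ] (ι → K) →ₗ[K] K :=
  LinearMap.mk₂'ₛₗ σ (RingHom.id K) (fun x y => ∑ i, σ (x i) * y i)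
    (fun x y z => by simp [add_mul, Finset.sum_add_distrib])
    (fun c x y => by simp [Finset.mul_sum, mul_assoc])
    (fun x y z => by simp [mul_add, Finset.sum_add_distrib])
    (fun c x y => by simp [Finset.mul_sum, mul_left_comm])

theorem hermForm_apply {K ι : Type*} [Field K] [Fintype ι] (σ : K →+* K) (x y : ι → K) :
    hermForm σ x y = ∑ i, σ (x i) * y i := rfl

/-- In a field with `q ^ 2` elements, `x ↦ x ^ q` is a ring homomorphism. -/
theorem exists_ringHom_eq_pow {q : ℕ} (hq : IsPrimePow q) {K : Type*} [Field K] [Fintype K]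
    (hK : Fintype.card K = q ^ 2) : ∃ σ : K →+* K, ∀ x, σ x = x ^ q := by
  obtain ⟨p, k, hp, hk, rfl⟩ := (isPrimePow_nat_iff _).1 hq
  have : Fact p.Prime := ⟨hp⟩
  have : CharP K p := charP_of_card_eq_prime_pow (f := k * 2) (by rw [hK, pow_mul])
  exact ⟨iterateFrobenius K p k, fun x => iterateFrobenius_def p k x⟩

theorem exists_add_pow_ne_zero {q : ℕ} (hq : 1 < q) {K : Type*} [Field K] [Fintype K]
    (hK : Fintype.card K = q ^ 2) : ∃ s : K, s + s ^ q ≠ 0 := by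
  by_contra! hcon
  have hdeg : (Polynomial.X ^ q + Polynomial.X : Polynomial K).natDegree = q := by
    compute_degree!
    · simp [hq.ne]
    · exact hq.le
  have hne : (Polynomial.X ^ q + Polynomial.X : Polynomial K) ≠ 0 := by
    intro h0
    rw [h0, Polynomial.natDegree_zero] at hdeg
    omega
  have hcard := Polynomial.card_le_degree_of_subset_roots
    (p := (Polynomial.X ^ q + Polynomial.X : Polynomial K)) (Z := Finset.univ) (by
      intro x _
      simp [hne, add_comm (x ^ q), hcon x])
  rw [hdeg, Finset.card_univ, hK] at hcard
  nlinarith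

theorem submodule_le_iff_rep_mem {F : Type} [Field F] (x : P4 F)
    (W : Submodule F (Fin 5 → F)) : x.submodule ≤ W ↔ x.rep ∈ W := by
  rw [Projectivization.submodule_eq, Submodule.span_singleton_le_iff_mem]

/-- Membership of a point in `hermV3` can be tested on any representative. -/
theorem mk_mem_hermV3_iff (q : ℕ) {F : Type} [Field F] {v : Fin 5 → F} (hv : v ≠ 0) :
    Projectivization.mk F v hv ∈ hermV3 q F ↔ ∑ i, v i ^ (q + 1) = 0 := by
  obtain ⟨c, hc⟩ := Projectivization.exists_smul_eq_mk_rep F v hv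
  simp [hermV3, ← hc, Units.smul_def, mul_pow, ← Finset.mul_sum]

/-- The points of a projective subspace determine the underlying linear subspace. -/
theorem le_of_setOf_submodule_le {F : Type} [Field F] {U W : Submodule F (Fin 5 → F)}
    (h : {x : P4 F | x.submodule ≤ U} ⊆ {x : P4 F | x.submodule ≤ W}) : U ≤ W := by
  intro v hv
  by_cases hv0 : v = 0
  · simp [hv0]
  · have := @h (Projectivization.mk F v hv0)
    simpa [Projectivization.submodule_mk, hv] using this

theorem stmt13 (q : ℕ) (hq : IsPrimePow q)
    (F : Type) [Field F] [Fintype F] (hF : Fintype.card F = q ^ 2)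
    (P : P4 F) (hP : P ∈ hermV3 q F)
    (ℓP : Set (P4 F)) (hℓP : IsLine F ℓP) (htan : ℓP ∩ hermV3 q F = {P})
    (Pl : Set (P4 F)) (hPl : IsPlane F Pl) (hsub : ℓP ⊆ Pl)
    (hnotsub : ¬ Pl ⊆ tangentHyp q P) :
    ∀ g : Set (P4 F), IsLine F g → g ⊆ hermV3 q F → ¬ g ⊆ Pl := by
  rintro g ⟨G, hG2, rfl⟩ hgV hgPl
  obtain ⟨L, hL2, rfl⟩ := hℓP
  obtain ⟨W, hW3, rfl⟩ := hPl
  obtain ⟨σ, hσq⟩ := exists_ringHom_eq_pow hq hF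
  have hσ : ∀ x, σ (σ x) = x := fun x => by
    rw [hσq, hσq, ← pow_mul, ← sq, ← hF, FiniteField.pow_card]
  have hs : ∃ s, s + σ s ≠ 0 := by
    simpa only [hσq] using exists_add_pow_ne_zero hq.one_lt hF
  have hh : ∀ x y : Fin 5 → F, hermForm σ y x = σ (hermForm σ x y) := fun x y => by
    simp [hermForm_apply, hσ, mul_comm]
  have hself : ∀ v : Fin 5 → F, hermForm σ v v = ∑ i, v i ^ (q + 1) := fun v => by
    simp [hermForm_apply, hσq, pow_succ]
  have hPL : P ∈ {x : P4 F | x.submodule ≤ L} :=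
    (htan.symm.subset (Set.mem_singleton P)).1
  have key : W ≤ LinearMap.ker (hermForm σ P.rep) := by
    refine le_ker_of_finrank_eq_three hσ hs hh ((submodule_le_iff_rep_mem P L).1 hPL)
      ((hself _).trans hP) (fun v hv hv0 => ?_) (fun v hv => ?_) (le_of_setOf_submodule_le hsub)
      (le_of_setOf_submodule_le hgPl) hL2 hG2 hW3
    · by_cases h0 : v = 0
      · simp [h0]
      have hmem : Projectivization.mk F v h0 ∈ ({P} : Set (P4 F)) := by
        rw [← htan]
        exact ⟨by simpa [Projectivization.submodule_mk] using hv,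
          (mk_mem_hermV3_iff q h0).2 ((hself v).symm.trans hv0)⟩
      rw [← Projectivization.submodule_eq, ← Set.mem_singleton_iff.1 hmem,
        Projectivization.submodule_mk]
      exact Submodule.mem_span_singleton_self v
    · by_cases h0 : v = 0
      · simp [h0]
      rw [hself, ← mk_mem_hermV3_iff q h0]
      exact hgV (by simpa [Projectivization.submodule_mk] using hv)
  refine hnotsub fun x hx => ?_
  have := key ((submodule_le_iff_rep_mem x W).1 hx)
  simpa [hermForm_apply, hσq, tangentHyp] using this
end
end
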